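/- Propagation of the W²_{log,1/2} seminorm for 2D Euler (smooth setting): there exists a constant C > 0 such that the following holds. Let T > 0 and let (u,ω) be a classical solution of the 2D Euler equations in vorticity form on [0,T] × 𝕋² with initial vorticity ω₀ = ω(0,·). Then for every t ∈ [0,T], [ω(t,·)]²_{1/2} ≤ [ω₀]²_{1/2} + C t ‖ω₀‖_{L²(𝕋²)} ‖ω₀‖²_{L⁴(𝕋²)}. -/

import Mathlib

open MeasureTheory ENNReal

noncomputable section

/-- The fundamental domain `[0,1)^d` of the torus `𝕋^d = ℝ^d/ℤ^d`. -/
def box (d : ℕ) : Set (Fin d → ℝ) := Set.univ.pi fun _ => Set.Ico (0:ℝ) 1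

/-- A function on `ℝ^d` is ℤ^d-periodic, i.e. it descends to the torus `𝕋^d`. -/
def IsPeriodic {d : ℕ} {E : Type*} (f : (Fin d → ℝ) → E) : Prop :=
  ∀ (x : Fin d → ℝ) (k : Fin d → ℤ), f (x + fun i => (k i : ℝ)) = f x

/-- Euclidean norm on `ℝ^d`. -/
def eNorm {d : ℕ} (h : Fin d → ℝ) : ℝ := Real.sqrt (∑ i, h i ^ 2)

/-- Geodesic distance on the torus `𝕋^d`, expressed for (representatives in) `ℝ^d`. -/
def torusDist {d : ℕ} (x y : Fin d → ℝ) : ℝ :=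
  ⨅ k : Fin d → ℤ, eNorm (x - y + fun i => (k i : ℝ))
/-- The kernel `K_h` on the torus (for representatives in `ℝ^d`). -/
def KhB (d : ℕ) (h : ℝ) (x : Fin d → ℝ) : ℝ :=
  if torusDist x 0 < 1/2 then (torusDist x 0 + h) ^ (-(d:ℝ)) else (1/2 + h) ^ (-(d:ℝ))

/-- The squared seminorm `[u]²_θ`, as a value in `[0,∞]`. -/
def jabinSqB (d : ℕ) (θ : ℝ) (u : (Fin d → ℝ) → ℝ) : ℝ≥0∞ :=
  ⨆ h ∈ Set.Ioc (0:ℝ) (1/2),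
    ENNReal.ofReal (|Real.log h| ^ (-θ)) *
      ∫⁻ x in box d, ∫⁻ y in box d,
        ENNReal.ofReal (KhB d h (x - y) * |u x - u y| ^ 2) ∂volume ∂volume
/-- `(u, ω)` is a classical solution of the 2D Euler equations in vorticity form
(on the torus, i.e. smooth and ℤ²-periodic in space): `u` is divergence-free with zero
average, `ω = ∂₁u₂ − ∂₂u₁` (Biot–Savart law) and `∂ₜω + u·∇ω = 0`. -/
def IsEulerSolution (u : ℝ → (Fin 2 → ℝ) → (Fin 2 → ℝ)) (ω : ℝ → (Fin 2 → ℝ) → ℝ) : Prop :=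
  ContDiff ℝ (⊤ : ℕ∞) (fun q : ℝ × (Fin 2 → ℝ) => u q.1 q.2) ∧
  ContDiff ℝ (⊤ : ℕ∞) (fun q : ℝ × (Fin 2 → ℝ) => ω q.1 q.2) ∧
  (∀ t, IsPeriodic (u t)) ∧ (∀ t, IsPeriodic (ω t)) ∧
  (∀ t x, ∑ i, fderiv ℝ (fun y => u t y i) x (Pi.single i 1) = 0) ∧
  (∀ t, (∫ x in box 2, u t x ∂volume) = 0) ∧
  (∀ t x, ω t x = fderiv ℝ (fun y => u t y 1) x (Pi.single 0 1)
      - fderiv ℝ (fun y => u t y 0) x (Pi.single 1 1)) ∧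
  (∀ t x, deriv (fun s => ω s x) t + ∑ i, u t x i * fderiv ℝ (ω t) x (Pi.single i 1) = 0)

/-- The `i`-th partial derivative of a real function on the plane. -/
def pd (i : Fin 2) (f : (Fin 2 → ℝ) → ℝ) : (Fin 2 → ℝ) → ℝ :=
  fun x => fderiv ℝ f x (Pi.single i 1)

/-- Smooth functions on the two-dimensional torus. -/
structure SmoothPeriodic (f : (Fin 2 → ℝ) → ℝ) : Prop where
  smooth : ContDiff ℝ (⊤ : ℕ∞) f
  periodic : IsPeriodic f

section Box

open scoped Pointwise

variable {d : ℕ}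

lemma measurableSet_box : MeasurableSet (box d) :=
  MeasurableSet.univ_pi fun _ => measurableSet_Ico

lemma box_subset_Icc : box d ⊆ Set.Icc 0 1 := fun _ hx =>
  ⟨fun i => (hx i trivial).1, fun i => (hx i trivial).2.le⟩

lemma integrableOn_of_subset_compact {X E : Type*} [TopologicalSpace X] [MeasurableSpace X]
    [OpensMeasurableSpace X] [T2Space X] {μ : Measure X} [IsFiniteMeasureOnCompacts μ]
    [NormedAddCommGroup E] [SecondCountableTopologyEither X E]
    {S K : Set X} (hK : IsCompact K) (hSK : S ⊆ K) {f : X → E} (hf : Continuous f) :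
    IntegrableOn f S μ :=
  (hf.continuousOn.integrableOn_compact hK).mono_set hSK

lemma integrableOn_box {f : (Fin d → ℝ) → ℝ} (hf : Continuous f) : IntegrableOn f (box d) :=
  integrableOn_of_subset_compact isCompact_Icc box_subset_Icc hf

lemma volume_box : volume (box d) = 1 := by
  simp [box, Real.volume_Ico, volume_pi_pi]

lemma isAddFundamentalDomain_box :
    IsAddFundamentalDomain (Submodule.span ℤ (Set.range (Pi.basisFun ℝ (Fin d)))) (box d)
      (volume : Measure (Fin d → ℝ)) := by
  have h := ZSpan.isAddFundamentalDomain (Pi.basisFun ℝ (Fin d)) (volume : Measure (Fin d → ℝ))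
  rwa [ZSpan.fundamentalDomain_pi_basisFun] at h

lemma IsPeriodic.apply_span_vadd {E : Type*} {f : (Fin d → ℝ) → E} (hf : IsPeriodic f)
    (g : Submodule.span ℤ (Set.range (Pi.basisFun ℝ (Fin d)))) (x : Fin d → ℝ) :
    f (g +ᵥ x) = f x := by
  obtain ⟨g, hg⟩ := g
  rw [Module.Basis.mem_span_iff_repr_mem] at hg
  choose k hk using hg
  have : ((⟨g, hg⟩ : Submodule.span ℤ (Set.range (Pi.basisFun ℝ (Fin d)))) +ᵥ x)
      = x + fun i => (k i : ℝ) := by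
    change g + x = _
    rw [add_comm]
    congr 1
    ext i
    simpa using (hk i).symm
  rw [this, hf]

lemma IsPeriodic.comp_add {E : Type*} {f : (Fin d → ℝ) → E} (hf : IsPeriodic f)
    (a : Fin d → ℝ) : IsPeriodic fun x => f (x + a) := fun x k => by
  change f (x + _ + a) = f (x + a)
  rw [add_right_comm, hf]

lemma isAddFundamentalDomain_translate_box (a : Fin d → ℝ) :
    IsAddFundamentalDomain (Submodule.span ℤ (Set.range (Pi.basisFun ℝ (Fin d))))
      (a +ᵥ box d) (volume : Measure (Fin d → ℝ)) :=
  isAddFundamentalDomain_box.vadd_of_comm a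

lemma IsPeriodic.setIntegral_box_comp_add {f : (Fin d → ℝ) → ℝ} (hf : IsPeriodic f)
    (a : Fin d → ℝ) : ∫ x in box d, f (x + a) = ∫ x in box d, f x := by
  have : VAddInvariantMeasure (Submodule.span ℤ (Set.range (Pi.basisFun ℝ (Fin d))))
      (Fin d → ℝ) volume :=
    inferInstanceAs (VAddInvariantMeasure
      (Submodule.span ℤ (Set.range (Pi.basisFun ℝ (Fin d)))).toAddSubgroup (Fin d → ℝ) volume)
  have h := (isAddFundamentalDomain_translate_box a).setIntegral_eq isAddFundamentalDomain_box
    (f := f) hf.apply_span_vadd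
  rw [← h]
  have e : MeasurableEmbedding (fun x : Fin d → ℝ => x + a) :=
    (Homeomorph.addRight a).measurableEmbedding
  have := (measurePreserving_add_right (volume : Measure (Fin d → ℝ)) a).setIntegral_image_emb e f
    (box d)
  rw [← this]
  congr 2
  ext x
  simp only [Set.mem_vadd_set, vadd_eq_add, Set.mem_image, add_comm]

lemma IsPeriodic.exists_mem_box {E : Type*} {f : (Fin d → ℝ) → E} (hf : IsPeriodic f)
    (x : Fin d → ℝ) : ∃ y ∈ box d, f y = f x := by
  refine ⟨x + fun i => ((-⌊x i⌋ : ℤ) : ℝ), fun i _ => ?_, hf x _⟩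
  simp only [Pi.add_apply, Int.cast_neg, ← sub_eq_add_neg]
  exact ⟨Int.fract_nonneg _, Int.fract_lt_one _⟩

lemma IsPeriodic.exists_bound {f : (Fin d → ℝ) → ℝ} (hf : IsPeriodic f)
    (hc : Continuous f) : ∃ M, 0 ≤ M ∧ ∀ x, |f x| ≤ M := by
  obtain ⟨M, hM⟩ := (isCompact_Icc (a := (0 : Fin d → ℝ)) (b := 1)).exists_bound_of_continuousOn
    hc.continuousOn
  have h : ∀ x, |f x| ≤ M := fun x => by
    obtain ⟨y, hy, hxy⟩ := hf.exists_mem_box x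
    rw [← hxy]
    exact hM y (box_subset_Icc hy)
  exact ⟨M, (abs_nonneg _).trans (h 0), h⟩

end Box

section ParametricIntegral

variable {X : Type*} [TopologicalSpace X] [T2Space X] [MeasurableSpace X] [BorelSpace X]
  {μ : Measure X} [IsFiniteMeasureOnCompacts μ] {S K : Set X}

/-- Differentiation under the integral sign over a relatively compact set. -/
lemma hasDerivAt_setIntegral (hK : IsCompact K) (hS : MeasurableSet S) (hSK : S ⊆ K)
    {F F' : ℝ → X → ℝ} {s₀ : ℝ} {U : Set ℝ} (hU : U ∈ nhds s₀)
    (hF : ∀ s, Continuous (F s)) (hF' : Continuous (Function.uncurry F'))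
    (hd : ∀ s ∈ U, ∀ x, HasDerivAt (fun r => F r x) (F' s x) s) :
    HasDerivAt (fun s => ∫ x in S, F s x ∂μ) (∫ x in S, F' s₀ x ∂μ) s₀ := by
  obtain ⟨V, hV, hVU, hVc⟩ := local_compact_nhds hU
  obtain ⟨M, hM⟩ := (hVc.prod hK).exists_bound_of_continuousOn hF'.continuousOn
  refine (hasDerivAt_integral_of_dominated_loc_of_deriv_le (F' := F') (bound := fun _ => M) hV
    (Filter.Eventually.of_forall fun s => (hF s).aestronglyMeasurable)
    (integrableOn_of_subset_compact hK hSK (hF s₀))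
    (hF'.comp (by fun_prop : Continuous fun x => (s₀, x))).aestronglyMeasurable ?_ ?_ ?_).2
  · refine (ae_restrict_iff' hS).2 (Filter.Eventually.of_forall fun x hx s hs => ?_)
    exact hM (s, x) ⟨hs, hSK hx⟩
  · exact (integrableOn_of_subset_compact hK hSK continuous_const)
  · exact Filter.Eventually.of_forall fun x s hs => hd s (hVU hs) x

lemma continuous_setIntegral {Y : Type*} [TopologicalSpace Y] [FirstCountableTopology Y]
    [LocallyCompactSpace Y]
    (hK : IsCompact K) (hS : MeasurableSet S) (hSK : S ⊆ K) {F : Y → X → ℝ}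
    (hF : Continuous (Function.uncurry F)) : Continuous fun y => ∫ x in S, F y x ∂μ := by
  refine continuous_iff_continuousAt.2 fun y₀ => ?_
  obtain ⟨V, hV, -, hVc⟩ := local_compact_nhds (Filter.univ_mem : (Set.univ : Set Y) ∈ nhds y₀)
  obtain ⟨M, hM⟩ := (hVc.prod hK).exists_bound_of_continuousOn hF.continuousOn
  refine continuousAt_of_dominated (bound := fun _ => M) ?_ ?_ ?_ ?_
  · exact Filter.Eventually.of_forall fun y =>
      (hF.comp (by fun_prop : Continuous fun x => (y, x))).aestronglyMeasurable
  · refine Filter.mem_of_superset hV fun y hy => ?_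
    refine (ae_restrict_iff' hS).2 (Filter.Eventually.of_forall fun x hx => ?_)
    exact hM (y, x) ⟨hy, hSK hx⟩
  · exact (integrableOn_of_subset_compact hK hSK continuous_const)
  · exact Filter.Eventually.of_forall fun x =>
      (hF.comp (by fun_prop : Continuous fun y => (y, x))).continuousAt

end ParametricIntegral

lemma hasDerivAt_box {d : ℕ} {F F' : ℝ → (Fin d → ℝ) → ℝ} {s₀ : ℝ} {U : Set ℝ}
    (hU : U ∈ nhds s₀) (hF : ∀ s, Continuous (F s)) (hF' : Continuous (Function.uncurry F'))
    (hd : ∀ s ∈ U, ∀ x, HasDerivAt (fun r => F r x) (F' s x) s) :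
    HasDerivAt (fun s => ∫ x in box d, F s x) (∫ x in box d, F' s₀ x) s₀ :=
  hasDerivAt_setIntegral isCompact_Icc measurableSet_box box_subset_Icc hU hF hF' hd

lemma continuous_box {d : ℕ} {Y : Type*} [TopologicalSpace Y] [FirstCountableTopology Y]
    [LocallyCompactSpace Y] {F : Y → (Fin d → ℝ) → ℝ} (hF : Continuous (Function.uncurry F)) :
    Continuous fun y => ∫ x in box d, F y x :=
  continuous_setIntegral isCompact_Icc measurableSet_box box_subset_Icc hF

/-- The derivative of a periodic function in a fixed direction has mean zero. -/
lemma IsPeriodic.setIntegral_lineDeriv_eq_zero {d : ℕ} {f f' : (Fin d → ℝ) → ℝ} {v : Fin d → ℝ}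
    (hp : IsPeriodic f) (hf : Continuous f) (hf' : Continuous f')
    (hd : ∀ x, HasLineDerivAt ℝ f (f' x) x v) : ∫ x in box d, f' x = 0 := by
  have h : HasDerivAt (fun s : ℝ => ∫ x in box d, f (x + s • v))
      (∫ x in box d, f' (x + (0 : ℝ) • v)) 0 := by
    refine hasDerivAt_box (F' := fun s x => f' (x + s • v)) Filter.univ_mem (fun s => by fun_prop)
      (by unfold Function.uncurry; fun_prop) fun s _ x => ?_
    have := hd (x + s • v)
    unfold HasLineDerivAt at this
    have h2 := HasDerivAt.comp_sub_const s s (f := fun t : ℝ => f (x + s • v + t • v))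
      (by simpa using this)
    refine h2.congr_of_eventuallyEq (Filter.Eventually.of_forall fun r => ?_)
    simp only [add_assoc, ← add_smul]
    congr 3
    ring
  simp only [hp.setIntegral_box_comp_add, zero_smul, add_zero] at h
  exact h.unique (hasDerivAt_const _ _)

namespace SmoothPeriodic

variable {f g : (Fin 2 → ℝ) → ℝ}

lemma continuous (hf : SmoothPeriodic f) : Continuous f := hf.smooth.continuous

lemma differentiable (hf : SmoothPeriodic f) : Differentiable ℝ f :=
  hf.smooth.differentiable (by simp)

lemma pd (hf : SmoothPeriodic f) (i : Fin 2) : SmoothPeriodic (pd i f) where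
  smooth := by
    have := hf.smooth.fderiv_right (m := (⊤ : ℕ∞)) (by simp)
    exact this.clm_apply contDiff_const
  periodic x k := by
    have : (fun y => f (y + fun i => (k i : ℝ))) = f := by ext y; exact hf.periodic y k
    unfold _root_.pd
    rw [← fderiv_comp_add_right, this]

lemma hasLineDerivAt (hf : SmoothPeriodic f) (i : Fin 2) (x : Fin 2 → ℝ) :
    HasLineDerivAt ℝ f (_root_.pd i f x) x (Pi.single i 1) :=
  (hf.differentiable x).hasFDerivAt.hasLineDerivAt _

lemma mul (hf : SmoothPeriodic f) (hg : SmoothPeriodic g) :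
    SmoothPeriodic (fun x => f x * g x) :=
  ⟨hf.smooth.mul hg.smooth, fun x k => by simp only [hf.periodic x k, hg.periodic x k]⟩

lemma add (hf : SmoothPeriodic f) (hg : SmoothPeriodic g) :
    SmoothPeriodic (fun x => f x + g x) :=
  ⟨hf.smooth.add hg.smooth, fun x k => by simp only [hf.periodic x k, hg.periodic x k]⟩

lemma comp_add (hf : SmoothPeriodic f) (a : Fin 2 → ℝ) : SmoothPeriodic (fun x => f (x + a)) :=
  ⟨hf.smooth.comp (contDiff_id.add contDiff_const), hf.periodic.comp_add a⟩

lemma integral_pd (hf : SmoothPeriodic f) (i : Fin 2) : ∫ x in box 2, _root_.pd i f x = 0 :=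
  hf.periodic.setIntegral_lineDeriv_eq_zero hf.continuous (hf.pd i).continuous (hf.hasLineDerivAt i)

lemma pd_mul (hf : SmoothPeriodic f) (hg : SmoothPeriodic g) (i : Fin 2) (x : Fin 2 → ℝ) :
    _root_.pd i (fun x => f x * g x) x = f x * _root_.pd i g x + g x * _root_.pd i f x := by
  unfold _root_.pd
  rw [fderiv_fun_mul (hf.differentiable x) (hg.differentiable x)]
  simp

lemma pd_add (hf : SmoothPeriodic f) (hg : SmoothPeriodic g) (i : Fin 2) (x : Fin 2 → ℝ) :
    _root_.pd i (fun x => f x + g x) x = _root_.pd i f x + _root_.pd i g x := by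
  unfold _root_.pd
  rw [fderiv_fun_add (hf.differentiable x) (hg.differentiable x)]
  simp

lemma pd_comp_add (f : (Fin 2 → ℝ) → ℝ) (a : Fin 2 → ℝ) (i : Fin 2) (x : Fin 2 → ℝ) :
    _root_.pd i (fun x => f (x + a)) x = _root_.pd i f (x + a) := by
  unfold _root_.pd
  rw [fderiv_comp_add_right]

lemma pd_comm (hf : SmoothPeriodic f) (i j : Fin 2) (x : Fin 2 → ℝ) :
    _root_.pd i (_root_.pd j f) x = _root_.pd j (_root_.pd i f) x := by
  have hd : Differentiable ℝ (fderiv ℝ f) :=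
    (hf.smooth.fderiv_right (m := (⊤ : ℕ∞)) (by simp)).differentiable (by simp)
  have key : ∀ k l : Fin 2, _root_.pd k (_root_.pd l f) x
      = fderiv ℝ (fderiv ℝ f) x (Pi.single k 1) (Pi.single l 1) := fun k l => by
    unfold _root_.pd
    rw [fderiv_clm_apply (hd x) (differentiableAt_const _)]
    simp
  rw [key, key]
  have hs : IsSymmSndFDerivAt ℝ f x := hf.smooth.contDiffAt.isSymmSndFDerivAt (by
    simpa using WithTop.coe_le_coe.2 (le_top : (2 : ℕ∞) ≤ ⊤))
  exact hs _ _

end SmoothPeriodic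

lemma fderiv_apply_eq_sum (f : (Fin 2 → ℝ) → ℝ) (y v : Fin 2 → ℝ) :
    fderiv ℝ f y v = ∑ i, v i * pd i f y := by
  have hv : v = ∑ i, v i • (Pi.single i 1 : Fin 2 → ℝ) := by
    ext j; fin_cases j <;> simp
  conv_lhs => rw [hv]
  simp only [map_sum, map_smul, smul_eq_mul, pd]

lemma integrable_exp_neg_mul_sq_add_sq {a : ℝ} (ha : 0 < a) :
    Integrable fun z : Fin 2 → ℝ => Real.exp (-a * (z 0 ^ 2 + z 1 ^ 2)) := by
  have h := Integrable.fintype_prod (ι := Fin 2) (f := fun (_ : Fin 2) (x : ℝ) => Real.exp (-a * x ^ 2))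
    fun _ => integrable_exp_neg_mul_sq ha
  refine (integrable_congr (Filter.Eventually.of_forall fun z => ?_)).1 h
  simp only [Fin.prod_univ_two, ← Real.exp_add]
  ring_nf

lemma integral_exp_neg_mul_sq_add_sq (a : ℝ) :
    ∫ z : Fin 2 → ℝ, Real.exp (-a * (z 0 ^ 2 + z 1 ^ 2)) = √(Real.pi / a) ^ 2 := by
  have h := integral_fintype_prod_volume_eq_prod (ι := Fin 2) (E := fun _ => ℝ)
    (f := fun (_ : Fin 2) (x : ℝ) => Real.exp (-a * x ^ 2))
  simp only [integral_gaussian, Fin.prod_univ_two, ← Real.exp_add] at h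
  rw [sq, ← h]
  congr 1
  ext z
  ring_nf

/-- The heat kernel of the plane at time one. -/
def gaussKernel (z : Fin 2 → ℝ) : ℝ :=
  (4 * Real.pi)⁻¹ * Real.exp (-(1 / 4) * (z 0 ^ 2 + z 1 ^ 2))

lemma continuous_gaussKernel : Continuous gaussKernel := by
  unfold gaussKernel
  fun_prop

lemma gaussKernel_nonneg (z : Fin 2 → ℝ) : 0 ≤ gaussKernel z := by
  unfold gaussKernel
  positivity

lemma gaussKernel_neg (z : Fin 2 → ℝ) : gaussKernel (-z) = gaussKernel z := by
  simp [gaussKernel]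

lemma integrable_gaussKernel : Integrable gaussKernel :=
  (integrable_exp_neg_mul_sq_add_sq (by norm_num)).const_mul _

lemma integral_gaussKernel : ∫ z, gaussKernel z = 1 := by
  unfold gaussKernel
  rw [integral_const_mul, integral_exp_neg_mul_sq_add_sq, Real.sq_sqrt (by positivity)]
  field_simp

lemma abs_le_two_mul_exp (t : ℝ) : |t| ≤ 2 * Real.exp (t ^ 2 / 8) := by
  have h := Real.add_one_le_exp (t ^ 2 / 8)
  rcases abs_cases t with ⟨h1, _⟩ | ⟨h1, _⟩ <;> rw [h1] <;>
    nlinarith [sq_nonneg (t - 2), sq_nonneg (t + 2)]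

lemma abs_coord_mul_gaussKernel_le (i : Fin 2) (z : Fin 2 → ℝ) :
    |z i| * gaussKernel z ≤ 2 * (4 * Real.pi)⁻¹ * Real.exp (-(1 / 8) * (z 0 ^ 2 + z 1 ^ 2)) := by
  have h1 : |z i| ≤ 2 * Real.exp ((1 / 8) * (z 0 ^ 2 + z 1 ^ 2)) := by
    refine (abs_le_two_mul_exp _).trans ?_
    gcongr
    fin_cases i <;> simp <;> nlinarith [sq_nonneg (z 0), sq_nonneg (z 1)]
  calc |z i| * gaussKernel z
      ≤ 2 * Real.exp ((1 / 8) * (z 0 ^ 2 + z 1 ^ 2)) * gaussKernel z := by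
        gcongr
        exact gaussKernel_nonneg z
    _ = _ := by
        unfold gaussKernel
        have : Real.exp (-(1 / 8) * (z 0 ^ 2 + z 1 ^ 2)) = Real.exp ((1 / 8) * (z 0 ^ 2 + z 1 ^ 2))
          * Real.exp (-(1 / 4) * (z 0 ^ 2 + z 1 ^ 2)) := by
          rw [← Real.exp_add]
          ring_nf
        rw [this]
        ring

lemma integrable_coord_mul_gaussKernel (i : Fin 2) :
    Integrable fun z : Fin 2 → ℝ => z i * gaussKernel z := by
  refine ((integrable_exp_neg_mul_sq_add_sq (a := 1 / 8) (by norm_num)).const_mul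
    (2 * (4 * Real.pi)⁻¹)).mono'
    (((continuous_apply i).mul continuous_gaussKernel).aestronglyMeasurable)
    (Filter.Eventually.of_forall fun z => ?_)
  rw [Real.norm_eq_abs, abs_mul, abs_of_nonneg (gaussKernel_nonneg z)]
  exact abs_coord_mul_gaussKernel_le i z

lemma hasFDerivAt_gaussKernel (z : Fin 2 → ℝ) :
    HasFDerivAt gaussKernel (gaussKernel z • (-(1 / 4 : ℝ)) •
      ((2 * z 0) • ContinuousLinearMap.proj (R := ℝ) (φ := fun _ : Fin 2 => ℝ) 0
        + (2 * z 1) • ContinuousLinearMap.proj (R := ℝ) (φ := fun _ : Fin 2 => ℝ) 1)) z := by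
  have h0 : HasFDerivAt (fun z : Fin 2 → ℝ => z 0) (ContinuousLinearMap.proj 0 : _ →L[ℝ] ℝ) z :=
    hasFDerivAt_apply 0 z
  have h1 : HasFDerivAt (fun z : Fin 2 → ℝ => z 1) (ContinuousLinearMap.proj 1 : _ →L[ℝ] ℝ) z :=
    hasFDerivAt_apply 1 z
  have := ((((h0.pow 2).add (h1.pow 2)).const_mul (-(1 / 4 : ℝ))).exp).const_mul (4 * Real.pi)⁻¹
  refine this.congr_fderiv ?_
  ext v
  simp [gaussKernel]
  ring

lemma pd_gaussKernel (i : Fin 2) (z : Fin 2 → ℝ) :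
    pd i gaussKernel z = -(1 / 2) * (z i * gaussKernel z) := by
  unfold pd
  rw [(hasFDerivAt_gaussKernel z).fderiv]
  fin_cases i <;> simp <;> ring

/-- The heat semigroup acting on functions on the plane; it is the identity for `s ≤ 0`. -/
def heat (f : (Fin 2 → ℝ) → ℝ) (s : ℝ) (x : Fin 2 → ℝ) : ℝ :=
  ∫ z, gaussKernel z * f (x + √s • z)

lemma integrable_gaussKernel_mul {f : (Fin 2 → ℝ) → ℝ} (hc : Continuous f) {M : ℝ}
    (hM : ∀ x, |f x| ≤ M) : Integrable fun z => gaussKernel z * f z := by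
  refine (integrable_gaussKernel.mul_const M).mono'
    ((continuous_gaussKernel.mul hc).aestronglyMeasurable) (Filter.Eventually.of_forall fun z => ?_)
  rw [Real.norm_eq_abs, abs_mul, abs_of_nonneg (gaussKernel_nonneg z)]
  gcongr
  · exact gaussKernel_nonneg z
  · exact hM z

lemma continuous_integral_gaussKernel_mul {Y : Type*} [TopologicalSpace Y]
    [FirstCountableTopology Y] {F : Y → (Fin 2 → ℝ) → ℝ} (hF : Continuous (Function.uncurry F))
    {M : ℝ} (hM : ∀ y z, |F y z| ≤ M) : Continuous fun y => ∫ z, gaussKernel z * F y z := by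
  refine continuous_of_dominated (bound := fun z => gaussKernel z * M) (fun y => ?_) (fun y => ?_)
    (integrable_gaussKernel.mul_const M) (Filter.Eventually.of_forall fun z => ?_)
  · exact (continuous_gaussKernel.mul
      (hF.comp (by fun_prop : Continuous fun z => (y, z)))).aestronglyMeasurable
  · refine Filter.Eventually.of_forall fun z => ?_
    rw [Real.norm_eq_abs, abs_mul, abs_of_nonneg (gaussKernel_nonneg z)]
    gcongr
    · exact gaussKernel_nonneg z
    · exact hM y z
  · exact continuous_const.mul (hF.comp (by fun_prop : Continuous fun y => (y, z)))

lemma heat_of_nonpos (f : (Fin 2 → ℝ) → ℝ) {s : ℝ} (hs : s ≤ 0) : heat f s = f := by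
  ext x
  simp [heat, Real.sqrt_eq_zero_of_nonpos hs, integral_mul_const, integral_gaussKernel]

namespace SmoothPeriodic

variable {f : (Fin 2 → ℝ) → ℝ}

lemma exists_bound (hf : SmoothPeriodic f) : ∃ M, 0 ≤ M ∧ ∀ x, |f x| ≤ M :=
  hf.periodic.exists_bound hf.continuous

lemma continuous_heat (hf : SmoothPeriodic f) : Continuous (Function.uncurry (heat f)) := by
  obtain ⟨M, -, hM⟩ := hf.exists_bound
  refine continuous_integral_gaussKernel_mul (Y := ℝ × (Fin 2 → ℝ))
    (F := fun q z => f (q.2 + √q.1 • z)) ?_ fun q z => hM _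
  exact hf.continuous.comp (by fun_prop)

lemma heat_periodic (hf : SmoothPeriodic f) (s : ℝ) : IsPeriodic (heat f s) := fun x k => by
  unfold heat
  congr 1
  ext z
  rw [add_right_comm, hf.periodic]

lemma hasFDerivAt_heat (hf : SmoothPeriodic f) (s : ℝ) (x : Fin 2 → ℝ) :
    HasFDerivAt (heat f s) (∑ i, heat (_root_.pd i f) s x •
      ContinuousLinearMap.proj (R := ℝ) (φ := fun _ : Fin 2 => ℝ) i) x := by
  choose M hM0 hM using fun i => (hf.pd i).exists_bound
  obtain ⟨M', -, hM'⟩ := hf.exists_bound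
  set P : Fin 2 → ((Fin 2 → ℝ) →L[ℝ] ℝ) :=
    fun i => ContinuousLinearMap.proj (R := ℝ) (φ := fun _ : Fin 2 => ℝ) i with hP
  have hfd : ∀ y, fderiv ℝ f y = ∑ i, _root_.pd i f y • P i := fun y => by
    ext v
    have hv : v = ∑ i, v i • (Pi.single i 1 : Fin 2 → ℝ) := by
      ext j; fin_cases j <;> simp
    conv_lhs => rw [hv]
    simp [_root_.pd, hP, mul_comm]
  have hInt : ∀ i, Integrable fun z => gaussKernel z * _root_.pd i f (x + √s • z) := fun i =>
    integrable_gaussKernel_mul (f := fun z => _root_.pd i f (x + √s • z))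
      ((hf.pd i).continuous.comp (by fun_prop)) fun z => hM i _
  have key := hasFDerivAt_integral_of_dominated_of_fderiv_le (𝕜 := ℝ) (μ := volume) (x₀ := x)
    (F := fun y z => gaussKernel z * f (y + √s • z)) (s := Set.univ)
    (F' := fun y z => gaussKernel z • ∑ i, _root_.pd i f (y + √s • z) • P i)
    (bound := fun z => gaussKernel z * ∑ i, M i * ‖P i‖) Filter.univ_mem
    (Filter.Eventually.of_forall fun y => (continuous_gaussKernel.mul
      (hf.continuous.comp (by fun_prop))).aestronglyMeasurable)
    (integrable_gaussKernel_mul (f := fun z => f (x + √s • z))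
      (hf.continuous.comp (by fun_prop)) fun z => hM' _)
    ?_ ?_ (integrable_gaussKernel.mul_const _) ?_
  · refine key.congr_fderiv ?_
    simp only [heat, Finset.smul_sum, smul_smul]
    rw [integral_finsetSum _ fun i _ => (hInt i).smul_const _]
    simp only [integral_smul_const]
    rfl
  · refine Continuous.aestronglyMeasurable (continuous_gaussKernel.smul
      (continuous_finsetSum _ fun i _ => ?_))
    have : Continuous fun z : Fin 2 → ℝ => _root_.pd i f (x + √s • z) :=
      (hf.pd i).continuous.comp (by fun_prop)
    exact this.smul continuous_const
  · refine Filter.Eventually.of_forall fun z y _ => ?_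
    rw [norm_smul, Real.norm_eq_abs, abs_of_nonneg (gaussKernel_nonneg z)]
    refine mul_le_mul_of_nonneg_left ((norm_sum_le _ _).trans (Finset.sum_le_sum fun i _ => ?_))
      (gaussKernel_nonneg z)
    rw [norm_smul]
    exact mul_le_mul_of_nonneg_right (hM i _) (norm_nonneg _)
  · refine Filter.Eventually.of_forall fun z y _ => ?_
    rw [← hfd]
    have h := (hf.differentiable (y + √s • z)).hasFDerivAt.comp y
      ((hasFDerivAt_id y).add_const (√s • z))
    exact (h.const_mul (gaussKernel z)).congr_fderiv (by ext v; simp)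

lemma pd_heat (hf : SmoothPeriodic f) (s : ℝ) (i : Fin 2) :
    _root_.pd i (heat f s) = heat (_root_.pd i f) s := by
  ext x
  rw [_root_.pd, (hf.hasFDerivAt_heat s x).fderiv]
  fin_cases i <;> simp

lemma contDiff_heat (n : ℕ) : ∀ {f : (Fin 2 → ℝ) → ℝ}, SmoothPeriodic f → ∀ s,
    ContDiff ℝ n (heat f s) := by
  induction n with
  | zero =>
    intro f hf s
    exact contDiff_zero.2 (hf.continuous_heat.comp (by fun_prop : Continuous fun x => (s, x)))
  | succ n ih =>
    intro f hf s
    refine (contDiff_succ_iff_hasFDerivAt (n := n)).2 ⟨_, ?_, fun x => hf.hasFDerivAt_heat s x⟩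
    exact ContDiff.sum fun i _ => (ih (hf.pd i) s).smul contDiff_const

protected lemma heat (hf : SmoothPeriodic f) (s : ℝ) : SmoothPeriodic (heat f s) :=
  ⟨contDiff_infty.2 fun n => contDiff_heat n hf s, hf.heat_periodic s⟩

lemma hasDerivAt_heat (hf : SmoothPeriodic f) {s : ℝ} (hs : 0 < s) (x : Fin 2 → ℝ) :
    HasDerivAt (fun r => heat f r x)
      (heat (_root_.pd 0 (_root_.pd 0 f)) s x + heat (_root_.pd 1 (_root_.pd 1 f)) s x) s := by
  choose M hM0 hM using fun i => (hf.pd i).exists_bound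
  obtain ⟨M', -, hM'⟩ := hf.exists_bound
  have hsmooth : ∀ {g : (Fin 2 → ℝ) → ℝ}, SmoothPeriodic g →
      Continuous fun z : Fin 2 → ℝ => g (x + √s • z) := fun hg => hg.continuous.comp (by fun_prop)
  have hInt : ∀ i, Integrable fun z : Fin 2 → ℝ =>
      z i * gaussKernel z * _root_.pd i f (x + √s • z) := fun i => by
    refine (integrable_coord_mul_gaussKernel i).mul_bdd (c := M i)
      (hsmooth (hf.pd i)).aestronglyMeasurable (Filter.Eventually.of_forall fun z => hM i _)
  have key := hasDerivAt_integral_of_dominated_loc_of_deriv_le (𝕜 := ℝ) (μ := volume) (x₀ := s)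
    (F := fun r z => gaussKernel z * f (x + √r • z)) (s := Set.Ioi (s / 2))
    (F' := fun r z => gaussKernel z * ((2 * √r)⁻¹ * ∑ i, z i * _root_.pd i f (x + √r • z)))
    (bound := fun z => ∑ i, (2 * √(s / 2))⁻¹ * M i *
      (2 * (4 * Real.pi)⁻¹ * Real.exp (-(1 / 8) * (z 0 ^ 2 + z 1 ^ 2))))
    (Ioi_mem_nhds (by linarith))
    (Filter.Eventually.of_forall fun y => (continuous_gaussKernel.mul
      (hf.continuous.comp (by fun_prop))).aestronglyMeasurable)
    (integrable_gaussKernel_mul (f := fun z => f (x + √s • z)) (hsmooth hf) fun z => hM' _)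
    ?_ ?_ ?_ ?_
  · have h2 := key.2
    have e : (∫ z, gaussKernel z * ((2 * √s)⁻¹ * ∑ i, z i * _root_.pd i f (x + √s • z)))
        = ∑ i, heat (_root_.pd i (_root_.pd i f)) s x := by
      have e1 : ∀ z : Fin 2 → ℝ,
          gaussKernel z * ((2 * √s)⁻¹ * ∑ i, z i * _root_.pd i f (x + √s • z))
          = ∑ i, (2 * √s)⁻¹ * (z i * gaussKernel z * _root_.pd i f (x + √s • z)) := fun z => by
        rw [← Finset.mul_sum, ← mul_assoc, mul_comm (gaussKernel z), mul_assoc, Finset.mul_sum]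
        congr 2
        ext i
        ring
      simp only [e1]
      rw [integral_finsetSum _ fun i _ => (hInt i).const_mul _]
      refine Finset.sum_congr rfl fun i _ => ?_
      have hder : ∀ z, HasFDerivAt (fun z => _root_.pd i f (x + √s • z))
          (√s • fderiv ℝ (_root_.pd i f) (x + √s • z)) z := fun z => by
        have h1 := ((hf.pd i).differentiable (x + √s • z)).hasFDerivAt
        have h2 : HasFDerivAt (fun z : Fin 2 → ℝ => x + √s • z)
          (√s • ContinuousLinearMap.id ℝ (Fin 2 → ℝ)) z :=
          ((hasFDerivAt_id z).const_smul (√s)).const_add x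
        have := h1.comp z h2
        exact this.congr_fderiv (by ext v; simp)
      have ibp := integral_mul_fderiv_eq_neg_fderiv_mul_of_integrable (μ := volume)
        (f := gaussKernel) (g := fun z => _root_.pd i f (x + √s • z)) (v := Pi.single i (1 : ℝ))
        ?_ ?_ ?_ (fun z _ => (hasFDerivAt_gaussKernel z).differentiableAt)
        (fun z _ => (hder z).differentiableAt)
      · have l1 : ∀ z, fderiv ℝ (fun z => _root_.pd i f (x + √s • z)) z (Pi.single i 1)
            = √s * _root_.pd i (_root_.pd i f) (x + √s • z) := fun z => by
          rw [(hder z).fderiv]; rfl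
        have l2 : ∀ z, fderiv ℝ gaussKernel z (Pi.single i 1)
            = -(1 / 2) * (z i * gaussKernel z) := fun z => pd_gaussKernel i z
        simp only [l1, l2] at ibp
        rw [integral_const_mul]
        have l3 : ∫ z : Fin 2 → ℝ, -(1 / 2) * (z i * gaussKernel z) * _root_.pd i f (x + √s • z)
            = -(1 / 2) * ∫ z : Fin 2 → ℝ, z i * gaussKernel z * _root_.pd i f (x + √s • z) := by
          rw [← integral_const_mul]
          congr 1
          ext z
          ring
        have l4 : ∫ z, gaussKernel z * (√s * _root_.pd i (_root_.pd i f) (x + √s • z))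
            = √s * heat (_root_.pd i (_root_.pd i f)) s x := by
          rw [heat, ← integral_const_mul]
          congr 1
          ext z
          ring
        rw [l3, l4] at ibp
        have : (√s) ≠ 0 := (Real.sqrt_pos.2 hs).ne'
        field_simp
        linarith
      · have l2 : ∀ z, fderiv ℝ gaussKernel z (Pi.single i 1)
            = -(1 / 2) * (z i * gaussKernel z) := fun z => pd_gaussKernel i z
        simp only [l2]
        refine ((hInt i).const_mul (-(1 / 2))).congr (Filter.Eventually.of_forall fun z => ?_)
        simp only
        ring
      · have l1 : ∀ z, fderiv ℝ (fun z => _root_.pd i f (x + √s • z)) z (Pi.single i 1)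
            = √s * _root_.pd i (_root_.pd i f) (x + √s • z) := fun z => by
          rw [(hder z).fderiv]; rfl
        simp only [l1]
        obtain ⟨M₂, -, hM₂⟩ := ((hf.pd i).pd i).exists_bound
        have := integrable_gaussKernel_mul (f := fun z => _root_.pd i (_root_.pd i f) (x + √s • z))
          (hsmooth ((hf.pd i).pd i)) fun z => hM₂ _
        refine (this.const_mul (√s)).congr (Filter.Eventually.of_forall fun z => ?_)
        simp only
        ring
      · exact integrable_gaussKernel_mul (f := fun z => _root_.pd i f (x + √s • z))
          (hsmooth (hf.pd i)) fun z => hM i _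
    rw [e, Fin.sum_univ_two] at h2
    exact h2
  · refine (continuous_gaussKernel.mul (continuous_const.mul
      (continuous_finsetSum _ fun i _ => ?_))).aestronglyMeasurable
    exact (continuous_apply i).mul (hsmooth (hf.pd i))
  · refine Filter.Eventually.of_forall fun z r hr => ?_
    have hr' : s / 2 < r := hr
    rw [Real.norm_eq_abs, ← mul_assoc, Finset.mul_sum]
    refine (Finset.abs_sum_le_sum_abs _ _).trans (Finset.sum_le_sum fun i _ => ?_)
    have hg := abs_coord_mul_gaussKernel_le i z
    have h1 : (2 * √r)⁻¹ ≤ (2 * √(s / 2))⁻¹ := by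
      have : 0 < √(s / 2) := Real.sqrt_pos.2 (by linarith)
      gcongr
    have h2 : 0 ≤ (2 * √r)⁻¹ := by positivity
    rw [abs_mul, abs_mul, abs_mul, abs_of_nonneg (gaussKernel_nonneg z), abs_of_nonneg h2]
    calc gaussKernel z * (2 * √r)⁻¹ * (|z i| * |_root_.pd i f (x + √r • z)|)
        = (2 * √r)⁻¹ * |_root_.pd i f (x + √r • z)| * (|z i| * gaussKernel z) := by ring
      _ ≤ _ := by
        gcongr
        · exact mul_nonneg (abs_nonneg _) (gaussKernel_nonneg z)
        · exact mul_nonneg (by positivity) (hM0 i)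
        · exact hM i _
  · exact integrable_finsetSum _ fun i _ =>
      ((integrable_exp_neg_mul_sq_add_sq (a := 1 / 8) (by norm_num)).const_mul _).const_mul _
  · refine Filter.Eventually.of_forall fun z r hr => ?_
    have hr' : 0 < r := by have : s / 2 < r := hr; linarith
    have h1 := (hf.differentiable (x + √r • z)).hasFDerivAt
    have h2 : HasDerivAt (fun r : ℝ => x + √r • z) ((1 / (2 * √r)) • z) r :=
      ((Real.hasDerivAt_sqrt hr'.ne').smul_const z).const_add x
    have h3 := (h1.comp_hasDerivAt r h2).const_mul (gaussKernel z)
    refine h3.congr_deriv ?_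
    congr 1
    rw [map_smul, smul_eq_mul, one_div]
    congr 1
    exact fderiv_apply_eq_sum f _ z

end SmoothPeriodic

/-- The squared Euclidean length of the gradient. -/
def gradSq (f : (Fin 2 → ℝ) → ℝ) (x : Fin 2 → ℝ) : ℝ := pd 0 f x ^ 2 + pd 1 f x ^ 2

lemma hessian_cross_term_le (s v a b A B C : ℝ) :
    -(4 * s * v * ((a ^ 2 + b ^ 2) * (A + C) + 2 * (a ^ 2 * A + 2 * a * b * B + b ^ 2 * C)))
      ≤ (a ^ 2 + b ^ 2) * (4 * s ^ 2 * (A ^ 2 + 2 * B ^ 2 + C ^ 2) + 16 * v ^ 2) := by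
  set K := (a ^ 2 + b ^ 2) * (A + C) + 2 * (a ^ 2 * A + 2 * a * b * B + b ^ 2 * C) with hK
  set p := a ^ 2 + b ^ 2 with hp
  set H := A ^ 2 + 2 * B ^ 2 + C ^ 2 with hH
  have hp0 : 0 ≤ p := by positivity
  have hH0 : 0 ≤ H := by positivity
  have h1 : K ^ 2 ≤ p ^ 2 * ((3 * A + C) ^ 2 + 8 * B ^ 2 + (A + 3 * C) ^ 2) := by
    have e : K = a ^ 2 * (3 * A + C) + 2 * (a * b * (2 * B)) + b ^ 2 * (A + 3 * C) := by
      rw [hK, hp]; ring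
    rw [e, hp]
    nlinarith [sq_nonneg (a ^ 2 * (2 * B) - a * b * (3 * A + C)),
      sq_nonneg (b ^ 2 * (2 * B) - a * b * (A + 3 * C)),
      sq_nonneg (a ^ 2 * (A + 3 * C) - b ^ 2 * (3 * A + C))]
  have h2 : K ^ 2 ≤ 16 * p ^ 2 * H := by
    have : (3 * A + C) ^ 2 + 8 * B ^ 2 + (A + 3 * C) ^ 2 ≤ 16 * H := by
      rw [hH]; nlinarith [sq_nonneg (A - C), sq_nonneg B]
    nlinarith [mul_le_mul_of_nonneg_left this (sq_nonneg p)]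
  refine (neg_le_abs _).trans (abs_le_of_sq_le_sq ?_ (by positivity))
  have h3 : (4 * s * v * K) ^ 2 ≤ (4 * s * v) ^ 2 * (16 * p ^ 2 * H) := by
    rw [mul_pow]; gcongr
  refine h3.trans ?_
  have : (4 * s * v) ^ 2 * (16 * p ^ 2 * H) = p ^ 2 * (4 * (4 * s ^ 2 * H) * (16 * v ^ 2)) := by ring
  rw [this, mul_pow]
  have := four_mul_le_sq_add (4 * s ^ 2 * H) (16 * v ^ 2)
  gcongr

namespace SmoothPeriodic

lemma integral_dissipation_le {v : (Fin 2 → ℝ) → ℝ} (hv : SmoothPeriodic v) (s : ℝ) :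
    ∫ x in box 2, (4 * s * gradSq v x ^ 2
      + 4 * s ^ 2 * gradSq v x *
        (_root_.pd 0 v x * (_root_.pd 0 (_root_.pd 0 (_root_.pd 0 v)) x
          + _root_.pd 1 (_root_.pd 1 (_root_.pd 0 v)) x)
        + _root_.pd 1 v x * (_root_.pd 0 (_root_.pd 0 (_root_.pd 1 v)) x
          + _root_.pd 1 (_root_.pd 1 (_root_.pd 1 v)) x))
      + 16 / 3 * (v x ^ 3 * (_root_.pd 0 (_root_.pd 0 v) x + _root_.pd 1 (_root_.pd 1 v) x))) ≤ 0 := by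
  have hcomm : _root_.pd 1 (_root_.pd 0 v) = _root_.pd 0 (_root_.pd 1 v) := by
    ext x; exact hv.pd_comm 1 0 x
  rw [hcomm]
  have ha := hv.pd 0
  have hb := hv.pd 1
  have hA := ha.pd 0
  have hB := hb.pd 0
  have hC := hb.pd 1
  have hv0 := fun x => hv.hasLineDerivAt 0 x
  have hv1 := fun x => hv.hasLineDerivAt 1 x
  have ha0 := fun x => ha.hasLineDerivAt 0 x
  have ha1 := fun x => ha.hasLineDerivAt 1 x
  have hb0 := fun x => hb.hasLineDerivAt 0 x
  have hb1 := fun x => hb.hasLineDerivAt 1 x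
  have hA0 := fun x => hA.hasLineDerivAt 0 x
  have hB0 := fun x => hB.hasLineDerivAt 0 x
  have hB1 := fun x => hB.hasLineDerivAt 1 x
  have hC1 := fun x => hC.hasLineDerivAt 1 x
  rw [hcomm] at ha1
  have c0 := hv.continuous
  have c1 := ha.continuous
  have c2 := hb.continuous
  have c3 := hA.continuous
  have c4 := hB.continuous
  have c5 := hC.continuous
  have c6 := (hA.pd 0).continuous
  have c7 := (hB.pd 0).continuous
  have c8 := (hB.pd 1).continuous
  have c9 := (hC.pd 1).continuous
  have p0 := hv.periodic
  have p1 := ha.periodic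
  have p2 := hb.periodic
  have p3 := hA.periodic
  have p4 := hB.periodic
  have p5 := hC.periodic
  unfold gradSq
  generalize _root_.pd 0 (_root_.pd 0 (_root_.pd 0 v)) = A0 at *
  generalize _root_.pd 0 (_root_.pd 0 (_root_.pd 1 v)) = B0 at *
  generalize _root_.pd 1 (_root_.pd 0 (_root_.pd 1 v)) = B1 at *
  generalize _root_.pd 1 (_root_.pd 1 (_root_.pd 1 v)) = C1 at *
  generalize _root_.pd 0 (_root_.pd 0 v) = A at *
  generalize _root_.pd 0 (_root_.pd 1 v) = B at *
  generalize _root_.pd 1 (_root_.pd 1 v) = C at *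
  generalize _root_.pd 0 v = a at *
  generalize _root_.pd 1 v = b at *
  have i0 := IsPeriodic.setIntegral_lineDeriv_eq_zero (d := 2) (v := Pi.single 0 1)
    (f := fun x => -4 * s ^ 2 * ((a x ^ 2 + b x ^ 2) * (a x * A x + b x * B x))
      - 16 / 3 * (v x ^ 3 * a x) - 4 * s * (v x * a x * (a x ^ 2 + b x ^ 2)))
    (f' := fun x => -4 * s ^ 2 * ((2 * a x * A x + 2 * b x * B x) * (a x * A x + b x * B x)
        + (a x ^ 2 + b x ^ 2) * (A x * A x + a x * A0 x + (B x * B x + b x * B0 x)))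
      - 16 / 3 * (3 * v x ^ 2 * a x * a x + v x ^ 3 * A x)
      - 4 * s * ((a x * a x + v x * A x) * (a x ^ 2 + b x ^ 2)
        + v x * a x * (2 * a x * A x + 2 * b x * B x)))
    (fun x k => by simp only [p0 x k, p1 x k, p2 x k, p3 x k, p4 x k])
    (by fun_prop) (by fun_prop) (fun x => by
      have dv := hv0 x
      have da := ha0 x
      have db := hb0 x
      have dA := hA0 x
      have dB := hB0 x
      unfold HasLineDerivAt at *
      refine ((((((da.fun_pow 2).fun_add (db.fun_pow 2)).fun_mul
        ((da.fun_mul dA).fun_add (db.fun_mul dB))).const_mul (-4 * s ^ 2)).fun_sub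
        (((dv.fun_pow 3).fun_mul da).const_mul (16 / 3))).fun_sub
        (((dv.fun_mul da).fun_mul
          ((da.fun_pow 2).fun_add (db.fun_pow 2))).const_mul (4 * s))).congr_deriv ?_
      simp
      try ring)
  have i1 := IsPeriodic.setIntegral_lineDeriv_eq_zero (d := 2) (v := Pi.single 1 1)
    (f := fun x => -4 * s ^ 2 * ((a x ^ 2 + b x ^ 2) * (a x * B x + b x * C x))
      - 16 / 3 * (v x ^ 3 * b x) - 4 * s * (v x * b x * (a x ^ 2 + b x ^ 2)))
    (f' := fun x => -4 * s ^ 2 * ((2 * a x * B x + 2 * b x * C x) * (a x * B x + b x * C x)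
        + (a x ^ 2 + b x ^ 2) * (B x * B x + a x * B1 x + (C x * C x + b x * C1 x)))
      - 16 / 3 * (3 * v x ^ 2 * b x * b x + v x ^ 3 * C x)
      - 4 * s * ((b x * b x + v x * C x) * (a x ^ 2 + b x ^ 2)
        + v x * b x * (2 * a x * B x + 2 * b x * C x)))
    (fun x k => by simp only [p0 x k, p1 x k, p2 x k, p4 x k, p5 x k])
    (by fun_prop) (by fun_prop) (fun x => by
      have dv := hv1 x
      have da := ha1 x
      have db := hb1 x
      have dB := hB1 x
      have dC := hC1 x
      unfold HasLineDerivAt at *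
      refine ((((((da.fun_pow 2).fun_add (db.fun_pow 2)).fun_mul
        ((da.fun_mul dB).fun_add (db.fun_mul dC))).const_mul (-4 * s ^ 2)).fun_sub
        (((dv.fun_pow 3).fun_mul db).const_mul (16 / 3))).fun_sub
        (((dv.fun_mul db).fun_mul
          ((da.fun_pow 2).fun_add (db.fun_pow 2))).const_mul (4 * s))).congr_deriv ?_
      simp
      try ring)
  conv_lhs =>
    rw [← add_zero (∫ x in box 2, _), ← i0, ← integral_add (integrableOn_box (by fun_prop))
      (integrableOn_box (by fun_prop)), ← add_zero (∫ x in box 2, _), ← i1,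
      ← integral_add (integrableOn_box (by fun_prop)) (integrableOn_box (by fun_prop))]
  refine integral_nonpos (E := ℝ) fun x => ?_
  have h := hessian_cross_term_le s (v x) (a x) (b x) (A x) (B x) (C x)
  have h1 : 0 ≤ s ^ 2 * ((a x * A x + b x * B x) ^ 2 + (a x * B x + b x * C x) ^ 2) := by positivity
  simp only [Pi.zero_apply]
  linarith

lemma continuous_gradSq_heat {f : (Fin 2 → ℝ) → ℝ} (hf : SmoothPeriodic f) :
    Continuous fun q : ℝ × (Fin 2 → ℝ) => gradSq (heat f q.1) q.2 := by
  simp only [gradSq, hf.pd_heat]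
  exact ((hf.pd 0).continuous_heat.pow 2).add ((hf.pd 1).continuous_heat.pow 2)

lemma continuous_integral_gradSq_heat {f : (Fin 2 → ℝ) → ℝ} (hf : SmoothPeriodic f) :
    Continuous fun s => ∫ x in box 2, gradSq (heat f s) x ^ 2 :=
  continuous_box (hf.continuous_gradSq_heat.pow 2)

/-- The `L⁴` energy estimate for the heat flow. -/
lemma integral_mul_gradSq_heat_le {f : (Fin 2 → ℝ) → ℝ} (hf : SmoothPeriodic f) {S : ℝ}
    (hS : 0 ≤ S) : ∫ s in (0 : ℝ)..S, s * ∫ x in box 2, gradSq (heat f s) x ^ 2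
      ≤ 2 / 3 * ∫ x in box 2, f x ^ 4 := by
  set Q := fun s => ∫ x in box 2, gradSq (heat f s) x ^ 2 with hQ
  have hQc : Continuous Q := hf.continuous_integral_gradSq_heat
  have cg := hf.continuous_gradSq_heat
  have cf := hf.continuous_heat
  set L := fun s => ∫ x in box 2, (s ^ 2 * gradSq (heat f s) x ^ 2 + 4 / 3 * heat f s x ^ 4)
    with hL
  set M := fun s => L s + ∫ r in (0 : ℝ)..s, 2 * (r * Q r) with hM
  have hLc : Continuous L := by
    refine continuous_box ?_
    exact ((continuous_fst.pow 2).mul (cg.pow 2)).add (continuous_const.mul (cf.pow 4))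
  have hInt : ∀ s, HasDerivAt (fun s => ∫ r in (0 : ℝ)..s, 2 * (r * Q r)) (2 * (s * Q s)) s :=
    fun s => ((by fun_prop : Continuous fun r => 2 * (r * Q r)).integral_hasStrictDerivAt
      0 s).hasDerivAt
  have hMc : Continuous M := hLc.add
    (continuous_iff_continuousAt.2 fun s => (hInt s).continuousAt)
  have hd : ∀ s, 0 < s → ∃ m ≤ 0, HasDerivAt M m s := fun s hs => by
    have h0 := (hf.pd 0)
    have h1 := (hf.pd 1)
    have h00 := ((h0.pd 0).pd 0).continuous_heat
    have h01 := ((h0.pd 1).pd 1).continuous_heat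
    have h10 := ((h1.pd 0).pd 0).continuous_heat
    have h11 := ((h1.pd 1).pd 1).continuous_heat
    have hA := (h0.pd 0).continuous_heat
    have hC := (h1.pd 1).continuous_heat
    have c0 := h0.continuous_heat
    have c1 := h1.continuous_heat
    have key := hasDerivAt_box (d := 2) (s₀ := s)
      (F := fun s x => s ^ 2 * gradSq (heat f s) x ^ 2 + 4 / 3 * heat f s x ^ 4)
      (F' := fun s x => 2 * s * gradSq (heat f s) x ^ 2
        + 4 * s ^ 2 * gradSq (heat f s) x *
          (heat (_root_.pd 0 f) s x * (heat (_root_.pd 0 (_root_.pd 0 (_root_.pd 0 f))) s x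
            + heat (_root_.pd 1 (_root_.pd 1 (_root_.pd 0 f))) s x)
          + heat (_root_.pd 1 f) s x * (heat (_root_.pd 0 (_root_.pd 0 (_root_.pd 1 f))) s x
            + heat (_root_.pd 1 (_root_.pd 1 (_root_.pd 1 f))) s x))
        + 16 / 3 * (heat f s x ^ 3 * (heat (_root_.pd 0 (_root_.pd 0 f)) s x
          + heat (_root_.pd 1 (_root_.pd 1 f)) s x)))
      (Ioi_mem_nhds hs) (fun s => by
        have e : Continuous fun x : Fin 2 → ℝ => (s, x) := by fun_prop
        exact (continuous_const.mul ((cg.comp e).pow 2)).add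
          (continuous_const.mul ((cf.comp e).pow 4))) (by
        exact (((continuous_const.mul continuous_fst).mul (cg.pow 2)).add
          (((continuous_const.mul (continuous_fst.pow 2)).mul cg).mul
            ((c0.mul (h00.add h01)).add (c1.mul (h10.add h11))))).add
          (continuous_const.mul ((cf.pow 3).mul (hA.add hC)))) (fun r hr x => by
        have dv := hf.hasDerivAt_heat hr x
        have d0 := h0.hasDerivAt_heat hr x
        have d1 := h1.hasDerivAt_heat hr x
        simp only [gradSq, hf.pd_heat]
        refine ((((hasDerivAt_id' r).fun_pow 2).fun_mul
          (((d0.fun_pow 2).fun_add (d1.fun_pow 2)).fun_pow 2)).fun_add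
          ((dv.fun_pow 4).const_mul (4 / 3))).congr_deriv ?_
        simp
        ring)
    refine ⟨_, ?_, key.add (hInt s)⟩
    have hle := (hf.heat s).integral_dissipation_le s
    simp only [hf.pd_heat, h0.pd_heat, h1.pd_heat, (h0.pd 0).pd_heat, (h0.pd 1).pd_heat,
      (h1.pd 0).pd_heat, (h1.pd 1).pd_heat] at hle
    have e : Continuous fun x : Fin 2 → ℝ => (s, x) := by fun_prop
    rw [hQ, ← mul_assoc, ← integral_const_mul, ← integral_add]
    · refine le_of_eq_of_le ?_ hle
      congr 1
      ext x
      ring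
    · exact integrableOn_box ((((continuous_const).mul ((cg.comp e).pow 2)).add
          (continuous_const.mul (cg.comp e) |>.mul
            (((c0.comp e).mul ((h00.comp e).add (h01.comp e))).add
              ((c1.comp e).mul ((h10.comp e).add (h11.comp e)))))).add
          (continuous_const.mul (((cf.comp e).pow 3).mul ((hA.comp e).add (hC.comp e)))))
    · exact integrableOn_box (continuous_const.mul ((cg.comp e).pow 2))
  have hanti : AntitoneOn M (Set.Ici 0) := by
    refine antitoneOn_of_deriv_nonpos (convex_Ici 0) hMc.continuousOn ?_ ?_
    · intro s hs
      rw [interior_Ici] at hs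
      obtain ⟨m, -, hm⟩ := hd s hs
      exact hm.differentiableAt.differentiableWithinAt
    · intro s hs
      rw [interior_Ici] at hs
      obtain ⟨m, hm0, hm⟩ := hd s hs
      rwa [hm.deriv]
  have h := hanti Set.self_mem_Ici hS hS
  have hL0 : M 0 = 4 / 3 * ∫ x in box 2, f x ^ 4 := by
    simp [hM, hL, heat_of_nonpos, integral_const_mul]
  have hLS : 0 ≤ L S := integral_nonneg fun x => by positivity
  rw [hL0] at h
  simp only [hM, intervalIntegral.integral_const_mul] at h
  linarith

end SmoothPeriodic

/-- Smooth divergence-free vector fields on the two-dimensional torus. -/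
structure DivFree (u : Fin 2 → (Fin 2 → ℝ) → ℝ) : Prop where
  smoothPeriodic : ∀ j, SmoothPeriodic (u j)
  div_eq_zero : ∀ x, pd 0 (u 0) x + pd 1 (u 1) x = 0

/-- The derivative of `f` along the vector field `u`. -/
def adv (u : Fin 2 → (Fin 2 → ℝ) → ℝ) (f : (Fin 2 → ℝ) → ℝ) (x : Fin 2 → ℝ) : ℝ :=
  u 0 x * pd 0 f x + u 1 x * pd 1 f x

/-- Twice the symmetric gradient of `u`, evaluated on the gradients of `v` and `w`. -/
def strainForm (u : Fin 2 → (Fin 2 → ℝ) → ℝ) (v w : (Fin 2 → ℝ) → ℝ) (x : Fin 2 → ℝ) : ℝ :=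
  2 * pd 0 (u 0) x * (pd 0 v x * pd 0 w x)
    + (pd 1 (u 0) x + pd 0 (u 1) x) * (pd 0 v x * pd 1 w x + pd 1 v x * pd 0 w x)
    + 2 * pd 1 (u 1) x * (pd 1 v x * pd 1 w x)

namespace DivFree

variable {u : Fin 2 → (Fin 2 → ℝ) → ℝ} {f g v w : (Fin 2 → ℝ) → ℝ}

lemma pd_div (hu : DivFree u) (i : Fin 2) (x : Fin 2 → ℝ) :
    pd 0 (pd i (u 0)) x + pd 1 (pd i (u 1)) x = 0 := by
  have h0 := hu.smoothPeriodic 0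
  have h1 := hu.smoothPeriodic 1
  rw [h0.pd_comm, h1.pd_comm, ← (h0.pd 0).pd_add (h1.pd 1)]
  simp only [hu.div_eq_zero]
  simp [pd]

lemma integral_adv_add (hu : DivFree u) (hf : SmoothPeriodic f) (hg : SmoothPeriodic g) :
    ∫ x in box 2, (f x * adv u g x + adv u f x * g x) = 0 := by
  have h0 := hu.smoothPeriodic 0
  have h1 := hu.smoothPeriodic 1
  have i0 := ((hf.mul hg).mul h0).integral_pd 0
  have i1 := ((hf.mul hg).mul h1).integral_pd 1
  have c0 := (((hf.mul hg).mul h0).pd 0).continuous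
  have c1 := (((hf.mul hg).mul h1).pd 1).continuous
  have := integral_add (integrableOn_box c0) (integrableOn_box c1)
  rw [i0, i1, add_zero] at this
  rw [← this]
  congr 1
  ext x
  rw [(hf.mul hg).pd_mul h0, (hf.mul hg).pd_mul h1, hf.pd_mul hg, hf.pd_mul hg, adv, adv]
  linear_combination -(f x * g x) * hu.div_eq_zero x

lemma continuous_adv (hu : DivFree u) (hf : SmoothPeriodic f) : Continuous (adv u f) :=
  ((hu.smoothPeriodic 0).continuous.mul (hf.pd 0).continuous).add
    ((hu.smoothPeriodic 1).continuous.mul (hf.pd 1).continuous)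

lemma integral_mul_adv (hu : DivFree u) (hf : SmoothPeriodic f) (hg : SmoothPeriodic g) :
    ∫ x in box 2, f x * adv u g x = -∫ x in box 2, adv u f x * g x := by
  have h := hu.integral_adv_add hf hg
  rw [integral_add (f := fun x => f x * adv u g x) (g := fun x => adv u f x * g x)
    (integrableOn_box (hf.continuous.mul (hu.continuous_adv hg)))
    (integrableOn_box ((hu.continuous_adv hf).mul hg.continuous))] at h
  linarith

/-- The commutator of the Laplacian with `u · ∇`, in weak form. -/
lemma integral_commutator (hu : DivFree u) (hv : SmoothPeriodic v) (hw : SmoothPeriodic w) :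
    ∫ x in box 2, ((pd 0 (pd 0 v) x + pd 1 (pd 1 v) x) * (u 0 x * pd 0 w x + u 1 x * pd 1 w x)
      - v x * (u 0 x * (pd 0 (pd 0 (pd 0 w)) x + pd 1 (pd 1 (pd 0 w)) x)
        + u 1 x * (pd 0 (pd 0 (pd 1 w)) x + pd 1 (pd 1 (pd 1 w)) x))
      + strainForm u v w x) = 0 := by
  have h0 := hu.smoothPeriodic 0
  have h1 := hu.smoothPeriodic 1
  have hdiv := hu.div_eq_zero
  have hd0 := hu.pd_div 0
  have hd1 := hu.pd_div 1
  have w01 : pd 1 (pd 0 w) = pd 0 (pd 1 w) := by ext x; exact hw.pd_comm 1 0 x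
  rw [w01]
  have hΦ0 : SmoothPeriodic fun x => pd 0 v x * (u 0 x * pd 0 w x + u 1 x * pd 1 w x)
      + v x * ((-1) * (u 0 x * pd 0 (pd 0 w) x + u 1 x * pd 0 (pd 1 w) x)
        + (pd 0 (u 0) x * pd 0 w x + pd 1 (u 0) x * pd 1 w x)) := by
    have hc : SmoothPeriodic (fun _ : Fin 2 → ℝ => (-1 : ℝ)) := ⟨contDiff_const, fun _ _ => rfl⟩
    exact ((hv.pd 0).mul ((h0.mul (hw.pd 0)).add (h1.mul (hw.pd 1)))).add
      (hv.mul ((hc.mul ((h0.mul ((hw.pd 0).pd 0)).add (h1.mul ((hw.pd 1).pd 0)))).add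
        (((h0.pd 0).mul (hw.pd 0)).add ((h0.pd 1).mul (hw.pd 1)))))
  have hΦ1 : SmoothPeriodic fun x => pd 1 v x * (u 0 x * pd 0 w x + u 1 x * pd 1 w x)
      + v x * ((-1) * (u 0 x * pd 0 (pd 1 w) x + u 1 x * pd 1 (pd 1 w) x)
        + (pd 0 (u 1) x * pd 0 w x + pd 1 (u 1) x * pd 1 w x)) := by
    have hc : SmoothPeriodic (fun _ : Fin 2 → ℝ => (-1 : ℝ)) := ⟨contDiff_const, fun _ _ => rfl⟩
    exact ((hv.pd 1).mul ((h0.mul (hw.pd 0)).add (h1.mul (hw.pd 1)))).add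
      (hv.mul ((hc.mul ((h0.mul ((hw.pd 1).pd 0)).add (h1.mul ((hw.pd 1).pd 1)))).add
        (((h1.pd 0).mul (hw.pd 0)).add ((h1.pd 1).mul (hw.pd 1)))))
  have i0 := hΦ0.integral_pd 0
  have i1 := hΦ1.integral_pd 1
  have := integral_add (integrableOn_box (hΦ0.pd 0).continuous)
    (integrableOn_box (hΦ1.pd 1).continuous)
  rw [i0, i1, add_zero] at this
  rw [← this]
  congr 1
  ext x
  have D : ∀ {F F' : (Fin 2 → ℝ) → ℝ} {i}, (∀ x, HasLineDerivAt ℝ F (F' x) x (Pi.single i 1)) →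
      SmoothPeriodic F → pd i F x = F' x := fun {F F' i} h hF => by
    have h1 := h x
    have h2 := hF.hasLineDerivAt i x
    unfold HasLineDerivAt at h1 h2
    exact h2.unique h1
  have e0 : ∀ x, HasLineDerivAt ℝ (fun x => pd 0 v x * (u 0 x * pd 0 w x + u 1 x * pd 1 w x)
      + v x * ((-1) * (u 0 x * pd 0 (pd 0 w) x + u 1 x * pd 0 (pd 1 w) x)
        + (pd 0 (u 0) x * pd 0 w x + pd 1 (u 0) x * pd 1 w x)))
      (pd 0 (pd 0 v) x * (u 0 x * pd 0 w x + u 1 x * pd 1 w x)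
        + pd 0 v x * (pd 0 (u 0) x * pd 0 w x + u 0 x * pd 0 (pd 0 w) x
          + (pd 0 (u 1) x * pd 1 w x + u 1 x * pd 0 (pd 1 w) x))
        + (pd 0 v x * ((-1) * (u 0 x * pd 0 (pd 0 w) x + u 1 x * pd 0 (pd 1 w) x)
        + (pd 0 (u 0) x * pd 0 w x + pd 1 (u 0) x * pd 1 w x))
        + v x * ((-1) * (pd 0 (u 0) x * pd 0 (pd 0 w) x + u 0 x * pd 0 (pd 0 (pd 0 w)) x
           + (pd 0 (u 1) x * pd 0 (pd 1 w) x + u 1 x * pd 0 (pd 0 (pd 1 w)) x))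
        + (pd 0 (pd 0 (u 0)) x * pd 0 w x + pd 0 (u 0) x * pd 0 (pd 0 w) x
          + (pd 0 (pd 1 (u 0)) x * pd 1 w x + pd 1 (u 0) x * pd 0 (pd 1 w) x)))))
      x (Pi.single 0 1) := fun x => by
    have d1 := hv.hasLineDerivAt 0 x
    have d2 := (hv.pd 0).hasLineDerivAt 0 x
    have d3 := h0.hasLineDerivAt 0 x
    have d4 := h1.hasLineDerivAt 0 x
    have d5 := (hw.pd 0).hasLineDerivAt 0 x
    have d6 := (hw.pd 1).hasLineDerivAt 0 x
    have d7 := ((hw.pd 0).pd 0).hasLineDerivAt 0 x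
    have d8 := ((hw.pd 1).pd 0).hasLineDerivAt 0 x
    have d9 := (h0.pd 0).hasLineDerivAt 0 x
    have d10 := (h0.pd 1).hasLineDerivAt 0 x
    unfold HasLineDerivAt at *
    refine ((d2.fun_mul ((d3.fun_mul d5).fun_add (d4.fun_mul d6))).fun_add
      (d1.fun_mul ((((d3.fun_mul d7).fun_add (d4.fun_mul d8)).const_mul (-1)).fun_add
        ((d9.fun_mul d5).fun_add (d10.fun_mul d6))))).congr_deriv ?_
    simp
  have e1 : ∀ x, HasLineDerivAt ℝ (fun x => pd 1 v x * (u 0 x * pd 0 w x + u 1 x * pd 1 w x)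
      + v x * ((-1) * (u 0 x * pd 0 (pd 1 w) x + u 1 x * pd 1 (pd 1 w) x)
        + (pd 0 (u 1) x * pd 0 w x + pd 1 (u 1) x * pd 1 w x)))
      (pd 1 (pd 1 v) x * (u 0 x * pd 0 w x + u 1 x * pd 1 w x)
        + pd 1 v x * (pd 1 (u 0) x * pd 0 w x + u 0 x * pd 0 (pd 1 w) x
          + (pd 1 (u 1) x * pd 1 w x + u 1 x * pd 1 (pd 1 w) x))
        + (pd 1 v x * ((-1) * (u 0 x * pd 0 (pd 1 w) x + u 1 x * pd 1 (pd 1 w) x)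
        + (pd 0 (u 1) x * pd 0 w x + pd 1 (u 1) x * pd 1 w x))
        + v x * ((-1) * (pd 1 (u 0) x * pd 0 (pd 1 w) x + u 0 x * pd 1 (pd 0 (pd 1 w)) x
           + (pd 1 (u 1) x * pd 1 (pd 1 w) x + u 1 x * pd 1 (pd 1 (pd 1 w)) x))
        + (pd 1 (pd 0 (u 1)) x * pd 0 w x + pd 0 (u 1) x * pd 0 (pd 1 w) x
          + (pd 1 (pd 1 (u 1)) x * pd 1 w x + pd 1 (u 1) x * pd 1 (pd 1 w) x)))))
      x (Pi.single 1 1) := fun x => by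
    have d1 := hv.hasLineDerivAt 1 x
    have d2 := (hv.pd 1).hasLineDerivAt 1 x
    have d3 := h0.hasLineDerivAt 1 x
    have d4 := h1.hasLineDerivAt 1 x
    have d5 := (hw.pd 0).hasLineDerivAt 1 x
    have d6 := (hw.pd 1).hasLineDerivAt 1 x
    have d7 := ((hw.pd 1).pd 0).hasLineDerivAt 1 x
    have d8 := ((hw.pd 1).pd 1).hasLineDerivAt 1 x
    have d9 := (h1.pd 0).hasLineDerivAt 1 x
    have d10 := (h1.pd 1).hasLineDerivAt 1 x
    rw [w01] at d5
    unfold HasLineDerivAt at *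
    refine ((d2.fun_mul ((d3.fun_mul d5).fun_add (d4.fun_mul d6))).fun_add
      (d1.fun_mul ((((d3.fun_mul d7).fun_add (d4.fun_mul d8)).const_mul (-1)).fun_add
        ((d9.fun_mul d5).fun_add (d10.fun_mul d6))))).congr_deriv ?_
    simp
  rw [D e0 hΦ0, D e1 hΦ1, strainForm]
  linear_combination -(v x * pd 0 w x) * hd0 x - (v x * pd 1 w x) * hd1 x

lemma integral_self_mul_adv (hu : DivFree u) (hf : SmoothPeriodic f) :
    ∫ x in box 2, f x * adv u f x = 0 := by
  have h := hu.integral_mul_adv hf hf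
  have : ∫ x in box 2, adv u f x * f x = ∫ x in box 2, f x * adv u f x := by
    simp only [mul_comm]
  linarith

lemma continuous_strainForm_heat (hu : DivFree u) (hf : SmoothPeriodic f) :
    Continuous fun q : (ℝ × ℝ) × (Fin 2 → ℝ) =>
      strainForm u (heat f q.1.1) (heat f q.1.2) q.2 := by
  have h0 := hu.smoothPeriodic 0
  have h1 := hu.smoothPeriodic 1
  have a : ∀ i, Continuous fun q : (ℝ × ℝ) × (Fin 2 → ℝ) => heat (pd i f) q.1.1 q.2 := fun i =>
    (hf.pd i).continuous_heat.comp
      (by fun_prop : Continuous fun q : (ℝ × ℝ) × (Fin 2 → ℝ) => (q.1.1, q.2))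
  have b : ∀ i, Continuous fun q : (ℝ × ℝ) × (Fin 2 → ℝ) => heat (pd i f) q.1.2 q.2 := fun i =>
    (hf.pd i).continuous_heat.comp
      (by fun_prop : Continuous fun q : (ℝ × ℝ) × (Fin 2 → ℝ) => (q.1.2, q.2))
  have a0 := a 0
  have a1 := a 1
  have b0 := b 0
  have b1 := b 1
  have c00 := (h0.pd 0).continuous
  have c01 := (h0.pd 1).continuous
  have c10 := (h1.pd 0).continuous
  have c11 := (h1.pd 1).continuous
  simp only [strainForm, hf.pd_heat]
  fun_prop

lemma continuous_integral_strainForm_heat (hu : DivFree u) (hf : SmoothPeriodic f) :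
    Continuous fun q : ℝ × ℝ =>
      ∫ x in box 2, strainForm u (heat f q.1) (heat f q.2) x :=
  continuous_box (hu.continuous_strainForm_heat hf)

lemma integral_mul_adv_heat (hu : DivFree u) (hf : SmoothPeriodic f) {τ : ℝ} (hτ : 0 < τ) :
    ∫ x in box 2, f x * adv u (heat f τ) x
      = ∫ s in (0 : ℝ)..τ / 2, ∫ x in box 2, strainForm u (heat f s) (heat f (τ - s)) x := by
  set G : ℝ → ℝ := fun s => ∫ x in box 2, heat f s x * adv u (heat f (τ - s)) x with hG
  have hNc : Continuous fun s => ∫ x in box 2, strainForm u (heat f s) (heat f (τ - s)) x :=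
    (hu.continuous_integral_strainForm_heat hf).comp
      (by fun_prop : Continuous fun s : ℝ => (s, τ - s))
  have e1 : Continuous fun q : ℝ × (Fin 2 → ℝ) => (τ - q.1, q.2) := by fun_prop
  have cu0 : Continuous fun q : ℝ × (Fin 2 → ℝ) => u 0 q.2 :=
    (hu.smoothPeriodic 0).continuous.comp continuous_snd
  have cu1 : Continuous fun q : ℝ × (Fin 2 → ℝ) => u 1 q.2 :=
    (hu.smoothPeriodic 1).continuous.comp continuous_snd
  have hFc : Continuous fun q : ℝ × (Fin 2 → ℝ) => heat f q.1 q.2 * adv u (heat f (τ - q.1)) q.2 := by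
    simp only [adv, hf.pd_heat]
    exact hf.continuous_heat.mul ((cu0.mul ((hf.pd 0).continuous_heat.comp e1)).add
      (cu1.mul ((hf.pd 1).continuous_heat.comp e1)))
  have hGc : Continuous G := continuous_box hFc
  have hd : ∀ s ∈ Set.Ioo 0 (τ / 2), HasDerivAt G
      (-∫ x in box 2, strainForm u (heat f s) (heat f (τ - s)) x) s := fun s hs => by
    have hs0 : 0 < s := hs.1
    have hsτ : s < τ := by have := hs.2; linarith
    have h0 := hf.pd 0
    have h1 := hf.pd 1
    have c0 := h0.continuous_heat.comp e1
    have c1 := h1.continuous_heat.comp e1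
    have cA := (h0.pd 0).continuous_heat
    have cC := (h1.pd 1).continuous_heat
    have c00 := ((h0.pd 0).pd 0).continuous_heat.comp e1
    have c01 := ((h0.pd 1).pd 1).continuous_heat.comp e1
    have c10 := ((h1.pd 0).pd 0).continuous_heat.comp e1
    have c11 := ((h1.pd 1).pd 1).continuous_heat.comp e1
    have key := hasDerivAt_box (d := 2) (s₀ := s)
      (F := fun s x => heat f s x * adv u (heat f (τ - s)) x)
      (F' := fun s x => (heat (pd 0 (pd 0 f)) s x + heat (pd 1 (pd 1 f)) s x)
          * (u 0 x * heat (pd 0 f) (τ - s) x + u 1 x * heat (pd 1 f) (τ - s) x)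
        - heat f s x * (u 0 x * (heat (pd 0 (pd 0 (pd 0 f))) (τ - s) x
            + heat (pd 1 (pd 1 (pd 0 f))) (τ - s) x)
          + u 1 x * (heat (pd 0 (pd 0 (pd 1 f))) (τ - s) x
            + heat (pd 1 (pd 1 (pd 1 f))) (τ - s) x)))
      (Ioo_mem_nhds hs0 hsτ)
      (fun s => hFc.comp (by fun_prop : Continuous fun x : Fin 2 → ℝ => (s, x)))
      (((cA.add cC).mul ((cu0.mul c0).add (cu1.mul c1))).sub
        (hf.continuous_heat.mul ((cu0.mul (c00.add c01)).add (cu1.mul (c10.add c11)))))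
      (fun r hr x => by
        have dv := hf.hasDerivAt_heat hr.1 x
        have hr2 : 0 < τ - r := by have := hr.2; linarith
        have d0 := (h0.hasDerivAt_heat hr2 x).scomp r ((hasDerivAt_id' r).const_sub τ)
        have d1 := (h1.hasDerivAt_heat hr2 x).scomp r ((hasDerivAt_id' r).const_sub τ)
        simp only [adv, hf.pd_heat]
        refine (dv.fun_mul ((d0.const_mul (u 0 x)).fun_add (d1.const_mul (u 1 x)))).congr_deriv ?_
        simp
        ring)
    refine key.congr_deriv ?_
    have hle := hu.integral_commutator (hf.heat s) (hf.heat (τ - s))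
    simp only [hf.pd_heat, h0.pd_heat, h1.pd_heat, (h0.pd 0).pd_heat, (h0.pd 1).pd_heat,
      (h1.pd 0).pd_heat, (h1.pd 1).pd_heat] at hle
    have e : Continuous fun x : Fin 2 → ℝ => (s, x) := by fun_prop
    rw [integral_add] at hle
    · linarith
    · exact integrableOn_box ((((cA.add cC).mul ((cu0.mul c0).add (cu1.mul c1))).sub
        (hf.continuous_heat.mul ((cu0.mul (c00.add c01)).add (cu1.mul (c10.add c11))))).comp e)
    · exact integrableOn_box ((hu.continuous_strainForm_heat hf).comp
        (by fun_prop : Continuous fun x : Fin 2 → ℝ => ((s, τ - s), x)))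
  have h := intervalIntegral.integral_eq_sub_of_hasDerivAt_of_le (by linarith) hGc.continuousOn hd
    (hNc.neg.intervalIntegrable _ _)
  have hG0 : G 0 = ∫ x in box 2, f x * adv u (heat f τ) x := by
    simp [hG, heat_of_nonpos]
  have hGτ : G (τ / 2) = 0 := by
    simp only [hG]
    rw [show τ - τ / 2 = τ / 2 by ring]
    exact hu.integral_self_mul_adv (hf.heat _)
  rw [intervalIntegral.integral_neg, hG0, hGτ] at h
  linarith

end DivFree

/-- The squared Frobenius norm of the gradient of a vector field. -/
def fieldGradSq (u : Fin 2 → (Fin 2 → ℝ) → ℝ) (x : Fin 2 → ℝ) : ℝ :=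
  gradSq (u 0) x + gradSq (u 1) x

lemma mul_le_weighted_sq {c : ℝ} (hc : 0 < c) (a b : ℝ) :
    |a * b| ≤ c / 2 * a ^ 2 + 1 / (2 * c) * b ^ 2 := by
  have h : c / 2 * a ^ 2 + 1 / (2 * c) * b ^ 2 - |a| * |b| = (c * |a| - |b|) ^ 2 / (2 * c) := by
    rw [← sq_abs a, ← sq_abs b]
    field_simp
    ring
  have : 0 ≤ (c * |a| - |b|) ^ 2 / (2 * c) := by positivity
  rw [abs_mul]
  linarith

lemma abs_strainForm_le (u : Fin 2 → (Fin 2 → ℝ) → ℝ) (v w : (Fin 2 → ℝ) → ℝ) (x : Fin 2 → ℝ)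
    {c β : ℝ} (hc : 0 < c) (hβ : 0 < β) :
    |strainForm u v w x| ≤ c * fieldGradSq u x
      + 1 / (2 * c) * (β * gradSq v x ^ 2 + β⁻¹ * gradSq w x ^ 2) := by
  have h1 : |strainForm u v w x| ≤ c * fieldGradSq u x + 1 / c * (gradSq v x * gradSq w x) := by
    unfold strainForm fieldGradSq gradSq
    generalize pd 0 (u 0) x = u00
    generalize pd 1 (u 0) x = u01
    generalize pd 0 (u 1) x = u10
    generalize pd 1 (u 1) x = u11
    generalize pd 0 v x = a
    generalize pd 1 v x = b
    generalize pd 0 w x = a'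
    generalize pd 1 w x = b'
    have k1 := abs_le.1 (mul_le_weighted_sq hc u00 (a * a'))
    have k2 := abs_le.1 (mul_le_weighted_sq hc u01 (a * b'))
    have k3 := abs_le.1 (mul_le_weighted_sq hc u01 (b * a'))
    have k4 := abs_le.1 (mul_le_weighted_sq hc u10 (a * b'))
    have k5 := abs_le.1 (mul_le_weighted_sq hc u10 (b * a'))
    have k6 := abs_le.1 (mul_le_weighted_sq hc u11 (b * b'))
    have e : c * (u00 ^ 2 + u01 ^ 2 + (u10 ^ 2 + u11 ^ 2))
        + 1 / c * ((a ^ 2 + b ^ 2) * (a' ^ 2 + b' ^ 2))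
        = 2 * (c / 2 * u00 ^ 2 + 1 / (2 * c) * (a * a') ^ 2)
          + (c / 2 * u01 ^ 2 + 1 / (2 * c) * (a * b') ^ 2)
          + (c / 2 * u01 ^ 2 + 1 / (2 * c) * (b * a') ^ 2)
          + (c / 2 * u10 ^ 2 + 1 / (2 * c) * (a * b') ^ 2)
          + (c / 2 * u10 ^ 2 + 1 / (2 * c) * (b * a') ^ 2)
          + 2 * (c / 2 * u11 ^ 2 + 1 / (2 * c) * (b * b') ^ 2) := by
      field_simp
      ring
    rw [e]
    refine abs_le.2 ⟨?_, ?_⟩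
    · linarith [k1.1, k2.1, k3.1, k4.1, k5.1, k6.1]
    · linarith [k1.2, k2.2, k3.2, k4.2, k5.2, k6.2]
  have h2 := (le_abs_self _).trans (mul_le_weighted_sq hβ (gradSq v x) (gradSq w x))
  have h3 : 1 / c * (gradSq v x * gradSq w x)
      ≤ 1 / c * (β / 2 * gradSq v x ^ 2 + 1 / (2 * β) * gradSq w x ^ 2) := by gcongr
  have h4 : 1 / c * (β / 2 * gradSq v x ^ 2 + 1 / (2 * β) * gradSq w x ^ 2)
      = 1 / (2 * c) * (β * gradSq v x ^ 2 + β⁻¹ * gradSq w x ^ 2) := by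
    field_simp
  linarith

lemma SmoothPeriodic.continuous_gradSq {f : (Fin 2 → ℝ) → ℝ} (hf : SmoothPeriodic f) :
    Continuous (gradSq f) :=
  ((hf.pd 0).continuous.pow 2).add ((hf.pd 1).continuous.pow 2)

lemma DivFree.continuous_fieldGradSq {u : Fin 2 → (Fin 2 → ℝ) → ℝ} (hu : DivFree u) :
    Continuous (fieldGradSq u) :=
  (hu.smoothPeriodic 0).continuous_gradSq.add (hu.smoothPeriodic 1).continuous_gradSq

lemma integral_inv_add_le {a : ℝ} (ha : 0 < a) :
    ∫ τ in (0 : ℝ)..1 / 4, (τ + a)⁻¹ = Real.log ((1 / 4 + a) / a) := by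
  rw [intervalIntegral.integral_comp_add_right (fun x => x⁻¹),
    integral_inv_of_pos (by linarith) (by linarith), zero_add]

lemma exp_neg_div_mul_inv_le {a τ : ℝ} (ha : 0 < a) (hτ : 0 < τ) :
    Real.exp (-(a / τ)) * τ⁻¹ ≤ (τ + a)⁻¹ := by
  have h1 : 1 + a / τ ≤ Real.exp (a / τ) := by linarith [Real.add_one_le_exp (a / τ)]
  have h2 : (0 : ℝ) < 1 + a / τ := by positivity
  rw [Real.exp_neg, ← mul_inv]
  refine inv_anti₀ (by positivity) ?_
  have : (1 + a / τ) * τ = τ + a := by field_simp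
  rw [← this]
  gcongr

lemma integral_rpow_neg_half_le : ∫ θ in (0 : ℝ)..1 / 2, θ ^ (-(1 / 2) : ℝ) ≤ 2 := by
  rw [integral_rpow (Or.inl (by norm_num))]
  have h : ((1 : ℝ) / 2) ^ (-(1 / 2) + 1 : ℝ) ≤ 1 :=
    Real.rpow_le_one (by norm_num) (by norm_num) (by norm_num)
  have h0 : (0 : ℝ) ^ (-(1 / 2) + 1 : ℝ) = 0 := Real.zero_rpow (by norm_num)
  rw [h0]
  norm_num at h ⊢
  linarith

namespace DivFree

variable {u : Fin 2 → (Fin 2 → ℝ) → ℝ} {f : (Fin 2 → ℝ) → ℝ}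

lemma abs_integral_strainForm_heat_le (hu : DivFree u) (hf : SmoothPeriodic f) (s r : ℝ)
    {c β : ℝ} (hc : 0 < c) (hβ : 0 < β) :
    |∫ x in box 2, strainForm u (heat f s) (heat f r) x| ≤ c * (∫ x in box 2, fieldGradSq u x)
      + 1 / (2 * c) * (β * (∫ x in box 2, gradSq (heat f s) x ^ 2)
        + β⁻¹ * ∫ x in box 2, gradSq (heat f r) x ^ 2) := by
  have i0 := integrableOn_box hu.continuous_fieldGradSq
  have i1 : IntegrableOn (fun x => gradSq (heat f s) x ^ 2) (box 2) :=
    integrableOn_box ((hf.heat s).continuous_gradSq.pow 2)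
  have i2 : IntegrableOn (fun x => gradSq (heat f r) x ^ 2) (box 2) :=
    integrableOn_box ((hf.heat r).continuous_gradSq.pow 2)
  have i3 : IntegrableOn (fun x => 1 / (2 * c) * (β * gradSq (heat f s) x ^ 2
      + β⁻¹ * gradSq (heat f r) x ^ 2)) (box 2) :=
    ((i1.const_mul β).add (i2.const_mul β⁻¹)).const_mul _
  have h := norm_integral_le_of_norm_le (μ := volume.restrict (box 2))
    (f := strainForm u (heat f s) (heat f r))
    (g := fun x => c * fieldGradSq u x + 1 / (2 * c) * (β * gradSq (heat f s) x ^ 2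
      + β⁻¹ * gradSq (heat f r) x ^ 2))
    ((i0.const_mul c).add i3)
    (Filter.Eventually.of_forall fun x => abs_strainForm_le u _ _ x hc hβ)
  refine h.trans_eq ?_
  rw [integral_add (i0.const_mul c) i3,
    integral_const_mul, integral_const_mul, integral_add (i1.const_mul β) (i2.const_mul β⁻¹),
    integral_const_mul, integral_const_mul]

lemma _root_.SmoothPeriodic.integral_mul_comp_le (hf : SmoothPeriodic f) {l : ℝ} (hl : 0 < l) :
    ∫ τ in (0 : ℝ)..1 / 4, τ * ∫ x in box 2, gradSq (heat f (l * τ)) x ^ 2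
      ≤ (l ^ 2)⁻¹ * (2 / 3 * ∫ x in box 2, f x ^ 4) := by
  have h := hf.integral_mul_gradSq_heat_le (S := l * (1 / 4)) (by positivity)
  have h2 := intervalIntegral.mul_integral_comp_mul_left (a := 0) (b := 1 / 4) (c := l)
    (f := fun s => s * ∫ x in box 2, gradSq (heat f s) x ^ 2)
  rw [mul_zero] at h2
  rw [← h2] at h
  simp only [mul_assoc, intervalIntegral.integral_const_mul] at h
  rw [le_inv_mul_iff₀ (by positivity)]
  linarith

lemma abs_integral_exp_mul_strain_le (hu : DivFree u) (hf : SmoothPeriodic f) {h ε θ : ℝ}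
    (hh : 0 < h) (hε : 0 < ε) (hθ : 0 < θ) (hθ' : θ ≤ 1 / 2) :
    |∫ τ in (0 : ℝ)..1 / 4, Real.exp (-(h ^ 2 / 4 / τ)) *
        ∫ x in box 2, strainForm u (heat f (θ * τ)) (heat f (τ - θ * τ)) x|
      ≤ θ ^ (-(1 / 2) : ℝ) * (ε * (∫ x in box 2, fieldGradSq u x)
          * Real.log ((1 / 4 + h ^ 2 / 4) / (h ^ 2 / 4))
        + 5 / 3 * (∫ x in box 2, f x ^ 4) / ε) := by
  set g := θ ^ (-(1 / 2) : ℝ) with hg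
  have hg0 : 0 < g := Real.rpow_pos_of_pos hθ _
  have hgg : g ^ 2 * θ = 1 := by
    rw [hg, ← Real.rpow_natCast, ← Real.rpow_mul hθ.le]
    norm_num
    rw [Real.rpow_neg_one, inv_mul_cancel₀ hθ.ne']
  set Y := ∫ x in box 2, fieldGradSq u x with hY
  have hY0 : 0 ≤ Y := integral_nonneg fun x => by
    unfold fieldGradSq gradSq; positivity
  set A := ∫ x in box 2, f x ^ 4 with hA
  set Q := fun s => ∫ x in box 2, gradSq (heat f s) x ^ 2 with hQ
  have hQc : Continuous Q := hf.continuous_integral_gradSq_heat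
  have hQ0 : ∀ s, 0 ≤ Q s := fun s => integral_nonneg fun x => by positivity
  have ha : 0 < h ^ 2 / 4 := by positivity
  have c1 : IntervalIntegrable (fun τ => (τ + h ^ 2 / 4)⁻¹) volume 0 (1 / 4) := by
    refine ContinuousOn.intervalIntegrable (ContinuousOn.inv₀ (by fun_prop) fun τ hτ => ?_)
    rw [Set.uIcc_of_le (by norm_num)] at hτ
    have := hτ.1
    positivity
  have c2 : IntervalIntegrable (fun τ => τ * Q (θ * τ)) volume 0 (1 / 4) :=
    (by fun_prop : Continuous fun τ => τ * Q (θ * τ)).intervalIntegrable _ _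
  have c3 : IntervalIntegrable (fun τ => τ * Q ((1 - θ) * τ)) volume 0 (1 / 4) :=
    (by fun_prop : Continuous fun τ => τ * Q ((1 - θ) * τ)).intervalIntegrable _ _
  have hle := intervalIntegral.norm_integral_le_of_norm_le (μ := volume)
    (f := fun τ => Real.exp (-(h ^ 2 / 4 / τ)) *
        ∫ x in box 2, strainForm u (heat f (θ * τ)) (heat f (τ - θ * τ)) x)
    (g := fun τ => ε * g * Y * (τ + h ^ 2 / 4)⁻¹ + (1 / (2 * ε * g) * θ * (τ * Q (θ * τ))
      + 1 / (2 * ε * g) * θ⁻¹ * (τ * Q ((1 - θ) * τ)))) (a := 0) (b := 1 / 4) (by norm_num)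
    (Filter.Eventually.of_forall fun τ hτ => by
      have hτ0 : 0 < τ := hτ.1
      have b1 := hu.abs_integral_strainForm_heat_le hf (θ * τ) (τ - θ * τ)
        (c := ε * g / τ) (β := θ) (by positivity) hθ
      have e1 : Real.exp (-(h ^ 2 / 4 / τ)) ≤ 1 := Real.exp_le_one_iff.2 (by
        have : 0 ≤ h ^ 2 / 4 / τ := by positivity
        linarith)
      have e2 := exp_neg_div_mul_inv_le ha hτ0
      have e0 := Real.exp_pos (-(h ^ 2 / 4 / τ))
      rw [Real.norm_eq_abs, abs_mul, abs_of_pos e0]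
      have hτθ : τ - θ * τ = (1 - θ) * τ := by ring
      have n1 := hQ0 (θ * τ)
      have n2 := hQ0 (τ - θ * τ)
      calc _ ≤ Real.exp (-(h ^ 2 / 4 / τ)) * (ε * g / τ * Y + 1 / (2 * (ε * g / τ))
            * (θ * Q (θ * τ) + θ⁻¹ * Q (τ - θ * τ))) := by gcongr
        _ = ε * g * Y * (Real.exp (-(h ^ 2 / 4 / τ)) * τ⁻¹) + Real.exp (-(h ^ 2 / 4 / τ))
            * (1 / (2 * (ε * g / τ)) * (θ * Q (θ * τ) + θ⁻¹ * Q (τ - θ * τ))) := by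
          field_simp
        _ ≤ ε * g * Y * (τ + h ^ 2 / 4)⁻¹ + 1
            * (1 / (2 * (ε * g / τ)) * (θ * Q (θ * τ) + θ⁻¹ * Q (τ - θ * τ))) := by gcongr
        _ = _ := by
          rw [hτθ]
          field_simp)
    ((c1.const_mul _).add ((c2.const_mul _).add (c3.const_mul _)))
  rw [Real.norm_eq_abs] at hle
  refine hle.trans ?_
  rw [intervalIntegral.integral_add (c1.const_mul _) ((c2.const_mul _).add (c3.const_mul _)),
    intervalIntegral.integral_add (c2.const_mul _) (c3.const_mul _),
    intervalIntegral.integral_const_mul, intervalIntegral.integral_const_mul,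
    intervalIntegral.integral_const_mul, integral_inv_add_le ha]
  have k1 := hf.integral_mul_comp_le hθ
  have k2 := hf.integral_mul_comp_le (l := 1 - θ) (by linarith)
  have hA0 : 0 ≤ A := integral_nonneg fun x => by positivity
  have k3 : ((1 - θ) ^ 2)⁻¹ ≤ 4 := by
    rw [inv_le_comm₀ (by nlinarith) (by norm_num)]
    nlinarith
  have k4 : ∫ τ in (0 : ℝ)..1 / 4, τ * Q ((1 - θ) * τ) ≤ 4 * (2 / 3 * A) :=
    k2.trans (by gcongr)
  calc _ ≤ ε * g * Y * Real.log ((1 / 4 + h ^ 2 / 4) / (h ^ 2 / 4))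
        + (1 / (2 * ε * g) * θ * ((θ ^ 2)⁻¹ * (2 / 3 * A))
          + 1 / (2 * ε * g) * θ⁻¹ * (4 * (2 / 3 * A))) := by gcongr
    _ = _ := by
      have : θ = (g ^ 2)⁻¹ := by
        field_simp
        linarith
      rw [this]
      field_simp
      ring

/-- The weighted time average of `∫ f u · ∇ e^{τΔ} f`. -/
lemma abs_integral_exp_mul_adv_heat_le (hu : DivFree u) (hf : SmoothPeriodic f) {h ε : ℝ}
    (hh : 0 < h) (hε : 0 < ε) :
    |∫ τ in (0 : ℝ)..1 / 4, Real.exp (-(h ^ 2 / 4 / τ)) *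
        (τ⁻¹ * ∫ x in box 2, f x * adv u (heat f τ) x)|
      ≤ 2 * (ε * (∫ x in box 2, fieldGradSq u x)
          * Real.log ((1 / 4 + h ^ 2 / 4) / (h ^ 2 / 4))
        + 5 / 3 * (∫ x in box 2, f x ^ 4) / ε) := by
  set N := fun q : ℝ × ℝ => ∫ x in box 2, strainForm u (heat f q.1) (heat f q.2) x with hN
  have hNc : Continuous N := hu.continuous_integral_strainForm_heat hf
  set B := ε * (∫ x in box 2, fieldGradSq u x) * Real.log ((1 / 4 + h ^ 2 / 4) / (h ^ 2 / 4))
        + 5 / 3 * (∫ x in box 2, f x ^ 4) / ε with hB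
  have hY0 : 0 ≤ ∫ x in box 2, fieldGradSq u x := integral_nonneg fun x => by
    unfold fieldGradSq gradSq; positivity
  have hA0 : 0 ≤ ∫ x in box 2, f x ^ 4 := integral_nonneg fun x => by positivity
  have ha : 0 < h ^ 2 / 4 := by positivity
  have hB0 : 0 ≤ B := by
    have : 0 ≤ Real.log ((1 / 4 + h ^ 2 / 4) / (h ^ 2 / 4)) := by
      refine Real.log_nonneg ?_
      rw [le_div_iff₀ ha]
      linarith
    positivity
  have e1 : ∀ τ ∈ Set.Ioc (0 : ℝ) (1 / 4), Real.exp (-(h ^ 2 / 4 / τ)) *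
        (τ⁻¹ * ∫ x in box 2, f x * adv u (heat f τ) x)
      = ∫ θ in (0 : ℝ)..1 / 2, Real.exp (-(h ^ 2 / 4 / τ)) * N (θ * τ, τ - θ * τ) := fun τ hτ => by
    have hτ0 : 0 < τ := hτ.1
    rw [hu.integral_mul_adv_heat hf hτ0, intervalIntegral.integral_const_mul]
    congr 1
    have := intervalIntegral.integral_comp_mul_right (a := 0) (b := 1 / 2) (c := τ)
      (fun s => N (s, τ - s)) hτ0.ne'
    rw [this, zero_mul, smul_eq_mul, one_div_mul_eq_div]
  have e2 : ∫ τ in (0 : ℝ)..1 / 4, Real.exp (-(h ^ 2 / 4 / τ)) *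
        (τ⁻¹ * ∫ x in box 2, f x * adv u (heat f τ) x)
      = ∫ θ in (0 : ℝ)..1 / 2, ∫ τ in (0 : ℝ)..1 / 4,
        Real.exp (-(h ^ 2 / 4 / τ)) * N (θ * τ, τ - θ * τ) := by
    simp only [intervalIntegral.integral_of_le (by norm_num : (0 : ℝ) ≤ 1 / 4),
      intervalIntegral.integral_of_le (by norm_num : (0 : ℝ) ≤ 1 / 2)] at e1 ⊢
    rw [setIntegral_congr_fun measurableSet_Ioc e1]
    refine integral_integral_swap ?_
    rw [Measure.prod_restrict]
    have i : IntegrableOn (fun q : ℝ × ℝ => N (q.2 * q.1, q.1 - q.2 * q.1))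
        (Set.Ioc 0 (1 / 4) ×ˢ Set.Ioc 0 (1 / 2)) (volume.prod volume) :=
      integrableOn_of_subset_compact (K := Set.Icc 0 (1 / 4) ×ˢ Set.Icc 0 (1 / 2))
        (isCompact_Icc.prod isCompact_Icc)
        (Set.prod_mono Set.Ioc_subset_Icc_self Set.Ioc_subset_Icc_self)
        (hNc.comp (by fun_prop))
    refine Integrable.bdd_mul (c := 1) i (by
      apply Measurable.aestronglyMeasurable
      fun_prop) ?_
    rw [ae_restrict_iff' (measurableSet_Ioc.prod measurableSet_Ioc)]
    refine Filter.Eventually.of_forall fun q hq => ?_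
    rw [Real.norm_eq_abs, abs_of_pos (Real.exp_pos _)]
    have hq0 : 0 < q.1 := hq.1.1
    refine Real.exp_le_one_iff.2 ?_
    have : 0 ≤ h ^ 2 / 4 / q.1 := by positivity
    linarith
  rw [e2]
  have hle := intervalIntegral.norm_integral_le_of_norm_le (μ := volume)
    (f := fun θ => ∫ τ in (0 : ℝ)..1 / 4, Real.exp (-(h ^ 2 / 4 / τ)) * N (θ * τ, τ - θ * τ))
    (g := fun θ => θ ^ (-(1 / 2) : ℝ) * B) (a := 0) (b := 1 / 2) (by norm_num)
    (Filter.Eventually.of_forall fun θ hθ =>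
      hu.abs_integral_exp_mul_strain_le hf hh hε hθ.1 hθ.2)
    ((intervalIntegral.intervalIntegrable_rpow' (by norm_num)).mul_const _)
  refine hle.trans ?_
  rw [intervalIntegral.integral_mul_const]
  exact mul_le_mul_of_nonneg_right integral_rpow_neg_half_le hB0

end DivFree

namespace DivFree

variable {u : Fin 2 → (Fin 2 → ℝ) → ℝ}

/-- The enstrophy of a smooth divergence-free field is its Dirichlet energy. -/
lemma integral_fieldGradSq (hu : DivFree u) :
    ∫ x in box 2, fieldGradSq u x = ∫ x in box 2, (pd 0 (u 1) x - pd 1 (u 0) x) ^ 2 := by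
  have h0 := hu.smoothPeriodic 0
  have h1 := hu.smoothPeriodic 1
  have c00 := (h0.pd 0).continuous
  have c01 := (h0.pd 1).continuous
  have c10 := (h1.pd 0).continuous
  have c11 := (h1.pd 1).continuous
  have i0 := (h1.mul (h0.pd 1)).integral_pd 0
  have i1 := (h1.mul (h0.pd 0)).integral_pd 1
  have d0 := ((h1.mul (h0.pd 1)).pd 0).continuous
  have d1 := ((h1.mul (h0.pd 0)).pd 1).continuous
  have e : ∀ x, fieldGradSq u x - (pd 0 (u 1) x - pd 1 (u 0) x) ^ 2
      = 2 * pd 0 (fun x => u 1 x * pd 1 (u 0) x) x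
        - 2 * pd 1 (fun x => u 1 x * pd 0 (u 0) x) x := fun x => by
    rw [h1.pd_mul (h0.pd 1), h1.pd_mul (h0.pd 0), h0.pd_comm 0 1, fieldGradSq, gradSq, gradSq]
    linear_combination (pd 0 (u 0) x + pd 1 (u 1) x) * hu.div_eq_zero x
  rw [← sub_eq_zero, ← integral_sub (integrableOn_box hu.continuous_fieldGradSq)
    (integrableOn_box (by fun_prop))]
  simp only [e]
  rw [integral_sub (integrableOn_box (by fun_prop)) (integrableOn_box (by fun_prop)),
    integral_const_mul, integral_const_mul, i0, i1]
  simp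

end DivFree

lemma exp_neg_div_mul_inv_sq_le {a τ : ℝ} (ha : 0 < a) (hτ : 0 < τ) :
    Real.exp (-(a / τ)) * (τ ^ 2)⁻¹ ≤ 2 / a ^ 2 := by
  have h := Real.quadratic_le_exp_of_nonneg (x := a / τ) (by positivity)
  have h2 : (a / τ) ^ 2 / 2 ≤ Real.exp (a / τ) := by
    have : 0 ≤ a / τ := by positivity
    linarith
  have h3 : Real.exp (-(a / τ)) ≤ 2 / (a / τ) ^ 2 := by
    rw [Real.exp_neg, ← inv_div ((a / τ) ^ 2) 2]
    exact inv_anti₀ (by positivity) h2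
  calc _ ≤ 2 / (a / τ) ^ 2 * (τ ^ 2)⁻¹ := by gcongr
    _ = _ := by field_simp

lemma integral_exp_neg_div_mul_inv_sq {q : ℝ} (hq : 0 < q) :
    ∫ τ in (0 : ℝ)..1 / 4, Real.exp (-(q / 4 / τ)) * (τ ^ 2)⁻¹ = 4 * (Real.exp (-q) / q) := by
  have hInt : IntervalIntegrable (fun τ => Real.exp (-(q / 4 / τ)) * (τ ^ 2)⁻¹) volume 0 (1 / 4) := by
    rw [intervalIntegrable_iff_integrableOn_Ioc_of_le (by norm_num)]
    refine Measure.integrableOn_of_bounded (M := 2 / (q / 4) ^ 2) (by simp)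
      (Measurable.aestronglyMeasurable (by fun_prop)) ?_
    rw [ae_restrict_iff' measurableSet_Ioc]
    refine Filter.Eventually.of_forall fun τ hτ => ?_
    rw [Real.norm_eq_abs, abs_of_nonneg (by positivity)]
    exact exp_neg_div_mul_inv_sq_le (by positivity) hτ.1
  have h := intervalIntegral.integral_eq_sub_of_hasDerivAt_of_tendsto
    (f := fun τ => 4 / q * Real.exp (-(q / 4 / τ))) (fa := 0) (fb := 4 / q * Real.exp (-q))
    (by norm_num : (0 : ℝ) < 1 / 4) (fun τ hτ => ?_) hInt ?_ ?_
  · rw [h]; ring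
  · have hτ0 : τ ≠ 0 := hτ.1.ne'
    have d := ((((hasDerivAt_inv hτ0).const_mul (q / 4)).fun_neg).exp).const_mul (4 / q)
    refine (d.congr_of_eventuallyEq (Filter.Eventually.of_forall fun r => ?_)).congr_deriv ?_
    · simp [div_eq_mul_inv]
    · simp only [div_eq_mul_inv]
      field_simp
  · have t : Filter.Tendsto (fun τ : ℝ => q / 4 / τ) (nhdsWithin 0 (Set.Ioi 0)) Filter.atTop := by
      simp only [div_eq_mul_inv (q / 4)]
      exact Filter.Tendsto.const_mul_atTop (by positivity) tendsto_inv_nhdsGT_zero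
    have := ((Real.tendsto_exp_neg_atTop_nhds_zero.comp t).const_mul (4 / q))
    simpa using this
  · have c : ContinuousAt (fun τ : ℝ => 4 / q * Real.exp (-(q / 4 / τ))) (1 / 4) := by
      have : (1 / 4 : ℝ) ≠ 0 := by norm_num
      fun_prop (disch := assumption)
    have h2 := c.tendsto.mono_left (nhdsWithin_le_nhds (s := Set.Iio (1 / 4)))
    have e : q / 4 / (1 / 4) = q := by ring
    rwa [e] at h2

/-- A regularisation at scale `h` of `z ↦ |z|⁻²`, with Gaussian decay. -/
def expKernel (h : ℝ) (z : Fin 2 → ℝ) : ℝ :=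
  Real.exp (-(z 0 ^ 2 + z 1 ^ 2 + h ^ 2)) / (z 0 ^ 2 + z 1 ^ 2 + h ^ 2)

/-- The symmetrised correlation of two functions on the torus. -/
def corr (η f : (Fin 2 → ℝ) → ℝ) (z : Fin 2 → ℝ) : ℝ :=
  ∫ x in box 2, η x * (f (x + z) + f (x - z))

section Corr

variable {η f : (Fin 2 → ℝ) → ℝ}

lemma continuous_corr (hη : Continuous η) (hf : Continuous f) : Continuous (corr η f) :=
  continuous_box (F := fun z x => η x * (f (x + z) + f (x - z))) (by
    unfold Function.uncurry; fun_prop)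

lemma abs_setIntegral_box_le {g : (Fin 2 → ℝ) → ℝ} {M : ℝ} (hM : ∀ x, |g x| ≤ M) :
    |∫ x in box 2, g x| ≤ M := by
  have := norm_setIntegral_le_of_norm_le_const (μ := volume) (s := box 2) (f := g) (C := M)
    (by simp [volume_box]) fun x _ => hM x
  simpa [measureReal_def, volume_box] using this

lemma exists_bound_corr (hη : Continuous η) (hηp : IsPeriodic η) (hf : SmoothPeriodic f) :
    ∃ M, 0 ≤ M ∧ ∀ z, |corr η f z| ≤ M := by
  obtain ⟨M1, h1, hM1⟩ := hηp.exists_bound hη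
  obtain ⟨M2, h2, hM2⟩ := hf.exists_bound
  refine ⟨M1 * (M2 + M2), by positivity, fun z => abs_setIntegral_box_le fun x => ?_⟩
  rw [abs_mul]
  gcongr
  · exact hM1 x
  · exact (abs_add_le _ _).trans (add_le_add (hM2 _) (hM2 _))

lemma integral_gaussKernel_mul_corr (hη : Continuous η) (hf : SmoothPeriodic f) (τ : ℝ) :
    ∫ z, gaussKernel z * corr η f (√τ • z) = 2 * ∫ x in box 2, η x * heat f τ x := by
  have hfc := hf.continuous
  obtain ⟨M, hM0, hM⟩ := hf.exists_bound
  have h1 : ∀ x, ∫ z, gaussKernel z * (f (x + √τ • z) + f (x - √τ • z)) = 2 * heat f τ x :=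
      fun x => by
    have i : ∀ t : ℝ, Integrable fun z : Fin 2 → ℝ => gaussKernel z * f (x + t • z) := fun t =>
      integrable_gaussKernel_mul (f := fun z => f (x + t • z)) (by fun_prop) fun z => hM _
    have e : ∫ z : Fin 2 → ℝ, gaussKernel z * f (x + (-√τ) • z) = heat f τ x := by
      rw [heat, ← integral_neg_eq_self]
      simp [gaussKernel_neg]
    have e2 : ∀ z : Fin 2 → ℝ, gaussKernel z * (f (x + √τ • z) + f (x - √τ • z))
        = gaussKernel z * f (x + √τ • z) + gaussKernel z * f (x + (-√τ) • z) := fun z => by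
      rw [mul_add, neg_smul, sub_eq_add_neg]
    simp only [e2]
    rw [integral_add (i _) (i _), e, heat]
    ring
  have hInt : Integrable (Function.uncurry fun (z x : Fin 2 → ℝ) =>
      gaussKernel z * (η x * (f (x + √τ • z) + f (x - √τ • z))))
      (volume.prod (volume.restrict (box 2))) := by
    have i := integrable_gaussKernel.mul_prod (integrableOn_box hη)
    have i2 := i.mul_bdd (c := M + M) (g := fun q : (Fin 2 → ℝ) × (Fin 2 → ℝ) =>
      f (q.2 + √τ • q.1) + f (q.2 - √τ • q.1))
      (Continuous.aestronglyMeasurable (by fun_prop))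
      (Filter.Eventually.of_forall fun q =>
        (abs_add_le _ _).trans (add_le_add (hM _) (hM _)))
    refine i2.congr (Filter.Eventually.of_forall fun q => ?_)
    simp only [Function.uncurry]
    ring
  have h2 := integral_integral_swap hInt
  simp only [corr, ← integral_const_mul]
  rw [h2]
  congr 1
  ext x
  rw [← mul_assoc, mul_comm 2 (η x), mul_assoc, ← h1, ← integral_const_mul]
  congr 1
  ext z
  ring

lemma integral_exp_mul_corr (hη : Continuous η) (hf : SmoothPeriodic f) {τ : ℝ} (hτ : 0 < τ) :
    ∫ z : Fin 2 → ℝ, Real.exp (-((z 0 ^ 2 + z 1 ^ 2) / 4 / τ)) * corr η f z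
      = 8 * Real.pi * τ * ∫ x in box 2, η x * heat f τ x := by
  have hs : 0 < √τ := Real.sqrt_pos.2 hτ
  have h := Measure.integral_comp_smul_of_nonneg (volume : Measure (Fin 2 → ℝ))
    (fun z : Fin 2 → ℝ => Real.exp (-((z 0 ^ 2 + z 1 ^ 2) / 4 / τ)) * corr η f z) (√τ)
    (hR := hs.le)
  have h2 : ∀ z : Fin 2 → ℝ, Real.exp (-(((√τ • z) 0 ^ 2 + (√τ • z) 1 ^ 2) / 4 / τ))
      * corr η f (√τ • z) = 4 * Real.pi * (gaussKernel z * corr η f (√τ • z)) := fun z => by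
    have : ((√τ • z) 0 ^ 2 + (√τ • z) 1 ^ 2) / 4 / τ = 1 / 4 * (z 0 ^ 2 + z 1 ^ 2) := by
      simp only [Pi.smul_apply, smul_eq_mul, mul_pow, Real.sq_sqrt hτ.le]
      field_simp
    have hpi := Real.pi_pos
    rw [this, gaussKernel, neg_mul]
    field_simp
  simp only [h2] at h
  rw [integral_const_mul, integral_gaussKernel_mul_corr hη hf, Module.finrank_fin_fun,
    Real.sq_sqrt hτ.le, smul_eq_mul] at h
  field_simp at h
  simp only [div_div]
  linarith

lemma integral_expKernel_mul_corr (hη : Continuous η) (hηp : IsPeriodic η)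
    (hf : SmoothPeriodic f) {h : ℝ} (hh : 0 < h) :
    ∫ z, expKernel h z * corr η f z
      = 2 * Real.pi * ∫ τ in (0 : ℝ)..1 / 4, Real.exp (-(h ^ 2 / 4 / τ)) *
        (τ⁻¹ * ∫ x in box 2, η x * heat f τ x) := by
  obtain ⟨M, hM0, hM⟩ := exists_bound_corr hη hηp hf
  have hcc := continuous_corr hη hf.continuous
  set F : ℝ → (Fin 2 → ℝ) → ℝ := fun τ z =>
    Real.exp (-(h ^ 2 / 4 / τ)) * (τ ^ 2)⁻¹ *
      (Real.exp (-((z 0 ^ 2 + z 1 ^ 2) / 4 / τ)) * corr η f z) with hF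
  have hInt : Integrable (Function.uncurry F)
      ((volume.restrict (Set.uIoc 0 (1 / 4))).prod volume) := by
    have i1 : IntegrableOn (fun _ : ℝ => 2 / (h ^ 2 / 4) ^ 2) (Set.uIoc 0 (1 / 4)) := by
      rw [Set.uIoc_of_le (by norm_num)]
      exact integrableOn_const (by simp)
    have i2 := (integrable_exp_neg_mul_sq_add_sq (a := 1) (by norm_num)).mul_const M
    refine (i1.mul_prod i2).mono' (Measurable.aestronglyMeasurable ?_) ?_
    · have := hcc.measurable
      unfold Function.uncurry
      fun_prop
    · have e : (volume.restrict (Set.uIoc (0 : ℝ) (1 / 4))).prod (volume : Measure (Fin 2 → ℝ))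
          = (volume.prod volume).restrict (Set.Ioc 0 (1 / 4) ×ˢ Set.univ) := by
        rw [Set.uIoc_of_le (by norm_num), ← Measure.prod_restrict, Measure.restrict_univ]
      rw [e, ae_restrict_iff' (measurableSet_Ioc.prod MeasurableSet.univ)]
      refine Filter.Eventually.of_forall fun q hq => ?_
      obtain ⟨τ, z⟩ := q
      have hτ0 : 0 < τ := hq.1.1
      have hτ1 : τ ≤ 1 / 4 := hq.1.2
      simp only [hF, Function.uncurry, Real.norm_eq_abs]
      rw [abs_mul, abs_mul (Real.exp _) (corr η f z), abs_of_nonneg (by positivity),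
        abs_of_pos (Real.exp_pos _)]
      gcongr
      · exact exp_neg_div_mul_inv_sq_le (by positivity) hτ0
      · rw [neg_one_mul, neg_le_neg_iff, le_div_iff₀ hτ0]
        nlinarith [sq_nonneg (z 0), sq_nonneg (z 1)]
      · exact hM z
  have h2 := intervalIntegral_integral_swap hInt
  have h3 : ∀ z, ∫ τ in (0 : ℝ)..1 / 4, F τ z = 4 * (expKernel h z * corr η f z) := fun z => by
    have hq : 0 < z 0 ^ 2 + z 1 ^ 2 + h ^ 2 := by positivity
    have e : ∀ τ, F τ z = Real.exp (-((z 0 ^ 2 + z 1 ^ 2 + h ^ 2) / 4 / τ)) * (τ ^ 2)⁻¹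
        * corr η f z := fun τ => by
      have : -((z 0 ^ 2 + z 1 ^ 2 + h ^ 2) / 4 / τ)
          = -(h ^ 2 / 4 / τ) + -((z 0 ^ 2 + z 1 ^ 2) / 4 / τ) := by ring
      rw [this, Real.exp_add]
      simp only [hF]
      ring
    simp only [e]
    rw [intervalIntegral.integral_mul_const, integral_exp_neg_div_mul_inv_sq hq, expKernel]
    ring
  simp only [h3] at h2
  rw [integral_const_mul] at h2
  have h4 : ∫ τ in (0 : ℝ)..1 / 4, ∫ z, F τ z = 8 * Real.pi *
      ∫ τ in (0 : ℝ)..1 / 4, Real.exp (-(h ^ 2 / 4 / τ)) *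
        (τ⁻¹ * ∫ x in box 2, η x * heat f τ x) := by
    rw [← intervalIntegral.integral_const_mul]
    simp only [intervalIntegral.integral_of_le (by norm_num : (0 : ℝ) ≤ 1 / 4)]
    refine setIntegral_congr_fun measurableSet_Ioc fun τ hτ => ?_
    have hτ0 : 0 < τ := hτ.1
    simp only [hF]
    rw [integral_const_mul, integral_exp_mul_corr hη hf hτ0]
    field_simp
  linarith

end Corr

lemma DivFree.adv_periodic {u : Fin 2 → (Fin 2 → ℝ) → ℝ} {f : (Fin 2 → ℝ) → ℝ} (hu : DivFree u)
    (hf : SmoothPeriodic f) : IsPeriodic (adv u f) := fun x k => by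
  simp only [adv, (hu.smoothPeriodic _).periodic x k, (hf.pd _).periodic x k]

lemma DivFree.abs_integral_expKernel_mul_corr_le {u : Fin 2 → (Fin 2 → ℝ) → ℝ}
    {f : (Fin 2 → ℝ) → ℝ} (hu : DivFree u) (hf : SmoothPeriodic f) {h ε : ℝ} (hh : 0 < h)
    (hε : 0 < ε) :
    |∫ z, expKernel h z * corr (adv u f) f z|
      ≤ 4 * Real.pi * (ε * (∫ x in box 2, fieldGradSq u x)
          * Real.log ((1 / 4 + h ^ 2 / 4) / (h ^ 2 / 4))
        + 5 / 3 * (∫ x in box 2, f x ^ 4) / ε) := by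
  have h1 := hu.abs_integral_exp_mul_adv_heat_le hf hh hε
  have h2 : ∀ τ, ∫ x in box 2, adv u f x * heat f τ x
      = -∫ x in box 2, f x * adv u (heat f τ) x := fun τ => by
    rw [hu.integral_mul_adv hf (hf.heat τ), neg_neg]
  rw [integral_expKernel_mul_corr (hu.continuous_adv hf) (hu.adv_periodic hf) hf hh]
  simp only [h2, mul_neg, intervalIntegral.integral_neg]
  rw [abs_neg, abs_mul, abs_of_pos (by positivity : 0 < 2 * Real.pi)]
  have := mul_le_mul_of_nonneg_left h1 (by positivity : 0 ≤ 2 * Real.pi)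
  linarith

/-- The correlation of two functions on the torus. -/
def crossCorr (p q : (Fin 2 → ℝ) → ℝ) (z : Fin 2 → ℝ) : ℝ :=
  ∫ x in box 2, p x * q (x + z)

section CrossCorr

variable {p q : (Fin 2 → ℝ) → ℝ}

lemma SmoothPeriodic.exists_lipschitzWith (hq : SmoothPeriodic q) : ∃ K, LipschitzWith K q := by
  have hc : Continuous fun x => ‖fderiv ℝ q x‖ := (hq.smooth.continuous_fderiv (by simp)).norm
  have hp : IsPeriodic fun x => ‖fderiv ℝ q x‖ := fun x k => by
    have : (fun y => q (y + fun i => (k i : ℝ))) = q := funext fun y => hq.periodic y k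
    simp only
    rw [← fderiv_comp_add_right, this]
  obtain ⟨M, hM0, hM⟩ := hp.exists_bound hc
  refine ⟨⟨M, hM0⟩, lipschitzWith_of_nnnorm_fderiv_le hq.differentiable fun x => ?_⟩
  have := hM x
  rwa [abs_of_nonneg (norm_nonneg _)] at this

lemma continuous_crossCorr (hp : Continuous p) (hq : Continuous q) :
    Continuous (crossCorr p q) :=
  continuous_box (F := fun z x => p x * q (x + z)) (by unfold Function.uncurry; fun_prop)

lemma exists_bound_crossCorr (hp : SmoothPeriodic p) (hq : SmoothPeriodic q) :
    ∃ M, 0 ≤ M ∧ ∀ z, |crossCorr p q z| ≤ M := by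
  obtain ⟨M1, h1, hM1⟩ := hp.exists_bound
  obtain ⟨M2, h2, hM2⟩ := hq.exists_bound
  refine ⟨M1 * M2, by positivity, fun z => abs_setIntegral_box_le fun x => ?_⟩
  rw [abs_mul]
  exact mul_le_mul (hM1 x) (hM2 _) (abs_nonneg _) h1

lemma exists_lipschitzWith_crossCorr (hp : SmoothPeriodic p) (hq : SmoothPeriodic q) :
    ∃ K, LipschitzWith K (crossCorr p q) := by
  obtain ⟨M, hM0, hM⟩ := hp.exists_bound
  obtain ⟨K, hK⟩ := hq.exists_lipschitzWith
  have cp := hp.continuous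
  have cq := hq.continuous
  refine ⟨M.toNNReal * K, LipschitzWith.of_dist_le_mul fun z w => ?_⟩
  rw [Real.dist_eq, crossCorr, crossCorr, ← integral_sub (integrableOn_box (by fun_prop))
    (integrableOn_box (by fun_prop))]
  refine abs_setIntegral_box_le fun x => ?_
  rw [← mul_sub, abs_mul, NNReal.coe_mul, Real.coe_toNNReal M hM0, mul_assoc]
  have h := hK.dist_le_mul (x + z) (x + w)
  rw [Real.dist_eq, dist_add_left] at h
  exact mul_le_mul (hM x) h (abs_nonneg _) hM0

lemma hasLineDerivAt_crossCorr (hp : SmoothPeriodic p) (hq : SmoothPeriodic q) (i : Fin 2)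
    (z : Fin 2 → ℝ) :
    HasLineDerivAt ℝ (crossCorr p q) (crossCorr p (pd i q) z) z (Pi.single i 1) := by
  have cp := hp.continuous
  have cq := hq.continuous
  have cq' := (hq.pd i).continuous
  unfold HasLineDerivAt
  have := hasDerivAt_box (d := 2) (U := Set.univ) (s₀ := 0) Filter.univ_mem
    (F := fun (t : ℝ) x => p x * q (x + (z + t • Pi.single i 1)))
    (F' := fun t x => p x * pd i q (x + (z + t • Pi.single i 1)))
    (fun s => by fun_prop) (by unfold Function.uncurry; fun_prop) fun s _ x => by
      have h := hq.hasLineDerivAt i (x + (z + s • Pi.single i 1))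
      unfold HasLineDerivAt at h
      have h0 : HasDerivAt (fun r : ℝ => r - s) 1 s := (hasDerivAt_id s).sub_const s
      have h2 := (HasDerivAt.scomp (h := fun r : ℝ => r - s) s (by simpa using h) h0).const_mul (p x)
      refine (h2.congr_of_eventuallyEq (Filter.Eventually.of_forall fun r => ?_)).congr_deriv
        (by simp)
      simp only [Function.comp, sub_smul]
      congr 2
      abel
  simpa [crossCorr] using this

end CrossCorr

/-- The `j`-th component of a vector field whose divergence is the symmetrised correlation of
`u · ∇f` and `f`, for divergence-free `u`. -/
def flux (u : Fin 2 → (Fin 2 → ℝ) → ℝ) (f : (Fin 2 → ℝ) → ℝ) (j : Fin 2) (z : Fin 2 → ℝ) : ℝ :=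
  crossCorr f (fun x => f x * u j x) z - crossCorr (fun x => f x * u j x) f z

/-- The derivative of the `j`-th component of the flux in the `j`-th direction. -/
def fluxDeriv (u : Fin 2 → (Fin 2 → ℝ) → ℝ) (f : (Fin 2 → ℝ) → ℝ) (j : Fin 2)
    (z : Fin 2 → ℝ) : ℝ :=
  crossCorr f (pd j fun x => f x * u j x) z - crossCorr (fun x => f x * u j x) (pd j f) z

namespace DivFree

variable {u : Fin 2 → (Fin 2 → ℝ) → ℝ} {f : (Fin 2 → ℝ) → ℝ}

lemma hasLineDerivAt_flux (hu : DivFree u) (hf : SmoothPeriodic f) (j : Fin 2) (z : Fin 2 → ℝ) :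
    HasLineDerivAt ℝ (flux u f j) (fluxDeriv u f j z) z (Pi.single j 1) := by
  have hq := hf.mul (hu.smoothPeriodic j)
  have h1 := hasLineDerivAt_crossCorr hf hq j z
  have h2 := hasLineDerivAt_crossCorr hq hf j z
  unfold HasLineDerivAt at *
  exact h1.fun_sub h2

lemma exists_lipschitzWith_flux (hu : DivFree u) (hf : SmoothPeriodic f) (j : Fin 2) :
    ∃ K, LipschitzWith K (flux u f j) := by
  have hq := hf.mul (hu.smoothPeriodic j)
  obtain ⟨K1, h1⟩ := exists_lipschitzWith_crossCorr hf hq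
  obtain ⟨K2, h2⟩ := exists_lipschitzWith_crossCorr hq hf
  exact ⟨K1 + K2, h1.sub h2⟩

lemma exists_bound_flux (hu : DivFree u) (hf : SmoothPeriodic f) (j : Fin 2) :
    ∃ M, 0 ≤ M ∧ ∀ z, |flux u f j z| ≤ M := by
  have hq := hf.mul (hu.smoothPeriodic j)
  obtain ⟨M1, h1, hM1⟩ := exists_bound_crossCorr hf hq
  obtain ⟨M2, h2, hM2⟩ := exists_bound_crossCorr hq hf
  exact ⟨M1 + M2, by positivity, fun z =>
    (abs_sub _ _).trans (add_le_add (hM1 z) (hM2 z))⟩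

lemma exists_bound_fluxDeriv (hu : DivFree u) (hf : SmoothPeriodic f) (j : Fin 2) :
    ∃ M, 0 ≤ M ∧ ∀ z, |fluxDeriv u f j z| ≤ M := by
  have hq := hf.mul (hu.smoothPeriodic j)
  obtain ⟨M1, h1, hM1⟩ := exists_bound_crossCorr hf (hq.pd j)
  obtain ⟨M2, h2, hM2⟩ := exists_bound_crossCorr hq (hf.pd j)
  exact ⟨M1 + M2, by positivity, fun z =>
    (abs_sub _ _).trans (add_le_add (hM1 z) (hM2 z))⟩

lemma continuous_flux (hu : DivFree u) (hf : SmoothPeriodic f) (j : Fin 2) :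
    Continuous (flux u f j) :=
  (hu.exists_lipschitzWith_flux hf j).choose_spec.continuous

lemma continuous_fluxDeriv (hu : DivFree u) (hf : SmoothPeriodic f) (j : Fin 2) :
    Continuous (fluxDeriv u f j) := by
  have hq := hf.mul (hu.smoothPeriodic j)
  exact (continuous_crossCorr hf.continuous (hq.pd j).continuous).sub
    (continuous_crossCorr hq.continuous (hf.pd j).continuous)

lemma corr_adv_eq (hu : DivFree u) (hf : SmoothPeriodic f) (z : Fin 2 → ℝ) :
    corr (adv u f) f z = fluxDeriv u f 0 z + fluxDeriv u f 1 z := by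
  have cf := hf.continuous
  have cu := fun j => (hu.smoothPeriodic j).continuous
  have cf' := fun j => (hf.pd j).continuous
  have cq := fun j => ((hf.mul (hu.smoothPeriodic j)).pd j).continuous
  have ca := hu.continuous_adv hf
  have h1 : crossCorr f (pd 0 fun x => f x * u 0 x) z + crossCorr f (pd 1 fun x => f x * u 1 x) z
      = ∫ x in box 2, adv u f x * f (x - z) := by
    have t := IsPeriodic.setIntegral_box_comp_add (f := fun x => adv u f x * f (x - z))
      (fun x k => by
        have := hu.adv_periodic hf x k
        have h := hf.periodic (x - z) k
        simp only [this]
        rw [add_sub_right_comm, h]) z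
    rw [← t, crossCorr, crossCorr, ← integral_add (integrableOn_box (by fun_prop))
      (integrableOn_box (by fun_prop))]
    congr 1
    ext x
    rw [hf.pd_mul (hu.smoothPeriodic 0), hf.pd_mul (hu.smoothPeriodic 1), add_sub_cancel_right, adv]
    linear_combination f x * f (x + z) * hu.div_eq_zero (x + z)
  have h2 : crossCorr (fun x => f x * u 0 x) (pd 0 f) z
      + crossCorr (fun x => f x * u 1 x) (pd 1 f) z = -∫ x in box 2, adv u f x * f (x + z) := by
    rw [← hu.integral_mul_adv hf (hf.comp_add z), crossCorr, crossCorr,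
      ← integral_add (integrableOn_box (by fun_prop)) (integrableOn_box (by fun_prop))]
    congr 1
    ext x
    rw [adv, SmoothPeriodic.pd_comp_add, SmoothPeriodic.pd_comp_add]
    ring
  have h3 : corr (adv u f) f z
      = (∫ x in box 2, adv u f x * f (x + z)) + ∫ x in box 2, adv u f x * f (x - z) := by
    rw [corr, ← integral_add (integrableOn_box (by fun_prop)) (integrableOn_box (by fun_prop))]
    congr 1
    ext x
    ring
  rw [h3, fluxDeriv, fluxDeriv]
  linarith

lemma abs_flux_le (hu : DivFree u) (hf : SmoothPeriodic f) (z : Fin 2 → ℝ) {ε : ℝ} (hε : 0 < ε) :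
    |z 0 * flux u f 0 z + z 1 * flux u f 1 z|
      ≤ (z 0 ^ 2 + z 1 ^ 2) * (ε / 2 * (∫ x in box 2, fieldGradSq u x)
        + 1 / (2 * ε) * ∫ x in box 2, f x ^ 4) := by
  have cf := hf.continuous
  have cu := fun j => (hu.smoothPeriodic j).continuous
  have cu' := fun i j => ((hu.smoothPeriodic j).pd i).continuous
  have cg := hu.continuous_fieldGradSq
  set H : ℝ → ℝ := fun t => ∫ x in box 2, f x * f (x + z) *
    (z 0 * u 0 (x + t • z) + z 1 * u 1 (x + t • z)) with hH
  set S : (Fin 2 → ℝ) → ℝ := fun y => z 0 * (z 0 * pd 0 (u 0) y + z 1 * pd 1 (u 0) y)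
    + z 1 * (z 0 * pd 0 (u 1) y + z 1 * pd 1 (u 1) y) with hS
  set C := (z 0 ^ 2 + z 1 ^ 2) * (ε / 2 * (∫ x in box 2, fieldGradSq u x)
        + 1 / (2 * ε) * ∫ x in box 2, f x ^ 4) with hC
  have hd : ∀ t, HasDerivAt H (∫ x in box 2, f x * f (x + z) * S (x + t • z)) t := fun t => by
    refine hasDerivAt_box (d := 2) (U := Set.univ) Filter.univ_mem
      (F := fun (t : ℝ) x => f x * f (x + z) * (z 0 * u 0 (x + t • z) + z 1 * u 1 (x + t • z)))
      (F' := fun t x => f x * f (x + z) * S (x + t • z))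
      (fun s => by fun_prop) (by unfold Function.uncurry; fun_prop) fun s _ x => ?_
    have hv : HasDerivAt (fun r : ℝ => x + r • z) z s := by
      simpa using ((hasDerivAt_id s).smul_const z).const_add x
    have hj : ∀ j, HasDerivAt (fun r : ℝ => u j (x + r • z))
        (z 0 * pd 0 (u j) (x + s • z) + z 1 * pd 1 (u j) (x + s • z)) s := fun j => by
      have := ((hu.smoothPeriodic j).differentiable _).hasFDerivAt.comp_hasDerivAt s hv
      refine this.congr_deriv ?_
      rw [fderiv_apply_eq_sum, Fin.sum_univ_two]
    exact (((hj 0).const_mul (z 0)).fun_add ((hj 1).const_mul (z 1))).const_mul _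
  have hb : ∀ t : ℝ, ‖∫ x in box 2, f x * f (x + z) * S (x + t • z)‖ ≤ C := fun t => by
    have i4 : ∫ x in box 2, f (x + z) ^ 4 = ∫ x in box 2, f x ^ 4 :=
      IsPeriodic.setIntegral_box_comp_add (f := fun x => f x ^ 4)
        (fun x k => by simp only [hf.periodic x k]) z
    have ig : ∫ x in box 2, fieldGradSq u (x + t • z) = ∫ x in box 2, fieldGradSq u x :=
      IsPeriodic.setIntegral_box_comp_add (f := fieldGradSq u)
        (fun x k => by
          simp only [fieldGradSq, gradSq, ((hu.smoothPeriodic _).pd _).periodic x k]) (t • z)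
    have hpt : ∀ x, ‖f x * f (x + z) * S (x + t • z)‖ ≤ (z 0 ^ 2 + z 1 ^ 2) *
        (ε / 2 * fieldGradSq u (x + t • z) + (1 / (4 * ε) * f x ^ 4 + 1 / (4 * ε) * f (x + z) ^ 4)) := by
      intro x
      generalize f x = a
      generalize f (x + z) = b
      generalize x + t • z = y
      have hg : 0 ≤ fieldGradSq u y := by unfold fieldGradSq gradSq; positivity
      have hSq : S y ^ 2 ≤ (z 0 ^ 2 + z 1 ^ 2) ^ 2 * fieldGradSq u y := by
        simp only [hS, fieldGradSq, gradSq]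
        generalize pd 0 (u 0) y = m00
        generalize pd 1 (u 0) y = m10
        generalize pd 0 (u 1) y = m01
        generalize pd 1 (u 1) y = m11
        generalize z 0 = z0
        generalize z 1 = z1
        have c1 : (z0 * m00 + z1 * m10) ^ 2 ≤ (z0 ^ 2 + z1 ^ 2) * (m00 ^ 2 + m10 ^ 2) := by
          nlinarith [sq_nonneg (z0 * m10 - z1 * m00)]
        have c2 : (z0 * m01 + z1 * m11) ^ 2 ≤ (z0 ^ 2 + z1 ^ 2) * (m01 ^ 2 + m11 ^ 2) := by
          nlinarith [sq_nonneg (z0 * m11 - z1 * m01)]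
        generalize z0 * m00 + z1 * m10 = v0 at *
        generalize z0 * m01 + z1 * m11 = v1 at *
        have c3 : (z0 * v0 + z1 * v1) ^ 2 ≤ (z0 ^ 2 + z1 ^ 2) * (v0 ^ 2 + v1 ^ 2) := by
          nlinarith [sq_nonneg (z0 * v1 - z1 * v0)]
        have hz : 0 ≤ z0 ^ 2 + z1 ^ 2 := by positivity
        nlinarith [mul_le_mul_of_nonneg_left (add_le_add c1 c2) hz]
      have hab : (a * b) ^ 2 ≤ (a ^ 4 + b ^ 4) / 2 := by nlinarith [sq_nonneg (a ^ 2 - b ^ 2)]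
      rw [Real.norm_eq_abs]
      refine abs_le_of_sq_le_sq ?_ (by positivity)
      have hX : (a * b) ^ 2 * fieldGradSq u y ≤
          (ε / 2 * fieldGradSq u y + (1 / (4 * ε) * a ^ 4 + 1 / (4 * ε) * b ^ 4)) ^ 2 := by
        have e : ε / 2 * fieldGradSq u y + (1 / (4 * ε) * a ^ 4 + 1 / (4 * ε) * b ^ 4)
          = ε / 2 * fieldGradSq u y + ((a ^ 4 + b ^ 4) / 2) / (2 * ε) := by field_simp; ring
        have e2 : fieldGradSq u y * ((a ^ 4 + b ^ 4) / 2) =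
          4 * (ε / 2 * fieldGradSq u y) * (((a ^ 4 + b ^ 4) / 2) / (2 * ε)) := by field_simp; ring
        rw [e]
        nlinarith [mul_le_mul_of_nonneg_right hab hg, sq_nonneg (ε / 2 * fieldGradSq u y -
          ((a ^ 4 + b ^ 4) / 2) / (2 * ε))]
      calc (a * b * S y) ^ 2 = (a * b) ^ 2 * S y ^ 2 := by ring
        _ ≤ (a * b) ^ 2 * ((z 0 ^ 2 + z 1 ^ 2) ^ 2 * fieldGradSq u y) := by gcongr
        _ = (z 0 ^ 2 + z 1 ^ 2) ^ 2 * ((a * b) ^ 2 * fieldGradSq u y) := by ring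
        _ ≤ _ := (mul_le_mul_of_nonneg_left hX (by positivity)).trans_eq (mul_pow _ _ 2).symm
    refine (norm_integral_le_of_norm_le (integrableOn_box (by fun_prop))
      (Filter.Eventually.of_forall hpt)).trans_eq ?_
    rw [integral_const_mul, integral_add (integrableOn_box (by fun_prop))
      (integrableOn_box (by fun_prop)), integral_add (integrableOn_box (by fun_prop))
      (integrableOn_box (by fun_prop)), integral_const_mul, integral_const_mul, integral_const_mul,
      i4, ig, hC]
    ring
  have hmv := norm_image_sub_le_of_norm_deriv_le_segment_01' (f := H)
    (fun t _ => (hd t).hasDerivWithinAt) (fun t _ => hb t)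
  have e : z 0 * flux u f 0 z + z 1 * flux u f 1 z = H 1 - H 0 := by
    simp only [hH, flux, crossCorr]
    rw [← integral_sub (integrableOn_box (by fun_prop)) (integrableOn_box (by fun_prop)),
      ← integral_sub (integrableOn_box (by fun_prop)) (integrableOn_box (by fun_prop)),
      ← integral_sub (integrableOn_box (by fun_prop)) (integrableOn_box (by fun_prop)),
      ← integral_const_mul, ← integral_const_mul,
      ← integral_add (integrableOn_box (by fun_prop)) (integrableOn_box (by fun_prop))]
    congr 1
    ext x
    simp
    ring
  rw [e]
  exact hmv

end DivFree

section ENormBasic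

lemma eNorm_eq_norm {d : ℕ} (z : Fin d → ℝ) : eNorm z = ‖WithLp.toLp 2 z‖ := by
  rw [eNorm, EuclideanSpace.norm_eq]
  simp

lemma eNorm_nonneg {d : ℕ} (z : Fin d → ℝ) : 0 ≤ eNorm z := Real.sqrt_nonneg _

lemma continuous_eNorm {d : ℕ} : Continuous (eNorm : (Fin d → ℝ) → ℝ) := by
  unfold eNorm
  fun_prop

lemma eNorm_sq (z : Fin 2 → ℝ) : eNorm z ^ 2 = z 0 ^ 2 + z 1 ^ 2 := by
  rw [eNorm, Real.sq_sqrt (by positivity), Fin.sum_univ_two]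

lemma abs_apply_le_eNorm {d : ℕ} (z : Fin d → ℝ) (i : Fin d) : |z i| ≤ eNorm z := by
  rw [eNorm_eq_norm]
  exact PiLp.norm_apply_le (WithLp.toLp 2 z) i

lemma norm_le_eNorm {d : ℕ} (z : Fin d → ℝ) : ‖z‖ ≤ eNorm z :=
  (pi_norm_le_iff_of_nonneg (eNorm_nonneg z)).2 fun i => abs_apply_le_eNorm z i

lemma eNorm_pos {z : Fin 2 → ℝ} (hz : z ≠ 0) : 0 < eNorm z :=
  (norm_pos_iff.2 hz).trans_le (norm_le_eNorm z)

lemma abs_eNorm_sub_le (z w : Fin 2 → ℝ) : |eNorm z - eNorm w| ≤ 2 * ‖z - w‖ := by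
  have h : |eNorm z - eNorm w| ≤ eNorm (z - w) := by
    simp only [eNorm_eq_norm, WithLp.toLp_sub]
    exact abs_norm_sub_norm_le _ _
  refine h.trans (Real.sqrt_le_iff.2 ⟨by positivity, ?_⟩)
  have h0 := norm_le_pi_norm (z - w) 0
  have h1 := norm_le_pi_norm (z - w) 1
  rw [Real.norm_eq_abs] at h0 h1
  rw [Fin.sum_univ_two, ← sq_abs ((z - w) 0), ← sq_abs ((z - w) 1)]
  nlinarith [abs_nonneg ((z - w) 0), abs_nonneg ((z - w) 1)]

lemma hasDerivAt_eNorm_add_smul_single {z : Fin 2 → ℝ} (hz : z ≠ 0) (j : Fin 2) :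
    HasDerivAt (fun t : ℝ => eNorm (z - t • Pi.single j 1)) (-z j / eNorm z) 0 := by
  have hz2 : z 0 ^ 2 + z 1 ^ 2 ≠ 0 := by
    rw [← eNorm_sq]
    exact pow_ne_zero _ (eNorm_pos hz).ne'
  have hq : HasDerivAt (fun t : ℝ => ∑ i, (z - t • (Pi.single j 1 : Fin 2 → ℝ)) i ^ 2) (-(2 * z j)) 0 := by
    have hi : ∀ i, HasDerivAt (fun t : ℝ => (z - t • (Pi.single j 1 : Fin 2 → ℝ)) i ^ 2)
        (2 * z i * -(Pi.single j (1 : ℝ) : Fin 2 → ℝ) i) 0 := fun i => by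
      have := ((((hasDerivAt_id (0 : ℝ)).mul_const
        ((Pi.single j (1 : ℝ) : Fin 2 → ℝ) i)).const_sub (z i)).fun_pow 2)
      exact this.congr_deriv (by simp)
    simp only [Fin.sum_univ_two]
    refine ((hi 0).fun_add (hi 1)).congr_deriv ?_
    fin_cases j <;> simp
  refine (hq.sqrt (by simpa [Fin.sum_univ_two] using hz2)).congr_deriv ?_
  simp only [zero_smul, sub_zero, eNorm]
  rw [neg_div, neg_div, mul_div_mul_left _ _ two_ne_zero]

lemma ae_eNorm_ne (r : ℝ) : ∀ᵐ z : Fin 2 → ℝ, eNorm z ≠ r := by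
  have h := (PiLp.volume_preserving_toLp (Fin 2)).quasiMeasurePreserving.preimage_null
    (Measure.addHaar_sphere volume (0 : EuclideanSpace ℝ (Fin 2)) r)
  rw [ae_iff]
  convert h using 2
  ext z
  simp [eNorm_eq_norm]

end ENormBasic

/-- The kernel `(|z| + h)⁻²`, truncated continuously to the ball of radius `1/2`. -/
def cutKernel (h : ℝ) (z : Fin 2 → ℝ) : ℝ :=
  ((min (eNorm z) (1 / 2) + h) ^ 2)⁻¹ - ((1 / 2 + h) ^ 2)⁻¹

/-- The radial derivative of `cutKernel`, up to the factor `-|z|⁻¹`. -/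
def cutKernelDeriv (h : ℝ) (z : Fin 2 → ℝ) : ℝ :=
  if eNorm z < 1 / 2 then 2 * ((eNorm z + h) ^ 3)⁻¹ * (eNorm z)⁻¹ else 0

/-- The radial derivative of `expKernel`, up to the factor `-|z|⁻¹`. -/
def expKernelDeriv (h : ℝ) (z : Fin 2 → ℝ) : ℝ :=
  2 * (Real.exp (-(z 0 ^ 2 + z 1 ^ 2 + h ^ 2)) *
    ((z 0 ^ 2 + z 1 ^ 2 + h ^ 2)⁻¹ + ((z 0 ^ 2 + z 1 ^ 2 + h ^ 2) ^ 2)⁻¹))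

section CutKernel

variable {h : ℝ}

lemma cutKernel_of_le {z : Fin 2 → ℝ} (hz : 1 / 2 ≤ eNorm z) : cutKernel h z = 0 := by
  rw [cutKernel, min_eq_right hz, sub_self]

lemma abs_inv_sq_sub_inv_sq_le (hh : 0 < h) {a b : ℝ} (ha : 0 ≤ a) (hb : 0 ≤ b) :
    |((a + h) ^ 2)⁻¹ - ((b + h) ^ 2)⁻¹| ≤ 2 * (h ^ 3)⁻¹ * |a - b| := by
  have hA : (a + h)⁻¹ ≤ h⁻¹ := inv_anti₀ hh (by linarith)
  have hB : (b + h)⁻¹ ≤ h⁻¹ := inv_anti₀ hh (by linarith)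
  have hA0 : 0 < (a + h)⁻¹ := by positivity
  have hB0 : 0 < (b + h)⁻¹ := by positivity
  have e : ((a + h) ^ 2)⁻¹ - ((b + h) ^ 2)⁻¹
      = (b - a) * ((a + h)⁻¹ * (b + h)⁻¹ * ((a + h)⁻¹ + (b + h)⁻¹)) := by
    have h1 : a + h ≠ 0 := by positivity
    have h2 : b + h ≠ 0 := by positivity
    field_simp
    ring
  rw [e, abs_mul, abs_sub_comm, mul_comm, abs_of_pos (by positivity)]
  refine mul_le_mul_of_nonneg_right ?_ (abs_nonneg _)
  calc (a + h)⁻¹ * (b + h)⁻¹ * ((a + h)⁻¹ + (b + h)⁻¹) ≤ h⁻¹ * h⁻¹ * (h⁻¹ + h⁻¹) := by gcongr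
    _ = 2 * (h ^ 3)⁻¹ := by rw [← inv_pow]; ring

lemma exists_lipschitzWith_cutKernel (hh : 0 < h) : ∃ K, LipschitzWith K (cutKernel h) := by
  refine ⟨(2 * (h ^ 3)⁻¹ * 2).toNNReal, LipschitzWith.of_dist_le_mul fun z w => ?_⟩
  rw [Real.dist_eq, Real.coe_toNNReal _ (by positivity), dist_eq_norm, cutKernel, cutKernel,
    sub_sub_sub_cancel_right]
  refine (abs_inv_sq_sub_inv_sq_le hh (le_min (eNorm_nonneg z) (by norm_num))
    (le_min (eNorm_nonneg w) (by norm_num))).trans ?_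
  rw [mul_assoc (2 * (h ^ 3)⁻¹) 2]
  refine mul_le_mul_of_nonneg_left ?_ (by positivity)
  refine le_trans ?_ (abs_eNorm_sub_le z w)
  have := abs_min_sub_min_le_max (eNorm z) (1 / 2) (eNorm w) (1 / 2)
  simpa using this

lemma hasCompactSupport_cutKernel : HasCompactSupport (cutKernel h) := by
  refine HasCompactSupport.intro (isCompact_closedBall (0 : Fin 2 → ℝ) (1 / 2)) fun z hz => ?_
  rw [mem_closedBall_zero_iff, not_le] at hz
  exact cutKernel_of_le (hz.le.trans (norm_le_eNorm z))

lemma ae_lineDeriv_cutKernel (hh : 0 < h) (j : Fin 2) :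
    ∀ᵐ z, lineDeriv ℝ (cutKernel h) z (-Pi.single j 1) = cutKernelDeriv h z * z j := by
  filter_upwards [ae_eNorm_ne 0, ae_eNorm_ne (1 / 2)] with z h0 h1
  have hz : z ≠ 0 := by
    rintro rfl
    simp [eNorm] at h0
  have hn := eNorm_pos hz
  refine HasLineDerivAt.lineDeriv ?_
  unfold HasLineDerivAt
  simp only [smul_neg, ← sub_eq_add_neg]
  have hd := hasDerivAt_eNorm_add_smul_single hz j
  have hc : Filter.Tendsto (fun t : ℝ => eNorm (z - t • Pi.single j 1)) (nhds 0)
      (nhds (eNorm z)) := by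
    simpa using hd.continuousAt.tendsto
  rcases lt_or_gt_of_ne h1 with hlt | hgt
  · have hd2 := (((hd.add_const h).fun_pow 2).fun_inv (by
      simp only [zero_smul, sub_zero]; positivity)).sub_const (((1 / 2 + h) ^ 2)⁻¹)
    refine (hd2.congr_of_eventuallyEq ?_).congr_deriv ?_
    · filter_upwards [hc.eventually (gt_mem_nhds hlt)] with t ht
      rw [cutKernel, min_eq_left ht.le]
    · simp only [zero_smul, sub_zero, cutKernelDeriv, if_pos hlt]
      have : eNorm z + h ≠ 0 := by positivity
      field_simp
      norm_num
      ring
  · have hd2 := hasDerivAt_const (0 : ℝ) (0 : ℝ)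
    refine (hd2.congr_of_eventuallyEq ?_).congr_deriv ?_
    · filter_upwards [hc.eventually (lt_mem_nhds hgt)] with t ht
      exact cutKernel_of_le ht.le
    · rw [cutKernelDeriv, if_neg hgt.not_gt, zero_mul]

lemma measurable_cutKernelDeriv : Measurable (cutKernelDeriv h) := by
  have := continuous_eNorm (d := 2) |>.measurable
  exact Measurable.ite (measurableSet_lt this measurable_const) (by fun_prop) measurable_const

lemma integrable_cutKernelDeriv_mul (hh : 0 < h) {b : (Fin 2 → ℝ) → ℝ} (hb : Continuous b)
    {M : ℝ} (hM : ∀ z, |b z| ≤ M) (j : Fin 2) :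
    Integrable fun z => cutKernelDeriv h z * z j * b z := by
  have hi : Integrable ((Metric.closedBall (0 : Fin 2 → ℝ) (1 / 2)).indicator
      fun _ => 2 * (h ^ 3)⁻¹ * M) :=
    (integrableOn_const (isCompact_closedBall _ _).measure_lt_top.ne).integrable_indicator
      measurableSet_closedBall
  have hm := measurable_cutKernelDeriv (h := h)
  have hbm := hb.measurable
  refine hi.mono' (Measurable.aestronglyMeasurable (by fun_prop))
    (Filter.Eventually.of_forall fun z => ?_)
  by_cases hz : eNorm z < 1 / 2
  · rw [Set.indicator_of_mem (by
      rw [mem_closedBall_zero_iff]; exact (norm_le_eNorm z).trans hz.le), cutKernelDeriv,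
      if_pos hz, Real.norm_eq_abs, abs_mul]
    have hn := eNorm_nonneg z
    refine mul_le_mul ?_ (hM z) (abs_nonneg _) (by positivity)
    rw [mul_assoc, abs_mul, abs_of_nonneg (by positivity), abs_mul,
      abs_of_nonneg (inv_nonneg.2 hn)]
    have h1 : (eNorm z)⁻¹ * |z j| ≤ 1 := by
      rw [inv_mul_eq_div]
      exact div_le_one_of_le₀ (abs_apply_le_eNorm z j) hn
    have h2 : ((eNorm z + h) ^ 3)⁻¹ ≤ (h ^ 3)⁻¹ := by
      gcongr
      linarith
    calc _ ≤ 2 * (h ^ 3)⁻¹ * 1 := by gcongr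
      _ = _ := mul_one _
  · rw [cutKernelDeriv, if_neg hz]
    simp only [zero_mul, norm_zero]
    refine Set.indicator_nonneg (fun _ _ => ?_) z
    have := (abs_nonneg _).trans (hM 0)
    positivity

lemma hasLineDerivAt_expKernel (hh : 0 < h) (j : Fin 2) (z : Fin 2 → ℝ) :
    HasLineDerivAt ℝ (expKernel h) (-(expKernelDeriv h z * z j)) z (Pi.single j 1) := by
  have hi : ∀ i, HasDerivAt (fun t : ℝ => (z + t • (Pi.single j 1 : Fin 2 → ℝ)) i ^ 2)
      (2 * z i * (Pi.single j (1 : ℝ) : Fin 2 → ℝ) i) 0 := fun i => by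
    have := ((((hasDerivAt_id (0 : ℝ)).mul_const
      ((Pi.single j (1 : ℝ) : Fin 2 → ℝ) i)).const_add (z i)).fun_pow 2)
    exact this.congr_deriv (by simp)
  have hs := ((hi 0).fun_add (hi 1)).add_const (h ^ 2)
  have hpos : 0 < z 0 ^ 2 + z 1 ^ 2 + h ^ 2 := by positivity
  unfold HasLineDerivAt expKernel
  refine (hs.fun_neg.exp.fun_div hs (by simpa using hpos.ne')).congr_deriv ?_
  have : 2 * z 0 * (Pi.single j (1 : ℝ) : Fin 2 → ℝ) 0
      + 2 * z 1 * (Pi.single j (1 : ℝ) : Fin 2 → ℝ) 1 = 2 * z j := by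
    fin_cases j <;> simp
  simp only [this, zero_smul, add_zero, expKernelDeriv]
  field_simp
  ring

lemma continuous_expKernel (hh : 0 < h) : Continuous (expKernel h) := by
  have : ∀ z : Fin 2 → ℝ, z 0 ^ 2 + z 1 ^ 2 + h ^ 2 ≠ 0 := fun z => by positivity
  unfold expKernel
  fun_prop (disch := assumption)

lemma continuous_expKernelDeriv (hh : 0 < h) : Continuous (expKernelDeriv h) := by
  have : ∀ z : Fin 2 → ℝ, z 0 ^ 2 + z 1 ^ 2 + h ^ 2 ≠ 0 := fun z => by positivity
  have h2 : ∀ z : Fin 2 → ℝ, (z 0 ^ 2 + z 1 ^ 2 + h ^ 2) ^ 2 ≠ 0 := fun z => by positivity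
  unfold expKernelDeriv
  fun_prop (disch := assumption)

lemma integrable_expKernel_mul (hh : 0 < h) {b : (Fin 2 → ℝ) → ℝ} (hb : Continuous b)
    {M : ℝ} (hM : ∀ z, |b z| ≤ M) : Integrable fun z => expKernel h z * b z := by
  have hc := continuous_expKernel hh
  refine ((integrable_exp_neg_mul_sq_add_sq (a := 1) (by norm_num)).mul_const
    ((h ^ 2)⁻¹ * M)).mono' (Continuous.aestronglyMeasurable (by fun_prop))
    (Filter.Eventually.of_forall fun z => ?_)
  rw [Real.norm_eq_abs, abs_mul, ← mul_assoc, expKernel, abs_of_nonneg (by positivity),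
    div_eq_mul_inv]
  have hs : h ^ 2 ≤ z 0 ^ 2 + z 1 ^ 2 + h ^ 2 := by nlinarith [sq_nonneg (z 0), sq_nonneg (z 1)]
  gcongr
  · nlinarith [sq_nonneg h]
  · exact hM z

lemma integrable_expKernelDeriv_mul (hh : 0 < h) {b : (Fin 2 → ℝ) → ℝ} (hb : Continuous b)
    {M : ℝ} (hM : ∀ z, |b z| ≤ M) (j : Fin 2) :
    Integrable fun z => expKernelDeriv h z * z j * b z := by
  have hc := continuous_expKernelDeriv hh
  refine ((integrable_exp_neg_mul_sq_add_sq (a := 1 / 2) (by norm_num)).mul_const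
    (2 * ((h ^ 2)⁻¹ + ((h ^ 2) ^ 2)⁻¹) * M)).mono'
    (Continuous.aestronglyMeasurable (by fun_prop)) (Filter.Eventually.of_forall fun z => ?_)
  have hs : h ^ 2 ≤ z 0 ^ 2 + z 1 ^ 2 + h ^ 2 := by nlinarith [sq_nonneg (z 0), sq_nonneg (z 1)]
  have hj : |z j| ≤ Real.exp (1 / 2 * (z 0 ^ 2 + z 1 ^ 2)) := by
    have h1 := Real.add_one_le_exp (1 / 2 * (z 0 ^ 2 + z 1 ^ 2))
    have h2 : z j ^ 2 ≤ z 0 ^ 2 + z 1 ^ 2 := by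
      fin_cases j <;> simp [sq_nonneg]
    nlinarith [sq_abs (z j), sq_nonneg (|z j| - 1)]
  rw [Real.norm_eq_abs, abs_mul, abs_mul, ← mul_assoc, expKernelDeriv,
    abs_of_nonneg (by positivity)]
  refine mul_le_mul ?_ (hM z) (abs_nonneg _) (by positivity)
  have he : Real.exp (-(z 0 ^ 2 + z 1 ^ 2 + h ^ 2)) ≤ Real.exp (-(z 0 ^ 2 + z 1 ^ 2)) :=
    Real.exp_le_exp.2 (by nlinarith [sq_nonneg h])
  have hw : (z 0 ^ 2 + z 1 ^ 2 + h ^ 2)⁻¹ + ((z 0 ^ 2 + z 1 ^ 2 + h ^ 2) ^ 2)⁻¹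
      ≤ (h ^ 2)⁻¹ + ((h ^ 2) ^ 2)⁻¹ := by gcongr
  calc _ ≤ 2 * (Real.exp (-(z 0 ^ 2 + z 1 ^ 2)) * ((h ^ 2)⁻¹ + ((h ^ 2) ^ 2)⁻¹))
        * Real.exp (1 / 2 * (z 0 ^ 2 + z 1 ^ 2)) :=
        mul_le_mul (mul_le_mul_of_nonneg_left (mul_le_mul he hw (by positivity) (by positivity))
          zero_le_two) hj (abs_nonneg _) (by positivity)
    _ = (Real.exp (-(z 0 ^ 2 + z 1 ^ 2)) * Real.exp (1 / 2 * (z 0 ^ 2 + z 1 ^ 2)))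
        * (2 * ((h ^ 2)⁻¹ + ((h ^ 2) ^ 2)⁻¹)) := by ring
    _ = _ := by
        rw [← Real.exp_add]
        congr 2
        ring

end CutKernel

namespace DivFree

variable {u : Fin 2 → (Fin 2 → ℝ) → ℝ} {f : (Fin 2 → ℝ) → ℝ} {h : ℝ}

lemma integral_cutKernel_mul_corr (hu : DivFree u) (hf : SmoothPeriodic f) (hh : 0 < h) :
    ∫ z, cutKernel h z * corr (adv u f) f z
      = ∫ z, cutKernelDeriv h z * (z 0 * flux u f 0 z + z 1 * flux u f 1 z) := by
  obtain ⟨K, hK⟩ := exists_lipschitzWith_cutKernel hh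
  have hd : ∀ j, Integrable fun z => cutKernel h z * fluxDeriv u f j z := fun j => by
    have c1 := hK.continuous
    have c2 := hu.continuous_fluxDeriv hf j
    exact Continuous.integrable_of_hasCompactSupport (by fun_prop)
      hasCompactSupport_cutKernel.mul_right
  have hi : ∀ j, Integrable fun z => cutKernelDeriv h z * z j * flux u f j z := fun j => by
    obtain ⟨M, _, hM⟩ := hu.exists_bound_flux hf j
    exact integrable_cutKernelDeriv_mul hh (hu.continuous_flux hf j) hM j
  have e : ∀ j, ∫ z, cutKernel h z * fluxDeriv u f j z
      = ∫ z, cutKernelDeriv h z * z j * flux u f j z := fun j => by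
    obtain ⟨L, hL⟩ := hu.exists_lipschitzWith_flux hf j
    have := hL.integral_lineDeriv_mul_eq (μ := volume) hK hasCompactSupport_cutKernel
      (Pi.single j 1)
    simp only [fun z => (hu.hasLineDerivAt_flux hf j z).lineDeriv] at this
    simp only [mul_comm (cutKernel h _)]
    rw [this]
    refine integral_congr_ae ?_
    filter_upwards [ae_lineDeriv_cutKernel hh j] with z hz
    rw [hz]
  simp only [hu.corr_adv_eq hf, mul_add]
  rw [integral_add (hd 0) (hd 1), e, e, ← integral_add (hi 0) (hi 1)]
  simp only [mul_assoc]

lemma integral_expKernel_mul_corr (hu : DivFree u) (hf : SmoothPeriodic f) (hh : 0 < h) :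
    ∫ z, expKernel h z * corr (adv u f) f z
      = ∫ z, expKernelDeriv h z * (z 0 * flux u f 0 z + z 1 * flux u f 1 z) := by
  have hd : ∀ j, Integrable fun z => expKernel h z * fluxDeriv u f j z := fun j => by
    obtain ⟨M, _, hM⟩ := hu.exists_bound_fluxDeriv hf j
    exact integrable_expKernel_mul hh (hu.continuous_fluxDeriv hf j) hM
  have hi : ∀ j, Integrable fun z => expKernelDeriv h z * z j * flux u f j z := fun j => by
    obtain ⟨M, _, hM⟩ := hu.exists_bound_flux hf j
    exact integrable_expKernelDeriv_mul hh (hu.continuous_flux hf j) hM j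
  have h0 : ∀ j, Integrable fun z => expKernel h z * flux u f j z := fun j => by
    obtain ⟨M, _, hM⟩ := hu.exists_bound_flux hf j
    exact integrable_expKernel_mul hh (hu.continuous_flux hf j) hM
  have e : ∀ j, ∫ z, expKernel h z * fluxDeriv u f j z
      = ∫ z, expKernelDeriv h z * z j * flux u f j z := fun j => by
    have := integral_bilinear_hasLineDerivAt_right_eq_neg_left_of_integrable (μ := volume)
      (f := expKernel h) (f' := fun z => -(expKernelDeriv h z * z j)) (g := flux u f j)
      (g' := fluxDeriv u f j) (v := Pi.single j 1) (B := ContinuousLinearMap.mul ℝ ℝ)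
      (by simpa using (hi j).neg) (hd j) (h0 j) (fun z _ => hasLineDerivAt_expKernel hh j z)
      (fun z _ => hu.hasLineDerivAt_flux hf j z)
    simpa [integral_neg] using this
  simp only [hu.corr_adv_eq hf, mul_add]
  rw [integral_add (hd 0) (hd 1), e, e, ← integral_add (hi 0) (hi 1)]
  simp only [mul_assoc]

end DivFree

lemma abs_kernelDeriv_sub_mul_le {h : ℝ} (hh : 0 < h) (z : Fin 2 → ℝ) :
    |cutKernelDeriv h z - expKernelDeriv h z| * (z 0 ^ 2 + z 1 ^ 2)
      ≤ 24 * (h / (‖z‖ + h) ^ 3) + 10 * Real.exp (-1 * (z 0 ^ 2 + z 1 ^ 2)) := by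
  have hr := eNorm_nonneg z
  have hnr := norm_le_eNorm z
  have hn : h / (eNorm z + h) ^ 3 ≤ h / (‖z‖ + h) ^ 3 := by
    have := norm_nonneg z
    gcongr
  rw [← eNorm_sq, expKernelDeriv, ← eNorm_sq, cutKernelDeriv, neg_one_mul]
  generalize eNorm z = r at *
  have hs : 0 < r ^ 2 + h ^ 2 := by positivity
  set s := r ^ 2 + h ^ 2 with hs_def
  have he1 : Real.exp (-s) ≤ 1 := Real.exp_le_one_iff.2 (by linarith)
  have he2 : 1 - s ≤ Real.exp (-s) := by linarith [Real.add_one_le_exp (-s)]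
  have he3 : Real.exp (-s) ≤ Real.exp (-r ^ 2) := Real.exp_le_exp.2 (by nlinarith [sq_nonneg h])
  have he4 : 1 - r ^ 2 ≤ Real.exp (-r ^ 2) := by linarith [Real.add_one_le_exp (-r ^ 2)]
  have he0 := Real.exp_pos (-s)
  have hrs : r ^ 2 * s⁻¹ ≤ 1 := by
    rw [← div_eq_mul_inv]
    exact div_le_one_of_le₀ (by nlinarith [sq_nonneg h]) hs.le
  have hrs0 : 0 ≤ r ^ 2 * s⁻¹ := by positivity
  generalize Real.exp (-s) = e at *
  generalize Real.exp (-r ^ 2) = e' at *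
  split_ifs with hlt
  · rcases hr.eq_or_lt with h0 | h0
    · rw [← h0]
      have : 0 ≤ h / (‖z‖ + h) ^ 3 := by positivity
      nlinarith
    have hN : |h ^ 3 - r * h ^ 2 - r ^ 2 * h - 3 * r ^ 3| * r ≤ 12 * s ^ 2 := by
      have : |h ^ 3 - r * h ^ 2 - r ^ 2 * h - 3 * r ^ 3|
          ≤ h ^ 3 + r * h ^ 2 + r ^ 2 * h + 3 * r ^ 3 := by
        have h1 : 0 ≤ r * h ^ 2 := by positivity
        have h2 : 0 ≤ r ^ 2 * h := by positivity
        have h3 : 0 ≤ r ^ 3 := by positivity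
        have h4 : 0 ≤ h ^ 3 := by positivity
        rw [abs_le]
        constructor <;> linarith
      refine (mul_le_mul_of_nonneg_right this hr).trans ?_
      rw [hs_def]
      have hp : 0 ≤ r * h := by positivity
      nlinarith [sq_nonneg (r - h), mul_nonneg hp (sq_nonneg (r - h)), sq_nonneg (r ^ 2 - h ^ 2),
        mul_nonneg hp hp, pow_nonneg hr 4, pow_nonneg hh.le 4,
        mul_nonneg (sq_nonneg (r - h)) (sq_nonneg r), mul_nonneg (sq_nonneg (r - h)) (sq_nonneg h)]
    have hT1 : |r * ((r + h) ^ 3)⁻¹ - r ^ 2 * (s ^ 2)⁻¹| ≤ 12 * (h / (r + h) ^ 3) := by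
      have e1 : r * ((r + h) ^ 3)⁻¹ - r ^ 2 * (s ^ 2)⁻¹
          = (h ^ 3 - r * h ^ 2 - r ^ 2 * h - 3 * r ^ 3) * r * (h * ((r + h) ^ 3)⁻¹ * (s ^ 2)⁻¹) := by
        have : r + h ≠ 0 := by positivity
        field_simp
        rw [hs_def]
        ring
      rw [e1, abs_mul, abs_mul, abs_of_pos h0, abs_of_pos (a := h * _ * _) (by positivity)]
      calc _ ≤ 12 * s ^ 2 * (h * ((r + h) ^ 3)⁻¹ * (s ^ 2)⁻¹) := by gcongr
        _ = _ := by field_simp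
    have hT2 : |r ^ 2 * (s ^ 2)⁻¹ * (1 - e) - r ^ 2 * s⁻¹ * e| ≤ 1 := by
      have h1 : r ^ 2 * (s ^ 2)⁻¹ * (1 - e) ≤ r ^ 2 * s⁻¹ := by
        calc _ ≤ r ^ 2 * (s ^ 2)⁻¹ * s := by gcongr; linarith
          _ = _ := by field_simp
      have h2 : 0 ≤ r ^ 2 * (s ^ 2)⁻¹ * (1 - e) := mul_nonneg (by positivity) (by linarith)
      have h3 : 0 ≤ r ^ 2 * s⁻¹ * e := by positivity
      have h4 : r ^ 2 * s⁻¹ * e ≤ 1 * 1 := by gcongr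
      rw [abs_le]
      constructor <;> linarith
    have e2 : (2 * ((r + h) ^ 3)⁻¹ * r⁻¹ - 2 * (e * (s⁻¹ + (s ^ 2)⁻¹))) * r ^ 2
        = 2 * ((r * ((r + h) ^ 3)⁻¹ - r ^ 2 * (s ^ 2)⁻¹)
          + (r ^ 2 * (s ^ 2)⁻¹ * (1 - e) - r ^ 2 * s⁻¹ * e)) := by
      field_simp
      ring
    rw [← abs_of_nonneg (sq_nonneg r), ← abs_mul, e2, abs_mul, abs_two]
    have := abs_add_le (r * ((r + h) ^ 3)⁻¹ - r ^ 2 * (s ^ 2)⁻¹)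
      (r ^ 2 * (s ^ 2)⁻¹ * (1 - e) - r ^ 2 * s⁻¹ * e)
    nlinarith
  · have h4 : s⁻¹ ≤ 4 := by
      rw [inv_le_comm₀ hs (by norm_num)]
      nlinarith
    have : 0 ≤ h / (‖z‖ + h) ^ 3 := by positivity
    rw [zero_sub, abs_neg, abs_of_nonneg (by positivity)]
    have e3 : 2 * (e * (s⁻¹ + (s ^ 2)⁻¹)) * r ^ 2 = 2 * e * (r ^ 2 * s⁻¹ * (1 + s⁻¹)) := by
      rw [← inv_pow]; ring
    have : r ^ 2 * s⁻¹ * (1 + s⁻¹) ≤ 1 * 5 := by gcongr; linarith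
    rw [e3]
    nlinarith

lemma integrable_inv_one_add_norm_pow_three :
    Integrable fun z : Fin 2 → ℝ => ((1 + ‖z‖) ^ 3)⁻¹ := by
  have h := integrable_one_add_norm (E := Fin 2 → ℝ) (μ := volume) (r := 3) (by simp; norm_num)
  refine h.congr (Filter.Eventually.of_forall fun z => ?_)
  simp only
  rw [Real.rpow_neg (by positivity)]
  norm_cast

lemma div_norm_add_pow_three_eq {h : ℝ} (hh : 0 < h) (z : Fin 2 → ℝ) :
    h / (‖z‖ + h) ^ 3 = (h ^ 2)⁻¹ * ((1 + ‖h⁻¹ • z‖) ^ 3)⁻¹ := by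
  rw [norm_smul, Real.norm_of_nonneg (by positivity)]
  have : ‖z‖ + h ≠ 0 := by positivity
  have h2 : 1 + h⁻¹ * ‖z‖ = (‖z‖ + h) / h := by field_simp; ring
  rw [h2]
  field_simp

lemma integrable_div_norm_add_pow_three {h : ℝ} (hh : 0 < h) :
    Integrable fun z : Fin 2 → ℝ => h / (‖z‖ + h) ^ 3 := by
  simp only [div_norm_add_pow_three_eq hh]
  exact (integrable_inv_one_add_norm_pow_three.comp_smul (inv_ne_zero hh.ne')).const_mul _

lemma integral_div_norm_add_pow_three {h : ℝ} (hh : 0 < h) :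
    ∫ z : Fin 2 → ℝ, h / (‖z‖ + h) ^ 3 = ∫ z : Fin 2 → ℝ, ((1 + ‖z‖) ^ 3)⁻¹ := by
  simp only [div_norm_add_pow_three_eq hh]
  rw [integral_const_mul, Measure.integral_comp_smul_of_nonneg volume
    (fun z : Fin 2 → ℝ => ((1 + ‖z‖) ^ 3)⁻¹) h⁻¹ (hR := by positivity), Module.finrank_fin_fun,
    smul_eq_mul]
  field_simp

/-- A bound, uniform in `h`, for the mass of the difference of the radial derivatives. -/
def kernelConst : ℝ :=
  24 * (∫ z : Fin 2 → ℝ, ((1 + ‖z‖) ^ 3)⁻¹)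
    + 10 * ∫ z : Fin 2 → ℝ, Real.exp (-1 * (z 0 ^ 2 + z 1 ^ 2))

lemma kernelConst_nonneg : 0 ≤ kernelConst := by
  have h1 : 0 ≤ ∫ z : Fin 2 → ℝ, ((1 + ‖z‖) ^ 3)⁻¹ := integral_nonneg fun z => by positivity
  have h2 : 0 ≤ ∫ z : Fin 2 → ℝ, Real.exp (-1 * (z 0 ^ 2 + z 1 ^ 2)) :=
    integral_nonneg fun z => by positivity
  unfold kernelConst
  positivity

namespace DivFree

variable {u : Fin 2 → (Fin 2 → ℝ) → ℝ} {f : (Fin 2 → ℝ) → ℝ} {h ε : ℝ}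

lemma abs_integral_cutKernel_sub_le (hu : DivFree u) (hf : SmoothPeriodic f) (hh : 0 < h)
    (hε : 0 < ε) :
    |(∫ z, cutKernel h z * corr (adv u f) f z) - ∫ z, expKernel h z * corr (adv u f) f z|
      ≤ kernelConst * (ε / 2 * (∫ x in box 2, fieldGradSq u x)
        + 1 / (2 * ε) * ∫ x in box 2, f x ^ 4) := by
  have hc : Integrable fun z => cutKernelDeriv h z * (z 0 * flux u f 0 z + z 1 * flux u f 1 z) := by
    obtain ⟨M0, _, hM0⟩ := hu.exists_bound_flux hf 0
    obtain ⟨M1, _, hM1⟩ := hu.exists_bound_flux hf 1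
    have := (integrable_cutKernelDeriv_mul hh (hu.continuous_flux hf 0) hM0 0).add
      (integrable_cutKernelDeriv_mul hh (hu.continuous_flux hf 1) hM1 1)
    refine this.congr (Filter.Eventually.of_forall fun z => ?_)
    simp only [Pi.add_apply]
    ring
  have he : Integrable fun z => expKernelDeriv h z * (z 0 * flux u f 0 z + z 1 * flux u f 1 z) := by
    obtain ⟨M0, _, hM0⟩ := hu.exists_bound_flux hf 0
    obtain ⟨M1, _, hM1⟩ := hu.exists_bound_flux hf 1
    have := (integrable_expKernelDeriv_mul hh (hu.continuous_flux hf 0) hM0 0).add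
      (integrable_expKernelDeriv_mul hh (hu.continuous_flux hf 1) hM1 1)
    refine this.congr (Filter.Eventually.of_forall fun z => ?_)
    simp only [Pi.add_apply]
    ring
  rw [hu.integral_cutKernel_mul_corr hf hh, hu.integral_expKernel_mul_corr hf hh,
    ← integral_sub hc he]
  set Q := ε / 2 * (∫ x in box 2, fieldGradSq u x) + 1 / (2 * ε) * ∫ x in box 2, f x ^ 4 with hQ
  have hQ0 : 0 ≤ Q := by
    have h1 : 0 ≤ ∫ x in box 2, fieldGradSq u x := integral_nonneg fun x => by
      unfold fieldGradSq gradSq; positivity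
    have h2 : 0 ≤ ∫ x in box 2, f x ^ 4 := integral_nonneg fun x => by positivity
    positivity
  have i1 := (integrable_div_norm_add_pow_three hh).const_mul 24
  have i2 := (integrable_exp_neg_mul_sq_add_sq (a := 1) one_pos).const_mul 10
  have hb : ∀ z, ‖cutKernelDeriv h z * (z 0 * flux u f 0 z + z 1 * flux u f 1 z)
      - expKernelDeriv h z * (z 0 * flux u f 0 z + z 1 * flux u f 1 z)‖
      ≤ (24 * (h / (‖z‖ + h) ^ 3) + 10 * Real.exp (-1 * (z 0 ^ 2 + z 1 ^ 2))) * Q := fun z => by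
    rw [← sub_mul, norm_mul, Real.norm_eq_abs, Real.norm_eq_abs]
    refine (mul_le_mul_of_nonneg_left (hu.abs_flux_le hf z hε) (abs_nonneg _)).trans ?_
    rw [← mul_assoc]
    exact mul_le_mul_of_nonneg_right (abs_kernelDeriv_sub_mul_le hh z) hQ0
  have hm := norm_integral_le_of_norm_le ((i1.add i2).mul_const Q) (Filter.Eventually.of_forall hb)
  refine hm.trans_eq ?_
  rw [integral_mul_const]
  simp only [Pi.add_apply]
  rw [integral_add i1 i2, integral_const_mul, integral_const_mul,
    integral_div_norm_add_pow_three hh, kernelConst]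

/-- The rate of change of the truncated logarithmic energy. -/
lemma abs_integral_cutKernel_mul_corr_le (hu : DivFree u) (hf : SmoothPeriodic f) (hh : 0 < h)
    (hε : 0 < ε) :
    |∫ z, cutKernel h z * corr (adv u f) f z|
      ≤ 4 * Real.pi * (ε * (∫ x in box 2, fieldGradSq u x)
          * Real.log ((1 / 4 + h ^ 2 / 4) / (h ^ 2 / 4))
        + 5 / 3 * (∫ x in box 2, f x ^ 4) / ε)
        + kernelConst * (ε / 2 * (∫ x in box 2, fieldGradSq u x)
        + 1 / (2 * ε) * ∫ x in box 2, f x ^ 4) := by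
  have h1 := hu.abs_integral_expKernel_mul_corr_le hf hh hε
  have h2 := hu.abs_integral_cutKernel_sub_le hf hh hε
  have h3 := abs_add_le (∫ z, expKernel h z * corr (adv u f) f z)
    ((∫ z, cutKernel h z * corr (adv u f) f z) - ∫ z, expKernel h z * corr (adv u f) f z)
  rw [add_sub_cancel] at h3
  linarith

end DivFree

section TorusKernel

variable {d : ℕ} {h : ℝ}

lemma abs_sub_round_of_abs_le {t : ℝ} (ht : |t| ≤ 1 / 2) : |t - round t| = |t| := by
  refine le_antisymm (by simpa using round_le t 0) ?_
  rcases eq_or_ne (round t) 0 with h0 | h0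
  · simp [h0]
  · have h1 : (1 : ℝ) ≤ |(round t : ℝ)| := by exact_mod_cast Int.one_le_abs h0
    have h2 := abs_sub_abs_le_abs_sub (round t : ℝ) t
    rw [abs_sub_comm] at h2
    linarith

lemma eNorm_congr_abs {z w : Fin d → ℝ} (h : ∀ i, |z i| = |w i|) : eNorm z = eNorm w := by
  simp only [eNorm, fun i => sq_eq_sq_iff_abs_eq_abs (z i) (w i) |>.2 (h i)]

lemma torusDist_zero_eq (z : Fin d → ℝ) :
    torusDist z 0 = eNorm fun i => z i - round (z i) := by
  unfold torusDist
  refine le_antisymm ?_ (le_ciInf fun k => Real.sqrt_le_sqrt (Finset.sum_le_sum fun i _ => ?_))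
  · refine (ciInf_le ⟨0, ?_⟩ fun i => -round (z i)).trans_eq ?_
    · rintro _ ⟨k, rfl⟩
      exact eNorm_nonneg _
    · congr 1
      ext i
      simp [sub_eq_add_neg]
  · rw [sq_le_sq]
    simpa using round_le (z i) (-k i)

lemma KhB_eq (z : Fin 2 → ℝ) :
    KhB 2 h z = cutKernel h (fun i => z i - round (z i)) + ((1 / 2 + h) ^ 2)⁻¹ := by
  have e : ∀ x : ℝ, x ^ (-((2 : ℕ) : ℝ)) = (x ^ 2)⁻¹ := fun x => by
    rw [Real.rpow_neg_natCast]
    rfl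
  rw [KhB, torusDist_zero_eq, cutKernel, e, e]
  split_ifs with hlt
  · rw [min_eq_left hlt.le]
    ring
  · rw [min_eq_right (not_lt.1 hlt)]
    ring

lemma cutKernel_congr {z w : Fin 2 → ℝ} (hzw : eNorm z = eNorm w) :
    cutKernel h z = cutKernel h w := by
  rw [cutKernel, cutKernel, hzw]

lemma KhB_of_abs_le {z : Fin 2 → ℝ} (hz : ∀ i, |z i| ≤ 1 / 2) :
    KhB 2 h z = cutKernel h z + ((1 / 2 + h) ^ 2)⁻¹ := by
  rw [KhB_eq, cutKernel_congr (eNorm_congr_abs fun i => abs_sub_round_of_abs_le (hz i))]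

lemma KhB_periodic : IsPeriodic (KhB 2 h) := fun x k => by
  simp only [KhB_eq, Pi.add_apply, round_add_intCast, Int.cast_add, add_sub_add_right_eq_sub]

lemma measurable_KhB (hh : 0 < h) : Measurable (KhB 2 h) := by
  have hr : ∀ i, Measurable fun z : Fin 2 → ℝ => (round (z i) : ℝ) := fun i => by
    simp only [round_eq]
    exact measurable_from_top.comp ((Int.measurable_floor).comp (by fun_prop))
  have hm : Measurable fun z : Fin 2 → ℝ => fun i => z i - round (z i) :=
    measurable_pi_lambda _ fun i => (measurable_pi_apply i).sub (hr i)
  have hc := (exists_lipschitzWith_cutKernel hh).choose_spec.continuous.measurable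
  rw [funext (KhB_eq (h := h))]
  exact (hc.comp hm).add_const _

lemma cutKernel_nonneg (hh : 0 < h) (z : Fin 2 → ℝ) : 0 ≤ cutKernel h z := by
  have h1 := le_min (eNorm_nonneg z) (by norm_num : (0 : ℝ) ≤ 1 / 2)
  have h2 := min_le_right (eNorm z) (1 / 2)
  rw [cutKernel, sub_nonneg]
  gcongr

lemma cutKernel_add_le (hh : 0 < h) (z : Fin 2 → ℝ) :
    cutKernel h z + ((1 / 2 + h) ^ 2)⁻¹ ≤ (h ^ 2)⁻¹ := by
  have h1 := le_min (eNorm_nonneg z) (by norm_num : (0 : ℝ) ≤ 1 / 2)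
  rw [cutKernel, sub_add_cancel]
  gcongr
  linarith

lemma KhB_nonneg (hh : 0 < h) (z : Fin 2 → ℝ) : 0 ≤ KhB 2 h z := by
  rw [KhB_eq]
  have := cutKernel_nonneg hh fun i => z i - round (z i)
  positivity

lemma KhB_le (hh : 0 < h) (z : Fin 2 → ℝ) : KhB 2 h z ≤ (h ^ 2)⁻¹ := by
  rw [KhB_eq]
  exact cutKernel_add_le hh _

end TorusKernel

instance isFiniteMeasure_restrict_box {d : ℕ} :
    IsFiniteMeasure ((volume : Measure (Fin d → ℝ)).restrict (box d)) :=
  ⟨by simp [volume_box]⟩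

section Energy

variable {f : (Fin 2 → ℝ) → ℝ} {h : ℝ}

/-- The truncated logarithmic energy, written in terms of the autocorrelation. -/
def cutEnergy (h : ℝ) (f : (Fin 2 → ℝ) → ℝ) : ℝ :=
  2 * (((1 / 2 + h) ^ 2)⁻¹ + ∫ z, cutKernel h z) * (∫ x in box 2, f x ^ 2)
    - 2 * ∫ z, cutKernel h z * crossCorr f f z

lemma crossCorr_periodic {p q : (Fin 2 → ℝ) → ℝ} (hq : IsPeriodic q) :
    IsPeriodic (crossCorr p q) := fun z k => by
  unfold crossCorr
  simp only [← add_assoc, hq _ k]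

lemma integral_crossCorr_eq_zero {p : (Fin 2 → ℝ) → ℝ} (hp : Continuous p) (hf : Continuous f)
    (hfp : IsPeriodic f) (h0 : ∫ x in box 2, f x = 0) :
    ∫ z in box 2, crossCorr p f z = 0 := by
  have hInt : Integrable (Function.uncurry fun (z x : Fin 2 → ℝ) => p x * f (x + z))
      ((volume.restrict (box 2)).prod (volume.restrict (box 2))) := by
    rw [Measure.prod_restrict]
    exact integrableOn_of_subset_compact (isCompact_Icc.prod isCompact_Icc)
      (Set.prod_mono box_subset_Icc box_subset_Icc) (by unfold Function.uncurry; fun_prop)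
  unfold crossCorr
  rw [integral_integral_swap hInt]
  have e : ∀ x, ∫ z in box 2, p x * f (x + z) = 0 := fun x => by
    rw [integral_const_mul]
    simp only [add_comm x]
    rw [hfp.setIntegral_box_comp_add, h0, mul_zero]
  simp [e]

lemma integral_sub_comp_add_sq (hf : Continuous f) (hfp : IsPeriodic f) (z : Fin 2 → ℝ) :
    ∫ x in box 2, (f x - f (x + z)) ^ 2
      = 2 * (∫ x in box 2, f x ^ 2) - 2 * crossCorr f f z := by
  have t := IsPeriodic.setIntegral_box_comp_add (f := fun x => f x ^ 2)
    (fun x k => by simp only [hfp x k]) z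
  have e : ∀ x, (f x - f (x + z)) ^ 2 = f x ^ 2 + f (x + z) ^ 2 - 2 * (f x * f (x + z)) :=
    fun x => by ring
  simp only [e]
  rw [integral_sub (integrableOn_box (by fun_prop)) (integrableOn_box (by fun_prop)),
    integral_add (integrableOn_box (by fun_prop)) (integrableOn_box (by fun_prop)),
    integral_const_mul, t, crossCorr]
  ring

lemma setIntegral_box_KhB_mul (hh : 0 < h) (hf : Continuous f) (hfp : IsPeriodic f)
    (h0 : ∫ x in box 2, f x = 0) :
    ∫ z in box 2, KhB 2 h (-z) * (2 * (∫ x in box 2, f x ^ 2) - 2 * crossCorr f f z)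
      = cutEnergy h f := by
  set X := ∫ x in box 2, f x ^ 2 with hX
  set c := ((1 / 2 + h) ^ 2)⁻¹ with hc
  have cc : Continuous (crossCorr f f) := continuous_crossCorr hf hf
  have ck := (exists_lipschitzWith_cutKernel hh).choose_spec.continuous
  have hcp : IsPeriodic (crossCorr f f) := crossCorr_periodic hfp
  let a : Fin 2 → ℝ := fun _ => -(1 / 2)
  have hcell : ∀ z ∈ box 2, ∀ i, |(z + a) i| ≤ 1 / 2 := fun z hz i => by
    have h1 := hz i trivial
    simp only [Pi.add_apply, a, abs_le]
    constructor <;> linarith [h1.1, h1.2]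
  have hper : IsPeriodic fun z => KhB 2 h (-z) * (2 * X - 2 * crossCorr f f z) := fun z k => by
    have h1 := KhB_periodic (h := h) (-z) (-k)
    have h2 : -(z + fun i => (k i : ℝ)) = -z + fun i => ((-k) i : ℝ) := by
      ext i
      simp
      ring
    simp only [hcp z k]
    rw [h2, h1]
  have e1 : ∀ z ∈ box 2, KhB 2 h (-(z + a)) * (2 * X - 2 * crossCorr f f (z + a))
      = cutKernel h (z + a) * (2 * X - 2 * crossCorr f f (z + a))
        + (2 * c * X - 2 * c * crossCorr f f (z + a)) := fun z hz => by
    have hk : cutKernel h (-(z + a)) = cutKernel h (z + a) :=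
      cutKernel_congr (eNorm_congr_abs fun i => by rw [Pi.neg_apply, abs_neg])
    rw [KhB_of_abs_le (fun i => by rw [Pi.neg_apply, abs_neg]; exact hcell z hz i), hk, ← hc]
    ring
  have e2 : ∫ z in box 2, cutKernel h (z + a) * (2 * X - 2 * crossCorr f f (z + a))
      = ∫ z, cutKernel h z * (2 * X - 2 * crossCorr f f z) := by
    rw [← integral_add_right_eq_self (fun z => cutKernel h z * (2 * X - 2 * crossCorr f f z)) a]
    refine setIntegral_eq_integral_of_forall_compl_eq_zero fun z hz => ?_
    rw [cutKernel_of_le, zero_mul]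
    by_contra! hlt
    refine hz fun i _ => ?_
    have := abs_lt.1 ((abs_apply_le_eNorm (z + a) i).trans_lt hlt)
    simp only [Pi.add_apply, a] at this
    exact ⟨by linarith [this.1], by linarith [this.2]⟩
  have e3 : ∫ z in box 2, (2 * c * X - 2 * c * crossCorr f f (z + a)) = 2 * c * X := by
    rw [integral_sub (integrableOn_box (by fun_prop)) (integrableOn_box (by fun_prop)),
      integral_const_mul (2 * c) (fun z => crossCorr f f (z + a)), hcp.setIntegral_box_comp_add,
      integral_crossCorr_eq_zero hf hf hfp h0]
    simp [measureReal_def, volume_box]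
  have i1 : Integrable (cutKernel h) :=
    ck.integrable_of_hasCompactSupport hasCompactSupport_cutKernel
  have i2 : Integrable fun z => cutKernel h z * crossCorr f f z :=
    Continuous.integrable_of_hasCompactSupport (by fun_prop)
      hasCompactSupport_cutKernel.mul_right
  have e4 : ∫ z, cutKernel h z * (2 * X - 2 * crossCorr f f z)
      = 2 * X * (∫ z, cutKernel h z) - 2 * ∫ z, cutKernel h z * crossCorr f f z := by
    have e5 := integral_sub (i1.const_mul (2 * X)) (i2.const_mul 2)
    rw [integral_const_mul, integral_const_mul] at e5
    rw [← e5]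
    congr 1
    ext z
    ring
  rw [← hper.setIntegral_box_comp_add a, setIntegral_congr_fun measurableSet_box e1,
    integral_add (integrableOn_box (by fun_prop)) (integrableOn_box (by fun_prop)), e2, e3, e4,
    cutEnergy, ← hX, ← hc]
  ring

lemma lintegral_KhB_eq (hh : 0 < h) (hf : Continuous f) (hfp : IsPeriodic f)
    (h0 : ∫ x in box 2, f x = 0) :
    ∫⁻ x in box 2, ∫⁻ y in box 2, ENNReal.ofReal (KhB 2 h (x - y) * |f x - f y| ^ 2)
      = ENNReal.ofReal (cutEnergy h f) := by
  obtain ⟨M, hM0, hM⟩ := hfp.exists_bound hf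
  have hK := measurable_KhB hh
  have hfm := hf.measurable
  have hD : ∀ x y, |f x - f y| ^ 2 ≤ (M + M) ^ 2 := fun x y => by
    gcongr
    exact (abs_sub _ _).trans (add_le_add (hM x) (hM y))
  have hb : ∀ w x y, ‖KhB 2 h w * |f x - f y| ^ 2‖ ≤ (h ^ 2)⁻¹ * (M + M) ^ 2 := fun w x y => by
    have h1 := KhB_nonneg hh w
    rw [Real.norm_of_nonneg (by positivity)]
    exact mul_le_mul (KhB_le hh w) (hD x y) (by positivity) (by positivity)
  have hInt : Integrable (fun q : (Fin 2 → ℝ) × (Fin 2 → ℝ) =>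
      KhB 2 h (q.1 - q.2) * |f q.1 - f q.2| ^ 2)
      ((volume.restrict (box 2)).prod (volume.restrict (box 2))) :=
    Integrable.of_bound (Measurable.aestronglyMeasurable (by fun_prop)) _
      (Filter.Eventually.of_forall fun q => hb _ _ _)
  have hint2 : Integrable (Function.uncurry fun (x z : Fin 2 → ℝ) =>
      KhB 2 h (-z) * |f x - f (x + z)| ^ 2)
      ((volume.restrict (box 2)).prod (volume.restrict (box 2))) :=
    Integrable.of_bound (Measurable.aestronglyMeasurable (by unfold Function.uncurry; fun_prop)) _
      (Filter.Eventually.of_forall fun q => hb _ _ _)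
  have e1 : ∀ x, ∫ y in box 2, KhB 2 h (x - y) * |f x - f y| ^ 2
      = ∫ z in box 2, KhB 2 h (-z) * |f x - f (x + z)| ^ 2 := fun x => by
    have hper : IsPeriodic fun y => KhB 2 h (x - y) * |f x - f y| ^ 2 := fun y k => by
      have h1 := KhB_periodic (h := h) (x - y) (-k)
      have h2 : x - (y + fun i => (k i : ℝ)) = x - y + fun i => ((-k) i : ℝ) := by
        ext i
        simp
        ring
      simp only [hfp y k]
      rw [h2, h1]
    rw [← hper.setIntegral_box_comp_add x]
    congr 1
    ext z
    rw [add_comm z x, sub_add_cancel_left]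
  rw [← lintegral_prod (fun q : (Fin 2 → ℝ) × (Fin 2 → ℝ) =>
      ENNReal.ofReal (KhB 2 h (q.1 - q.2) * |f q.1 - f q.2| ^ 2))
      (Measurable.aemeasurable (by fun_prop)),
    ← ofReal_integral_eq_lintegral_ofReal hInt (Filter.Eventually.of_forall fun q =>
      mul_nonneg (KhB_nonneg hh _) (sq_nonneg _)), integral_prod _ hInt]
  simp only [e1]
  rw [integral_integral_swap hint2]
  simp only [sq_abs, integral_const_mul, integral_sub_comp_add_sq hf hfp]
  rw [setIntegral_box_KhB_mul hh hf hfp h0]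

end Energy

/-- The components of the velocity field at time `t`. -/
def velocity (u : ℝ → (Fin 2 → ℝ) → (Fin 2 → ℝ)) (t : ℝ) (j : Fin 2) (x : Fin 2 → ℝ) : ℝ :=
  u t x j

namespace IsEulerSolution

variable {u : ℝ → (Fin 2 → ℝ) → (Fin 2 → ℝ)} {ω : ℝ → (Fin 2 → ℝ) → ℝ}

lemma divFree (H : IsEulerSolution u ω) (t : ℝ) : DivFree (velocity u t) where
  smoothPeriodic j := by
    have h1 := H.1.comp (contDiff_const.prodMk contDiff_id :
      ContDiff ℝ (⊤ : ℕ∞) fun x : Fin 2 → ℝ => (t, x))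
    exact ⟨contDiff_pi.1 h1 j, fun x k => congrFun (H.2.2.1 t x k) j⟩
  div_eq_zero x := by
    have := H.2.2.2.2.1 t x
    rwa [Fin.sum_univ_two] at this

lemma smoothPeriodic (H : IsEulerSolution u ω) (t : ℝ) : SmoothPeriodic (ω t) :=
  ⟨H.2.1.comp (contDiff_const.prodMk contDiff_id :
      ContDiff ℝ (⊤ : ℕ∞) fun x : Fin 2 → ℝ => (t, x)), H.2.2.2.1 t⟩

lemma eq_curl (H : IsEulerSolution u ω) (t : ℝ) (x : Fin 2 → ℝ) :
    ω t x = pd 0 (velocity u t 1) x - pd 1 (velocity u t 0) x :=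
  H.2.2.2.2.2.2.1 t x

lemma integral_vorticity (H : IsEulerSolution u ω) (t : ℝ) : ∫ x in box 2, ω t x = 0 := by
  have hu := (H.divFree t).smoothPeriodic
  simp only [H.eq_curl]
  rw [integral_sub (integrableOn_box ((hu 1).pd 0).continuous)
    (integrableOn_box ((hu 0).pd 1).continuous), (hu 1).integral_pd, (hu 0).integral_pd, sub_zero]

lemma integral_fieldGradSq (H : IsEulerSolution u ω) (t : ℝ) :
    ∫ x in box 2, fieldGradSq (velocity u t) x = ∫ x in box 2, ω t x ^ 2 := by
  rw [(H.divFree t).integral_fieldGradSq]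
  simp only [H.eq_curl]

lemma hasDerivAt_fderiv (H : IsEulerSolution u ω) (t : ℝ) (x : Fin 2 → ℝ) :
    HasDerivAt (fun s => ω s x)
      (fderiv ℝ (fun q : ℝ × (Fin 2 → ℝ) => ω q.1 q.2) (t, x) (1, 0)) t := by
  have h1 := (H.2.1.differentiable (by simp) (t, x)).hasFDerivAt
  exact h1.comp_hasDerivAt (f := fun s : ℝ => (s, x)) t
    ((hasDerivAt_id t).prodMk (hasDerivAt_const t x))

lemma adv_eq (H : IsEulerSolution u ω) (t : ℝ) (x : Fin 2 → ℝ) :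
    adv (velocity u t) (ω t) x
      = -fderiv ℝ (fun q : ℝ × (Fin 2 → ℝ) => ω q.1 q.2) (t, x) (1, 0) := by
  have := H.2.2.2.2.2.2.2 t x
  rw [(H.hasDerivAt_fderiv t x).deriv, Fin.sum_univ_two] at this
  exact eq_neg_of_add_eq_zero_right this

lemma hasDerivAt (H : IsEulerSolution u ω) (t : ℝ) (x : Fin 2 → ℝ) :
    HasDerivAt (fun s => ω s x) (-adv (velocity u t) (ω t) x) t :=
  (H.hasDerivAt_fderiv t x).congr_deriv (by rw [H.adv_eq, neg_neg])

lemma continuous_adv (H : IsEulerSolution u ω) :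
    Continuous fun q : ℝ × (Fin 2 → ℝ) => adv (velocity u q.1) (ω q.1) q.2 := by
  simp only [H.adv_eq]
  exact ((H.2.1.continuous_fderiv (by simp)).clm_apply continuous_const).neg

lemma continuous_vorticity (H : IsEulerSolution u ω) :
    Continuous fun q : ℝ × (Fin 2 → ℝ) => ω q.1 q.2 := H.2.1.continuous

lemma integral_sq (H : IsEulerSolution u ω) (t : ℝ) :
    ∫ x in box 2, ω t x ^ 2 = ∫ x in box 2, ω 0 x ^ 2 := by
  have ca := H.continuous_adv
  have cω := H.continuous_vorticity
  have hd : ∀ s, HasDerivAt (fun s => ∫ x in box 2, ω s x ^ 2) 0 s := fun s => by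
    refine (hasDerivAt_box (F := fun s x => ω s x ^ 2)
      (F' := fun s x => -2 * (ω s x * adv (velocity u s) (ω s) x)) Filter.univ_mem
      (fun s => (H.smoothPeriodic s).continuous.pow 2)
      (by unfold Function.uncurry; fun_prop) fun r _ x => ?_).congr_deriv ?_
    · exact ((H.hasDerivAt r x).fun_pow 2).congr_deriv (by norm_num; ring)
    · rw [integral_const_mul, (H.divFree s).integral_self_mul_adv (H.smoothPeriodic s), mul_zero]
  exact is_const_of_deriv_eq_zero (fun s => (hd s).differentiableAt) (fun s => (hd s).deriv) t 0

lemma integral_pow_four (H : IsEulerSolution u ω) (t : ℝ) :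
    ∫ x in box 2, ω t x ^ 4 = ∫ x in box 2, ω 0 x ^ 4 := by
  have ca := H.continuous_adv
  have cω := H.continuous_vorticity
  have hd : ∀ s, HasDerivAt (fun s => ∫ x in box 2, ω s x ^ 4) 0 s := fun s => by
    refine (hasDerivAt_box (F := fun s x => ω s x ^ 4)
      (F' := fun s x => -4 * (ω s x ^ 3 * adv (velocity u s) (ω s) x)) Filter.univ_mem
      (fun s => (H.smoothPeriodic s).continuous.pow 4)
      (by unfold Function.uncurry; fun_prop) fun r _ x => ?_).congr_deriv ?_
    · exact ((H.hasDerivAt r x).fun_pow 4).congr_deriv (by norm_num; ring)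
    · have hω := H.smoothPeriodic s
      have h := (H.divFree s).integral_self_mul_adv (hω.mul hω)
      have e : ∀ x, ω s x * ω s x * adv (velocity u s) (fun x => ω s x * ω s x) x
          = 2 * (ω s x ^ 3 * adv (velocity u s) (ω s) x) := fun x => by
        simp only [adv, hω.pd_mul hω]
        ring
      simp only [e] at h
      rw [integral_const_mul] at h ⊢
      linarith
  exact is_const_of_deriv_eq_zero (fun s => (hd s).differentiableAt) (fun s => (hd s).deriv) t 0

lemma hasDerivAt_crossCorr (H : IsEulerSolution u ω) (t : ℝ) (z : Fin 2 → ℝ) :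
    HasDerivAt (fun s => crossCorr (ω s) (ω s) z) (-corr (adv (velocity u t) (ω t)) (ω t) z) t := by
  have ca := H.continuous_adv
  have cω := H.continuous_vorticity
  have cas := fun s => (H.divFree s).continuous_adv (H.smoothPeriodic s)
  have cωs := fun s => (H.smoothPeriodic s).continuous
  have ca' : Continuous fun q : ℝ × (Fin 2 → ℝ) => adv (velocity u q.1) (ω q.1) (q.2 + z) :=
    ca.comp (by fun_prop : Continuous fun q : ℝ × (Fin 2 → ℝ) => (q.1, q.2 + z))
  have cω' : Continuous fun q : ℝ × (Fin 2 → ℝ) => ω q.1 (q.2 + z) :=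
    cω.comp (by fun_prop : Continuous fun q : ℝ × (Fin 2 → ℝ) => (q.1, q.2 + z))
  refine (hasDerivAt_box (F := fun s x => ω s x * ω s (x + z))
      (F' := fun s x => -(adv (velocity u s) (ω s) x * ω s (x + z))
        - ω s x * adv (velocity u s) (ω s) (x + z)) Filter.univ_mem
      (fun s => by fun_prop)
      (by unfold Function.uncurry; fun_prop) fun r _ x => ?_).congr_deriv ?_
  · exact ((H.hasDerivAt r x).fun_mul (H.hasDerivAt r (x + z))).congr_deriv (by ring)
  · have hp : IsPeriodic fun x => ω t (x - z) * adv (velocity u t) (ω t) x := fun x k => by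
      have h1 := ((H.smoothPeriodic t).periodic.comp_add (-z)) x k
      simp only [← sub_eq_add_neg] at h1
      simp only [h1, (H.divFree t).adv_periodic (H.smoothPeriodic t) x k]
    have h1 := hp.setIntegral_box_comp_add z
    simp only [add_sub_cancel_right] at h1
    have h2 : corr (adv (velocity u t) (ω t)) (ω t) z
        = (∫ x in box 2, adv (velocity u t) (ω t) x * ω t (x + z))
          + ∫ x in box 2, ω t (x - z) * adv (velocity u t) (ω t) x := by
      rw [← integral_add (integrableOn_box (by fun_prop)) (integrableOn_box (by fun_prop)), corr]
      congr 1
      ext x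
      ring
    rw [integral_sub (integrableOn_box (by fun_prop)) (integrableOn_box (by fun_prop)),
      integral_neg, h1, h2]
    ring

lemma continuous_corr (H : IsEulerSolution u ω) :
    Continuous fun q : ℝ × (Fin 2 → ℝ) => corr (adv (velocity u q.1) (ω q.1)) (ω q.1) q.2 := by
  have ca := H.continuous_adv
  have cω := H.continuous_vorticity
  refine continuous_box (F := fun (q : ℝ × (Fin 2 → ℝ)) x =>
    adv (velocity u q.1) (ω q.1) x * (ω q.1 (x + q.2) + ω q.1 (x - q.2))) ?_
  unfold Function.uncurry
  exact (ca.comp (by fun_prop : Continuous fun p : (ℝ × (Fin 2 → ℝ)) × (Fin 2 → ℝ) =>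
    (p.1.1, p.2))).mul
    ((cω.comp (by fun_prop : Continuous fun p : (ℝ × (Fin 2 → ℝ)) × (Fin 2 → ℝ) =>
      (p.1.1, p.2 + p.1.2))).add
    (cω.comp (by fun_prop : Continuous fun p : (ℝ × (Fin 2 → ℝ)) × (Fin 2 → ℝ) =>
      (p.1.1, p.2 - p.1.2))))

lemma hasDerivAt_cutEnergy (H : IsEulerSolution u ω) {h : ℝ} (hh : 0 < h) (t : ℝ) :
    HasDerivAt (fun s => cutEnergy h (ω s))
      (2 * ∫ z, cutKernel h z * corr (adv (velocity u t) (ω t)) (ω t) z) t := by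
  have ck := (exists_lipschitzWith_cutKernel hh).choose_spec.continuous
  have cc := H.continuous_corr
  have hz : ∀ g : (Fin 2 → ℝ) → ℝ, ∀ z, z ∉ Metric.closedBall (0 : Fin 2 → ℝ) (1 / 2) →
      cutKernel h z * g z = 0 := fun g z hz => by
    rw [mem_closedBall_zero_iff, not_le] at hz
    rw [cutKernel_of_le (hz.le.trans (norm_le_eNorm z)), zero_mul]
  have hd : HasDerivAt (fun s => ∫ z, cutKernel h z * crossCorr (ω s) (ω s) z)
      (∫ z, cutKernel h z * -corr (adv (velocity u t) (ω t)) (ω t) z) t := by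
    have e1 : ∀ s, ∫ z, cutKernel h z * crossCorr (ω s) (ω s) z
        = ∫ z in Metric.closedBall 0 (1 / 2), cutKernel h z * crossCorr (ω s) (ω s) z := fun s =>
      (setIntegral_eq_integral_of_forall_compl_eq_zero (hz _)).symm
    rw [funext e1, ← setIntegral_eq_integral_of_forall_compl_eq_zero
      (hz fun z => -corr (adv (velocity u t) (ω t)) (ω t) z)]
    refine hasDerivAt_setIntegral (F := fun s z => cutKernel h z * crossCorr (ω s) (ω s) z)
      (F' := fun s z => cutKernel h z * -corr (adv (velocity u s) (ω s)) (ω s) z)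
      (isCompact_closedBall _ _) Metric.isClosed_closedBall.measurableSet subset_rfl Filter.univ_mem
      (fun s => ck.mul (continuous_crossCorr (H.smoothPeriodic s).continuous
        (H.smoothPeriodic s).continuous))
      (by unfold Function.uncurry; fun_prop) fun s _ z => ?_
    exact (H.hasDerivAt_crossCorr s z).const_mul _
  simp only [cutEnergy, H.integral_sq]
  refine ((hd.const_mul 2).const_sub _).congr_deriv ?_
  simp only [mul_neg, integral_neg, neg_neg]

end IsEulerSolution

lemma le_of_forall_weighted_le {Z K P Q : ℝ} (hK : 0 ≤ K) (hP : 0 ≤ P) (hQ : 0 ≤ Q)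
    (h : ∀ ε > 0, Z ≤ K * (ε * P + Q / ε)) : Z ≤ 2 * K * (√P * √Q) := by
  have hp := Real.sqrt_nonneg P
  have hq := Real.sqrt_nonneg Q
  have key : ∀ δ > 0, Z ≤ K * ((√Q + δ) * √P + √Q * (√P + δ)) := fun δ hδ => by
    refine (h ((√Q + δ) / (√P + δ)) (by positivity)).trans ?_
    refine mul_le_mul_of_nonneg_left (add_le_add ?_ ?_) hK
    · rw [div_mul_eq_mul_div, mul_div_assoc]
      refine mul_le_mul_of_nonneg_left ?_ (by positivity)
      rw [div_le_iff₀ (by positivity)]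
      nlinarith [Real.mul_self_sqrt hP, mul_nonneg hp hδ.le]
    · rw [div_div_eq_mul_div, div_le_iff₀ (by positivity)]
      have : 0 ≤ √Q * (√P + δ) * δ := by positivity
      nlinarith [Real.mul_self_sqrt hQ]
  have hc : Filter.Tendsto (fun δ : ℝ => K * ((√Q + δ) * √P + √Q * (√P + δ)))
      (nhdsWithin 0 (Set.Ioi 0)) (nhds (K * ((√Q + 0) * √P + √Q * (√P + 0)))) :=
    (Continuous.tendsto (by fun_prop) 0).mono_left nhdsWithin_le_nhds
  refine (ge_of_tendsto hc (Filter.mem_of_superset self_mem_nhdsWithin key)).trans_eq ?_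
  ring

lemma half_le_abs_log {h : ℝ} (hh : 0 < h) (hh' : h ≤ 1 / 2) : 1 / 2 ≤ |Real.log h| := by
  have h1 := Real.log_le_sub_one_of_pos hh
  rw [abs_of_nonpos (by linarith)]
  linarith

lemma log_ratio_le {h : ℝ} (hh : 0 < h) (hh' : h ≤ 1 / 2) :
    Real.log ((1 / 4 + h ^ 2 / 4) / (h ^ 2 / 4)) ≤ 3 * |Real.log h| := by
  have h1 := Real.log_le_sub_one_of_pos hh
  have h2 : 3 * |Real.log h| = Real.log (h⁻¹ ^ 3) := by
    rw [Real.log_pow, Real.log_inv, abs_of_nonpos (by linarith)]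
    norm_num
  rw [h2]
  refine Real.log_le_log (by positivity) ?_
  rw [div_le_iff₀ (by positivity), inv_pow]
  have h3 : (h ^ 3)⁻¹ * (h ^ 2 / 4) = h⁻¹ / 4 := by
    field_simp
  have h4 : 2 ≤ h⁻¹ := by
    rw [le_inv_comm₀ (by norm_num) hh]
    linarith
  rw [h3]
  nlinarith

/-- The constant in the growth bound of the logarithmic energy. -/
def growthConst : ℝ := 4 * (12 * Real.pi + kernelConst)

lemma growthConst_pos : 0 < growthConst := by
  have := kernelConst_nonneg
  have := Real.pi_pos
  unfold growthConst
  positivity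

namespace IsEulerSolution

variable {u : ℝ → (Fin 2 → ℝ) → (Fin 2 → ℝ)} {ω : ℝ → (Fin 2 → ℝ) → ℝ} {h : ℝ}

lemma abs_deriv_cutEnergy_le (H : IsEulerSolution u ω) (hh : 0 < h) (hh' : h ≤ 1 / 2) (t : ℝ) :
    |2 * ∫ z, cutKernel h z * corr (adv (velocity u t) (ω t)) (ω t) z|
      ≤ growthConst * (√|Real.log h| * √(∫ x in box 2, ω 0 x ^ 2) * √(∫ x in box 2, ω 0 x ^ 4)) := by
  have hX : 0 ≤ ∫ x in box 2, ω 0 x ^ 2 := integral_nonneg fun x => by positivity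
  have hA : 0 ≤ ∫ x in box 2, ω 0 x ^ 4 := integral_nonneg fun x => by positivity
  have hL := half_le_abs_log hh hh'
  have hκ := kernelConst_nonneg
  have key := fun ε (hε : 0 < ε) =>
    (H.divFree t).abs_integral_cutKernel_mul_corr_le (H.smoothPeriodic t) hh hε
  simp only [H.integral_fieldGradSq, H.integral_sq, H.integral_pow_four] at key
  rw [abs_mul, abs_two, ← Real.sqrt_mul (by positivity), growthConst]
  generalize ∫ x in box 2, ω 0 x ^ 2 = X at *
  generalize ∫ x in box 2, ω 0 x ^ 4 = A at *
  have := le_of_forall_weighted_le (K := 12 * Real.pi + kernelConst) (P := |Real.log h| * X)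
    (Q := A) (by positivity) (by positivity) hA fun ε hε => (key ε hε).trans ?_
  · linarith
  · have hlog := log_ratio_le hh hh'
    have e1 : ε * X * Real.log ((1 / 4 + h ^ 2 / 4) / (h ^ 2 / 4)) ≤ ε * X * (3 * |Real.log h|) := by
      gcongr
    have e2 : ε / 2 * X ≤ ε * (|Real.log h| * X) := by
      have : 0 ≤ ε * X := by positivity
      nlinarith
    have e3 : 1 / (2 * ε) * A ≤ A / ε := by
      have : 0 ≤ A / ε := by positivity
      have e : 1 / (2 * ε) * A = A / ε / 2 := by field_simp
      linarith
    calc _ ≤ 4 * Real.pi * (ε * X * (3 * |Real.log h|) + 3 * (A / ε))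
          + kernelConst * (ε * (|Real.log h| * X) + A / ε) := by
            gcongr
            rw [mul_div_assoc]
            have : 0 ≤ A / ε := by positivity
            linarith
      _ = _ := by ring

lemma cutEnergy_le (H : IsEulerSolution u ω) (hh : 0 < h) (hh' : h ≤ 1 / 2) {t : ℝ} (ht : 0 ≤ t) :
    cutEnergy h (ω t) ≤ cutEnergy h (ω 0) + growthConst * t * (√|Real.log h|
      * √(∫ x in box 2, ω 0 x ^ 2) * √(∫ x in box 2, ω 0 x ^ 4)) := by
  have := (convex_univ (𝕜 := ℝ) (E := ℝ)).norm_image_sub_le_of_norm_hasDerivWithin_le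
    (fun s _ => (H.hasDerivAt_cutEnergy hh s).hasDerivWithinAt)
    (fun s _ => H.abs_deriv_cutEnergy_le hh hh' s) (Set.mem_univ 0) (Set.mem_univ t)
  rw [sub_zero, Real.norm_of_nonneg ht] at this
  have := (le_abs_self _).trans this
  linarith

lemma jabinSqB_le (H : IsEulerSolution u ω) {t : ℝ} (ht : 0 ≤ t) :
    jabinSqB 2 (1 / 2) (ω t) ≤ jabinSqB 2 (1 / 2) (ω 0) + ENNReal.ofReal (growthConst * t
      * √(∫ x in box 2, ω 0 x ^ 2) * √(∫ x in box 2, ω 0 x ^ 4)) := by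
  refine iSup₂_le fun h ⟨hh, hh'⟩ => ?_
  have hL : 0 < |Real.log h| := (by norm_num : (0 : ℝ) < 1 / 2).trans_le (half_le_abs_log hh hh')
  have hE := fun s => lintegral_KhB_eq hh (H.smoothPeriodic s).continuous
    (H.smoothPeriodic s).periodic (H.integral_vorticity s)
  have h0 : ENNReal.ofReal (|Real.log h| ^ (-(1 / 2) : ℝ)) * ENNReal.ofReal (cutEnergy h (ω 0))
      ≤ jabinSqB 2 (1 / 2) (ω 0) := by
    rw [← hE 0]
    exact le_iSup₂_of_le h ⟨hh, hh'⟩ le_rfl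
  have hs : |Real.log h| ^ (-(1 / 2) : ℝ) * √|Real.log h| = 1 := by
    rw [Real.sqrt_eq_rpow, ← Real.rpow_add hL]
    norm_num
  rw [hE t]
  refine le_trans ?_ (add_le_add_left h0 _)
  rw [← ENNReal.ofReal_mul (by positivity), ← ENNReal.ofReal_mul (by positivity)]
  refine le_trans (ENNReal.ofReal_le_ofReal ?_) ENNReal.ofReal_add_le
  refine (mul_le_mul_of_nonneg_left (H.cutEnergy_le hh hh' ht) (by positivity)).trans_eq ?_
  linear_combination growthConst * t * √(∫ x in box 2, ω 0 x ^ 2)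
    * √(∫ x in box 2, ω 0 x ^ 4) * hs

end IsEulerSolution

lemma toReal_eLpNorm_box_pow {f : (Fin 2 → ℝ) → ℝ} (hf : Continuous f) {n : ℕ} (hn : n ≠ 0)
    (he : Even n) : (eLpNorm f n (volume.restrict (box 2))).toReal ^ n = ∫ x in box 2, f x ^ n := by
  have hi : ∀ x, ‖f x‖ ^ (n : ℝ) = f x ^ n := fun x => by
    rw [Real.rpow_natCast, Real.norm_eq_abs, he.pow_abs]
  have h0 : 0 ≤ ∫ x in box 2, f x ^ n := integral_nonneg fun x => he.pow_nonneg _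
  have hm : MemLp f n (volume.restrict (box 2)) := by
    have h1 := integrableOn_box (hf.pow n)
    refine (integrable_norm_rpow_iff hf.aestronglyMeasurable (by simpa) (by simp)).1 ?_
    simpa only [ENNReal.toReal_natCast, hi, IntegrableOn, Pi.pow_def] using h1
  rw [hm.eLpNorm_eq_integral_rpow_norm (by simpa) (by simp), ENNReal.toReal_natCast]
  simp only [hi]
  rw [ENNReal.toReal_ofReal (by positivity), Real.rpow_inv_natCast_pow h0 hn]

theorem stmt13 :
    ∃ C : ℝ, 0 < C ∧
      ∀ T : ℝ, 0 < T →
      ∀ u : ℝ → (Fin 2 → ℝ) → (Fin 2 → ℝ), ∀ ω : ℝ → (Fin 2 → ℝ) → ℝ,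
        IsEulerSolution u ω →
        ∀ t ∈ Set.Icc (0:ℝ) T,
          jabinSqB 2 (1/2) (ω t) ≤ jabinSqB 2 (1/2) (ω 0) +
            ENNReal.ofReal (C * t * (eLpNorm (ω 0) 2 (volume.restrict (box 2))).toReal *
              (eLpNorm (ω 0) 4 (volume.restrict (box 2))).toReal ^ 2) := by
  refine ⟨growthConst, growthConst_pos, fun T _ u ω H t ht => ?_⟩
  have hc := (H.smoothPeriodic 0).continuous
  have h2 := toReal_eLpNorm_box_pow hc (n := 2) (by norm_num) (by decide)
  have h4 := toReal_eLpNorm_box_pow hc (n := 4) (by norm_num) (by decide)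
  rw [Nat.cast_ofNat] at h2 h4
  have key := H.jabinSqB_le ht.1
  rwa [← h2, ← h4, Real.sqrt_sq (by positivity), show (4 : ℕ) = 2 * 2 from rfl, pow_mul,
    Real.sqrt_sq (by positivity)] at key
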